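/- Let ε(x) be a positive-valued function of x ≥ 1 that tends to 0 as x → ∞, and let a and b be nonzero integers that are multiplicatively independent. Then, as x → ∞, the number of natural numbers n ≤ x for which max{ℓ_a(n), ℓ_b(n), ℓ_{ab}(n), ℓ_{a²b}(n), ℓ_{ab²}(n)} ≤ n^{8/15 + ε(n)} is o(x). -/

import Mathlib

open Filter Asymptotics

/-- `ellc a n` is the eventual period of `a, a², a³, …` modulo `n`: the multiplicative
order of `a` modulo `n'`, where `n'` is the largest positive divisor of `n` coprime
to `a`. -/
noncomputable def ellc (a : ℤ) (n : ℕ) : ℕ :=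
  orderOf ((a : ZMod (((n.divisors.filter (fun d => Nat.Coprime d a.natAbs)).max).getD 1)))

/-- primes in the interval `(u, v]` -/
noncomputable def PI (u v : ℝ) : Finset ℕ :=
  (Finset.Icc 1 ⌊v⌋₊).filter (fun p => p.Prime ∧ u < (p : ℝ))

lemma mem_PI {u v : ℝ} {p : ℕ} : p ∈ PI u v ↔ p.Prime ∧ u < (p : ℝ) ∧ (p : ℝ) ≤ v := by
  unfold PI
  rw [Finset.mem_filter, Finset.mem_Icc]
  constructor
  · rintro ⟨⟨h1, h2⟩, h3, h4⟩
    exact ⟨h3, h4, (Nat.le_floor_iff' (by omega)).1 h2⟩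
  · rintro ⟨h1, h2, h3⟩
    exact ⟨⟨h1.one_lt.le, Nat.le_floor h3⟩, h1, h2⟩

lemma factorial_log (N : ℕ) : Real.log (N.factorial) =
    ∑ p ∈ PI 0 N, (padicValNat p N.factorial : ℝ) * Real.log p := by
  have h := Nat.prod_factorization_pow_eq_self (Nat.factorial_ne_zero N)
  have hs : N.factorial.factorization.support ⊆ PI 0 N := by
    intro p hp
    rw [Nat.support_factorization, Nat.mem_primeFactors] at hp
    rw [mem_PI]
    refine ⟨hp.1, by exact_mod_cast hp.1.pos, ?_⟩
    exact_mod_cast (hp.1.dvd_factorial).1 hp.2.1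
  rw [Finsupp.prod_of_support_subset _ hs _ (by simp)] at h
  conv_lhs => rw [← h]
  push_cast
  rw [Real.log_prod]
  · apply Finset.sum_congr rfl
    intro p hp
    rw [Real.log_pow, Nat.factorization_def _ (mem_PI.1 hp).1]
  · intro p hp
    have := (mem_PI.1 hp).1.pos
    positivity

lemma padic_fac_le (N p : ℕ) (hp : p.Prime) :
    (padicValNat p N.factorial : ℝ) ≤ N / ((p : ℝ) - 1) := by
  have := Fact.mk hp
  have h := sub_one_mul_padicValNat_factorial (p := p) N
  have h1 : (p - 1) * padicValNat p N.factorial ≤ N := by rw [h]; omega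
  have hp2 := hp.two_le
  have hp1 : (0 : ℝ) < (p : ℝ) - 1 := by
    have : (2 : ℝ) ≤ p := by exact_mod_cast hp2
    linarith
  rw [le_div_iff₀ hp1]
  have h2 : (((p - 1) * padicValNat p N.factorial : ℕ) : ℝ) ≤ N := by exact_mod_cast h1
  push_cast [Nat.cast_sub hp.one_lt.le] at h2
  linarith

lemma padic_fac_ge (N p : ℕ) (hp : p.Prime) :
    (N : ℝ) / p - 1 ≤ (padicValNat p N.factorial : ℝ) := by
  have := Fact.mk hp
  have h1 : N / p ≤ padicValNat p N.factorial := by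
    rw [padicValNat_factorial (b := N + 1) (by
      exact Nat.lt_succ_of_le (Nat.log_le_self _ _))]
    rcases Nat.eq_zero_or_pos N with h | h
    · simp [h]
    · calc N / p = N / p ^ 1 := by simp
        _ ≤ _ := Finset.single_le_sum (f := fun i => N / p ^ i) (fun _ _ => Nat.zero_le _)
          (by simp; omega)
  have h2 : ((N / p : ℕ) : ℝ) ≤ padicValNat p N.factorial := by exact_mod_cast h1
  have h3 := Nat.lt_floor_add_one ((N : ℝ) / p)
  rw [Nat.floor_div_eq_div] at h3
  linarith

lemma theta_PI (N : ℕ) : ∑ p ∈ PI 0 N, Real.log p ≤ Real.log 4 * N := by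
  have := Chebyshev.theta_le_log4_mul_x (x := N) (by positivity)
  refine le_trans (le_of_eq ?_) this
  rw [Chebyshev.theta_eq_sum_Icc]
  apply Finset.sum_congr _ (fun _ _ => rfl)
  ext p
  rw [mem_PI]
  simp only [Finset.mem_filter, Finset.mem_Icc, Nat.floor_natCast]
  constructor
  · rintro ⟨h1, h2, h3⟩; exact ⟨⟨by omega, by exact_mod_cast h3⟩, h1⟩
  · rintro ⟨h1, h2⟩; exact ⟨h2, by exact_mod_cast h2.pos, by exact_mod_cast h1.2⟩

lemma sum_log_sq_bound : ∃ C : ℝ, 0 ≤ C ∧ ∀ N : ℕ,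
    ∑ p ∈ PI 0 N, (Real.log p / ((p : ℝ) - 1) - Real.log p / p) ≤ C := by
  have hsum : Summable (fun n : ℕ => 1 / (n : ℝ) ^ (3 / 2 : ℝ)) :=
    Real.summable_one_div_nat_rpow.2 (by norm_num)
  refine ⟨∑' n : ℕ, 4 * (1 / (n : ℝ) ^ (3 / 2 : ℝ)), tsum_nonneg (fun n => by positivity), ?_⟩
  intro N
  refine le_trans (Finset.sum_le_sum (g := fun n : ℕ => 4 * (1 / (n : ℝ) ^ (3 / 2 : ℝ))) ?_)
    ((hsum.mul_left 4).sum_le_tsum _ (fun n _ => by positivity))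
  intro p hp
  have hp' := (mem_PI.1 hp).1
  have h2 : (2 : ℝ) ≤ p := by exact_mod_cast hp'.two_le
  have hlog : Real.log p ≤ (p : ℝ) ^ (1 / 2 : ℝ) / (1 / 2) :=
    Real.log_le_rpow_div (by positivity) (by norm_num)
  have hl0 : 0 ≤ Real.log p := Real.log_nonneg (by linarith)
  have e1 : Real.log p / ((p : ℝ) - 1) - Real.log p / p = Real.log p / (p * (p - 1)) := by
    have : (p : ℝ) - 1 ≠ 0 := by linarith
    field_simp
    ring
  rw [e1]
  have e2 : (p : ℝ) ^ (3 / 2 : ℝ) * (p : ℝ) ^ (1 / 2 : ℝ) = p ^ 2 := by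
    rw [← Real.rpow_add (by linarith)]; norm_num
  have hpos : 0 < (p : ℝ) ^ (3 / 2 : ℝ) := by positivity
  have hh : (p:ℝ)^2 / 2 ≤ p * (p - 1) := by nlinarith
  calc Real.log p / (p * (p - 1)) ≤ ((p : ℝ) ^ (1 / 2 : ℝ) / (1 / 2)) / ((p:ℝ)^2 / 2) := by
        gcongr
    _ = 4 * (1 / (p : ℝ) ^ (3 / 2 : ℝ)) := by
        rw [← e2]; field_simp; norm_num

lemma mertens_nat : ∃ C : ℝ, 0 ≤ C ∧ ∀ N : ℕ, 1 ≤ N →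
    |∑ p ∈ PI 0 N, Real.log p / p - Real.log N| ≤ C := by
  obtain ⟨C, hC0, hC⟩ := sum_log_sq_bound
  refine ⟨C + 4, by linarith, ?_⟩
  intro N hN
  have hNr : (1 : ℝ) ≤ N := by exact_mod_cast hN
  have hN0 : (0 : ℝ) < N := by linarith
  have hlog4 : Real.log 4 ≤ 3 := by
    have := Real.log_le_sub_one_of_pos (show (0:ℝ) < 4 by norm_num)
    linarith
  have hfac := factorial_log N
  have hlp : ∀ p ∈ PI 0 N, 0 ≤ Real.log p := fun p hp =>
    Real.log_nonneg (by exact_mod_cast (mem_PI.1 hp).1.one_lt.le)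
  -- lower
  have h1 : N * ∑ p ∈ PI 0 N, Real.log p / p - ∑ p ∈ PI 0 N, Real.log p
      ≤ Real.log N.factorial := by
    rw [hfac, Finset.mul_sum, ← Finset.sum_sub_distrib]
    apply Finset.sum_le_sum
    intro p hp
    have := mul_le_mul_of_nonneg_right (padic_fac_ge N p (mem_PI.1 hp).1) (hlp p hp)
    calc _ = ((N : ℝ) / p - 1) * Real.log p := by ring
      _ ≤ _ := this
  have h2 : Real.log N.factorial ≤ N * ∑ p ∈ PI 0 N, Real.log p / p + N * C := by
    have := hC N
    rw [Finset.sum_sub_distrib] at this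
    calc Real.log N.factorial ≤ ∑ p ∈ PI 0 N, N * (Real.log p / ((p : ℝ) - 1)) := by
          rw [hfac]
          apply Finset.sum_le_sum
          intro p hp
          have := mul_le_mul_of_nonneg_right (padic_fac_le N p (mem_PI.1 hp).1) (hlp p hp)
          calc _ ≤ _ := this
            _ = _ := by ring
      _ = N * ∑ p ∈ PI 0 N, (Real.log p / ((p : ℝ) - 1)) := by rw [Finset.mul_sum]
      _ ≤ _ := by
        rw [← mul_add]
        gcongr
        linarith
  have h3 : Real.log N.factorial ≤ N * Real.log N := by
    have : (N.factorial : ℝ) ≤ (N : ℝ) ^ N := by exact_mod_cast Nat.factorial_le_pow N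
    calc _ ≤ Real.log ((N : ℝ) ^ N) := Real.log_le_log (by positivity) this
      _ = _ := by rw [Real.log_pow]
  have h4 : N * Real.log N - N ≤ Real.log N.factorial := by
    have h5 : (N : ℝ) ^ N / N.factorial ≤ Real.exp N := by
      exact Real.pow_div_factorial_le_exp N (by positivity) N
    have h6 := Real.log_le_log (by positivity) h5
    rw [Real.log_exp, Real.log_div (by positivity) (by positivity), Real.log_pow] at h6
    linarith
  have h5 := theta_PI N
  set S := ∑ p ∈ PI 0 N, Real.log p / p
  rw [abs_le]
  constructor
  · have : N * (Real.log N - 1) ≤ N * (S + C) := by nlinarith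
    have := le_of_mul_le_mul_left this hN0
    linarith
  · have : N * S ≤ N * (Real.log N + 3) := by nlinarith
    have := le_of_mul_le_mul_left this hN0
    linarith

lemma PI_floor (v : ℝ) (hv : 0 ≤ v) : PI 0 v = PI 0 (⌊v⌋₊ : ℕ) := by
  unfold PI; simp

/-- Mertens' first theorem on intervals. -/
lemma mertens : ∃ C : ℝ, 1 ≤ C ∧ ∀ u v : ℝ, 1 ≤ u → u ≤ v →
    |∑ p ∈ PI u v, Real.log p / p - (Real.log v - Real.log u)| ≤ C := by
  obtain ⟨C, hC0, hC⟩ := mertens_nat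
  have key : ∀ v : ℝ, 1 ≤ v → |∑ p ∈ PI 0 v, Real.log p / p - Real.log v| ≤ C + 1 := by
    intro v hv
    rw [PI_floor v (by linarith)]
    have hf : 1 ≤ ⌊v⌋₊ := Nat.le_floor (by simpa using hv)
    have h1 := hC _ hf
    have hfr : (1 : ℝ) ≤ (⌊v⌋₊ : ℝ) := by exact_mod_cast hf
    have h2 : Real.log (⌊v⌋₊ : ℝ) ≤ Real.log v :=
      Real.log_le_log (by linarith) (Nat.floor_le (by linarith))
    have h3 : Real.log v ≤ Real.log (⌊v⌋₊ : ℝ) + 1 := by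
      have hlt := Nat.lt_floor_add_one v
      have : v ≤ 2 * (⌊v⌋₊ : ℝ) := by linarith
      have h4 := Real.log_le_log (by linarith) this
      rw [Real.log_mul (by norm_num) (by linarith)] at h4
      have : Real.log 2 ≤ 1 := by
        have := Real.log_two_lt_d9; linarith
      linarith
    rw [abs_le] at h1 ⊢
    constructor <;> linarith
  refine ⟨2 * (C + 1), by linarith, ?_⟩
  intro u v hu huv
  have hsplit : PI 0 v = PI 0 u ∪ PI u v := by
    ext p
    simp only [Finset.mem_union, mem_PI]
    constructor
    · rintro ⟨h1, h2, h3⟩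
      by_cases h : u < p
      · right; exact ⟨h1, h, h3⟩
      · left; exact ⟨h1, h2, not_lt.1 h⟩
    · rintro (⟨h1, h2, h3⟩ | ⟨h1, h2, h3⟩)
      · exact ⟨h1, h2, by linarith⟩
      · exact ⟨h1, by linarith, h3⟩
  have hdisj : Disjoint (PI 0 u) (PI u v) := by
    rw [Finset.disjoint_left]
    intro p h1 h2
    have := (mem_PI.1 h1).2.2
    have := (mem_PI.1 h2).2.1
    linarith
  have e : ∑ p ∈ PI 0 v, Real.log p / p = ∑ p ∈ PI 0 u, Real.log p / p
      + ∑ p ∈ PI u v, Real.log p / p := by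
    rw [hsplit, Finset.sum_union hdisj]
  have h1 := key u hu
  have h2 := key v (by linarith)
  rw [e] at h2
  rw [abs_le] at h1 h2 ⊢
  constructor <;> linarith

lemma sum_PI_split (f : ℕ → ℝ) {u v w : ℝ} (huv : u ≤ v) (hvw : v ≤ w) :
    ∑ p ∈ PI u w, f p = ∑ p ∈ PI u v, f p + ∑ p ∈ PI v w, f p := by
  have hsplit : PI u w = PI u v ∪ PI v w := by
    ext p
    simp only [Finset.mem_union, mem_PI]
    constructor
    · rintro ⟨h1, h2, h3⟩
      by_cases h : v < p
      · right; exact ⟨h1, h, h3⟩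
      · left; exact ⟨h1, h2, not_lt.1 h⟩
    · rintro (⟨h1, h2, h3⟩ | ⟨h1, h2, h3⟩)
      · exact ⟨h1, h2, by linarith⟩
      · exact ⟨h1, by linarith, h3⟩
  have hdisj : Disjoint (PI u v) (PI v w) := by
    rw [Finset.disjoint_left]
    intro p h1 h2
    have := (mem_PI.1 h1).2.2
    have := (mem_PI.1 h2).2.1
    linarith
  rw [hsplit, Finset.sum_union hdisj]

lemma recip_le {u v : ℝ} (hu : 1 < u) :
    ∑ p ∈ PI u v, 1 / (p : ℝ) ≤ (∑ p ∈ PI u v, Real.log p / p) / Real.log u := by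
  rw [Finset.sum_div]
  apply Finset.sum_le_sum
  intro p hp
  obtain ⟨h1, h2, h3⟩ := mem_PI.1 hp
  have hl : 0 < Real.log u := Real.log_pos hu
  have hl2 : Real.log u ≤ Real.log p := Real.log_le_log (by linarith) h2.le
  have hp0 : (0 : ℝ) < p := by linarith
  rw [div_div, div_le_div_iff₀ hp0 (by positivity)]
  nlinarith

lemma recip_ge {u v : ℝ} (hu : 1 < u) (hv : 1 < v) :
    (∑ p ∈ PI u v, Real.log p / p) / Real.log v ≤ ∑ p ∈ PI u v, 1 / (p : ℝ) := by
  rw [Finset.sum_div]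
  apply Finset.sum_le_sum
  intro p hp
  obtain ⟨h1, h2, h3⟩ := mem_PI.1 hp
  have hl : 0 < Real.log v := Real.log_pos hv
  have hp0 : (0 : ℝ) < p := by linarith
  have hl2 : Real.log p ≤ Real.log v := Real.log_le_log hp0 h3
  rw [div_div, div_le_div_iff₀ (by positivity) hp0]
  nlinarith

/-- the exponents used for the roughness threshold -/
noncomputable def th (J : ℕ) : ℝ := (1 / 10) * (10 / 11) ^ J

lemma th_pos (J : ℕ) : 0 < th J := by unfold th; positivity
lemma th_succ (J : ℕ) : th J = (11 / 10) * th (J + 1) := by unfold th; rw [pow_succ]; ring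
lemma th_le (J : ℕ) : th J ≤ 1 / 10 := by
  unfold th
  have : ((10 : ℝ) / 11) ^ J ≤ 1 := pow_le_one₀ (by norm_num) (by norm_num)
  linarith

lemma ev_log_ge (B : ℝ) : ∀ᶠ x : ℝ in atTop, B ≤ Real.log x :=
  Real.tendsto_log_atTop.eventually_ge_atTop B

lemma recip_block (J : ℕ) : ∀ᶠ x : ℝ in atTop,
    (0.09 : ℝ) * J ≤ ∑ p ∈ PI (x ^ th J) (x ^ (1 / 10 : ℝ)), 1 / (p : ℝ) ∧
    ∑ p ∈ PI (x ^ th J) (x ^ (1 / 10 : ℝ)), 1 / (p : ℝ) ≤ (0.101 : ℝ) * J := by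
  induction J with
  | zero =>
    filter_upwards with x
    have : PI (x ^ th 0) (x ^ (1 / 10 : ℝ)) = ∅ := by
      ext p
      simp only [mem_PI, th, pow_zero, mul_one]
      simp
    rw [this]; simp
  | succ J ih =>
    obtain ⟨C, hC1, hC⟩ := mertens
    have htp := th_pos (J + 1)
    filter_upwards [ih, eventually_gt_atTop 1, ev_log_ge (2000 * C / th (J + 1))] with x hx hx1 hl
    have hts := th_succ J
    set w := x ^ th (J + 1) with hw
    have hw1 : 1 < w := Real.one_lt_rpow hx1 htp
    have hlw : Real.log w = th (J + 1) * Real.log x := Real.log_rpow (by linarith) _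
    have hlv : Real.log (x ^ th J) = th J * Real.log x := Real.log_rpow (by linarith) _
    have hwv : w ≤ x ^ th J := Real.rpow_le_rpow_of_exponent_le hx1.le (by linarith)
    have hv1 : 1 < x ^ th J := by linarith
    have hvt : x ^ th J ≤ x ^ (1 / 10 : ℝ) := Real.rpow_le_rpow_of_exponent_le hx1.le (th_le J)
    rw [sum_PI_split _ hwv hvt]
    have hm := hC w (x ^ th J) hw1.le hwv
    have hbig : 2000 * C ≤ Real.log w := by
      rw [hlw]; rw [div_le_iff₀ htp] at hl; linarith
    have hlv' : Real.log (x ^ th J) = 1.1 * Real.log w := by rw [hlv, hts, hlw]; ring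
    rw [hlv', abs_le] at hm
    have h1 := recip_le (u := w) (v := x ^ th J) hw1
    have h2 := recip_ge (u := w) (v := x ^ th J) hw1 hv1
    rw [hlv'] at h2
    have hlwp : 0 < Real.log w := by linarith
    have h3 : (∑ p ∈ PI w (x ^ th J), Real.log p / p) / Real.log w ≤ 0.101 := by
      rw [div_le_iff₀ hlwp]; linarith
    have h4 : 0.09 ≤ (∑ p ∈ PI w (x ^ th J), Real.log p / p) / (1.1 * Real.log w) := by
      rw [le_div_iff₀ (by linarith)]; linarith
    push_cast
    constructor <;> linarith

lemma recip_top : ∀ᶠ x : ℝ in atTop,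
    ∑ p ∈ PI (x ^ (1 / 10 : ℝ)) x, 1 / (p : ℝ) ≤ 10 := by
  obtain ⟨C, hC1, hC⟩ := mertens
  filter_upwards [eventually_gt_atTop 1, ev_log_ge (10 * C)] with x hx1 hl
  have hw1 : 1 < x ^ (1 / 10 : ℝ) := Real.one_lt_rpow hx1 (by norm_num)
  have hlw : Real.log (x ^ (1 / 10 : ℝ)) = (1 / 10) * Real.log x := Real.log_rpow (by linarith) _
  have hwx : x ^ (1 / 10 : ℝ) ≤ x := by
    conv_rhs => rw [← Real.rpow_one x]
    exact Real.rpow_le_rpow_of_exponent_le hx1.le (by norm_num)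
  have hm := hC _ x hw1.le hwx
  rw [hlw, abs_le] at hm
  refine (recip_le hw1).trans ?_
  rw [hlw, div_le_iff₀ (by linarith)]
  linarith

lemma pi_lower : ∃ A c : ℝ, 2 ≤ A ∧ 0 < c ∧ ∀ᶠ x : ℝ in atTop,
    c * x / Real.log x ≤ (PI (x / A) x).card := by
  obtain ⟨C, hC1, hC⟩ := mertens
  refine ⟨Real.exp (C + 1), Real.exp (-(C+1)), ?_, by positivity, ?_⟩
  · have := Real.add_one_le_exp (C + 1); linarith
  set A := Real.exp (C + 1) with hA
  have hA1 : 1 < A := by rw [hA]; exact Real.one_lt_exp_iff.2 (by linarith)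
  filter_upwards [eventually_ge_atTop A, eventually_gt_atTop 1] with x hxA hx1
  have hx0 : 0 < x := by linarith
  have h1 : 1 ≤ x / A := by rw [le_div_iff₀ (by linarith)]; linarith
  have h2 : x / A ≤ x := div_le_self (by linarith) hA1.le
  have hm := hC _ x h1 h2
  rw [Real.log_div (by linarith) (by linarith), hA, Real.log_exp, ← hA, abs_le] at hm
  have h3 : ∑ p ∈ PI (x / A) x, Real.log p / p ≤
      ∑ p ∈ PI (x / A) x, Real.log x * A / x := by
    apply Finset.sum_le_sum
    intro p hp
    obtain ⟨g1, g2, g3⟩ := mem_PI.1 hp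
    have hp0 : (0 : ℝ) < p := by linarith
    have hll : Real.log p ≤ Real.log x := Real.log_le_log hp0 g3
    have hl0 : 0 < Real.log x := Real.log_pos hx1
    rw [div_lt_iff₀ (by linarith)] at g2
    rw [div_le_div_iff₀ hp0 hx0]
    calc Real.log p * x ≤ Real.log x * (p * A) := by gcongr
      _ = _ := by ring
  rw [Finset.sum_const, nsmul_eq_mul] at h3
  have hl0 : 0 < Real.log x := Real.log_pos hx1
  rw [div_le_iff₀ hl0, Real.exp_neg, ← hA, ← div_eq_inv_mul, div_le_iff₀ (by linarith)]
  have : 1 ≤ (PI (x / A) x).card * (Real.log x * A / x) := by linarith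
  rw [← mul_div_assoc, le_div_iff₀ hx0] at this
  linarith

namespace Sel

/-- real valued Moebius -/
noncomputable def mu (l : ℕ) : ℝ := ((ArithmeticFunction.moebius l : ℤ) : ℝ)

lemma abs_mu_le (l : ℕ) : |mu l| ≤ 1 := by
  unfold mu
  have := ArithmeticFunction.abs_moebius_le_one (n := l)
  exact_mod_cast this

noncomputable def GG (R : ℕ) : ℝ := ∑ l ∈ Finset.Icc 1 R, |mu l| / l

noncomputable def HH (R : ℕ) : ℝ := ∑ l ∈ Finset.Icc 1 R, 1 / (l : ℝ)

noncomputable def yy (R l : ℕ) : ℝ := if l ≤ R then mu l / (l * GG R) else 0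

noncomputable def lam (R d : ℕ) : ℝ :=
  d * ∑ l ∈ (Finset.Icc 1 R).filter (fun l => d ∣ l), mu (l / d) * yy R l

lemma GG_pos {R : ℕ} (hR : 1 ≤ R) : 0 < GG R := by
  unfold GG
  apply Finset.sum_pos'
  · intro i hi; positivity
  · exact ⟨1, by simp [hR], by simp [mu]⟩

lemma sum_mu_between (l m : ℕ) (hl : 1 ≤ l) (R : ℕ) (hm : m ∈ Finset.Icc 1 R) :
    ∑ d ∈ (Finset.Icc 1 R).filter (fun d => l ∣ d ∧ d ∣ m), mu (m / d)
      = if m = l then 1 else 0 := by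
  rw [Finset.mem_Icc] at hm
  by_cases hlm : l ∣ m
  · obtain ⟨k, rfl⟩ := hlm
    have hk : k ≠ 0 := by rintro rfl; simp at hm
    have h1 : ∑ d ∈ (Finset.Icc 1 R).filter (fun d => l ∣ d ∧ d ∣ l * k), mu (l * k / d)
        = ∑ e ∈ k.divisors, mu (k / e) := by
      symm
      apply Finset.sum_bij (fun e _ => l * e)
      · intro e he
        rw [Nat.mem_divisors] at he
        have he0 : 0 < e := Nat.pos_of_dvd_of_pos he.1 (Nat.pos_of_ne_zero hk)
        have : l * e ≤ l * k := Nat.mul_le_mul_left _ (Nat.le_of_dvd (Nat.pos_of_ne_zero hk) he.1)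
        simp only [Finset.mem_filter, Finset.mem_Icc]
        exact ⟨⟨Nat.mul_pos hl he0, by omega⟩, dvd_mul_right _ _, Nat.mul_dvd_mul_left _ he.1⟩
      · intro e1 _ e2 _ h
        exact Nat.eq_of_mul_eq_mul_left hl h
      · intro d hd
        simp only [Finset.mem_filter, Finset.mem_Icc] at hd
        obtain ⟨_, ⟨e, rfl⟩, h3⟩ := hd
        exact ⟨e, by rw [Nat.mem_divisors]; exact ⟨Nat.dvd_of_mul_dvd_mul_left hl h3, hk⟩, rfl⟩
      · intro e he
        rw [Nat.mul_div_mul_left _ _ hl]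
    rw [h1, Nat.sum_div_divisors k mu]
    have h2 : ∑ e ∈ k.divisors, mu e = if k = 1 then 1 else 0 := by
      have := ArithmeticFunction.coe_mul_zeta_apply (f := ArithmeticFunction.moebius) (x := k)
      rw [ArithmeticFunction.moebius_mul_coe_zeta, ArithmeticFunction.one_apply] at this
      unfold mu
      rw [← Int.cast_sum, ← this]
      split_ifs <;> simp
    rw [h2]
    have : (k = 1) ↔ (l * k = l) := by
      constructor
      · rintro rfl; simp
      · intro h; exact Nat.eq_of_mul_eq_mul_left hl (by omega)
    simp only [this]
  · have : (Finset.Icc 1 R).filter (fun d => l ∣ d ∧ d ∣ m) = ∅ := by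
      apply Finset.filter_eq_empty_iff.2
      rintro d _ ⟨h1, h2⟩
      exact hlm (h1.trans h2)
    rw [this, if_neg]
    · simp
    · rintro rfl; exact hlm dvd_rfl

lemma sum_lam (R l : ℕ) (hl : 1 ≤ l) :
    ∑ d ∈ (Finset.Icc 1 R).filter (fun d => l ∣ d), lam R d / d = yy R l := by
  have h1 : ∑ d ∈ (Finset.Icc 1 R).filter (fun d => l ∣ d), lam R d / d
      = ∑ m ∈ Finset.Icc 1 R, yy R m *
        ∑ d ∈ (Finset.Icc 1 R).filter (fun d => l ∣ d ∧ d ∣ m), mu (m / d) := by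
    calc _ = ∑ d ∈ (Finset.Icc 1 R).filter (fun d => l ∣ d),
          ∑ m ∈ (Finset.Icc 1 R).filter (fun m => d ∣ m), mu (m / d) * yy R m := by
          apply Finset.sum_congr rfl
          intro d hd
          simp only [Finset.mem_filter, Finset.mem_Icc] at hd
          have : (d : ℝ) ≠ 0 := by
            have : d ≠ 0 := by omega
            exact_mod_cast this
          unfold lam
          field_simp
      _ = ∑ d ∈ Finset.Icc 1 R, ∑ m ∈ Finset.Icc 1 R,
            if l ∣ d ∧ d ∣ m then mu (m / d) * yy R m else 0 := by
          rw [Finset.sum_filter]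
          apply Finset.sum_congr rfl
          intro d hd
          split_ifs with h
          · rw [Finset.sum_filter]
            simp [h]
          · simp [h]
      _ = _ := by
          rw [Finset.sum_comm]
          apply Finset.sum_congr rfl
          intro m hm
          rw [Finset.mul_sum, Finset.sum_filter]
          apply Finset.sum_congr rfl
          intro d hd
          split_ifs <;> ring
  rw [h1]
  rw [Finset.sum_congr rfl (fun m hm => by rw [sum_mu_between l m hl R hm])]
  by_cases h : l ≤ R
  · rw [Finset.sum_eq_single l]
    · simp
    · intro m _ hne; simp [hne]
    · intro hn; exact absurd (Finset.mem_Icc.2 ⟨hl, h⟩) hn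
  · have : yy R l = 0 := by unfold yy; rw [if_neg h]
    rw [this]
    apply Finset.sum_eq_zero
    intro m hm
    rw [Finset.mem_Icc] at hm
    rw [if_neg (by omega)]
    simp

lemma lam_one {R : ℕ} (hR : 1 ≤ R) : lam R 1 = 1 := by
  have hG := GG_pos hR
  unfold lam
  simp only [one_dvd, Finset.filter_true, Nat.cast_one, one_mul, Nat.div_one]
  have : ∀ l ∈ Finset.Icc 1 R, mu l * yy R l = (|mu l| / l) / GG R := by
    intro l hl
    rw [Finset.mem_Icc] at hl
    unfold yy
    rw [if_pos hl.2]
    have h0 : (l : ℝ) ≠ 0 := by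
      have : l ≠ 0 := by omega
      exact_mod_cast this
    have : mu l * mu l = |mu l| := by
      unfold mu
      rcases ArithmeticFunction.moebius_eq_or l with h | h | h <;> simp [h]
    field_simp
    rw [← this]; ring
  rw [Finset.sum_congr rfl this, ← Finset.sum_div]
  exact div_self hG.ne'

lemma abs_mu_mul_le (d k : ℕ) : |mu (d * k)| ≤ |mu k| := by
  unfold mu
  by_cases h : Squarefree k
  · have h2 : |ArithmeticFunction.moebius k| = 1 := ArithmeticFunction.abs_moebius_eq_one_of_squarefree h
    have h1 := ArithmeticFunction.abs_moebius_le_one (n := d * k)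
    have : |ArithmeticFunction.moebius (d * k)| ≤ |ArithmeticFunction.moebius k| := by rw [h2]; exact h1
    exact_mod_cast this
  · have : ¬ Squarefree (d * k) := fun hs => h (hs.squarefree_of_dvd (dvd_mul_left _ _))
    rw [ArithmeticFunction.moebius_eq_zero_of_not_squarefree this]
    simp

lemma abs_lam_le {R : ℕ} (hR : 1 ≤ R) (d : ℕ) : |lam R d| ≤ 1 := by
  have hG := GG_pos hR
  rcases Nat.eq_zero_or_pos d with hd | hd
  · subst hd; simp [lam]
  have hdr : (0 : ℝ) < d := by exact_mod_cast hd
  unfold lam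
  rw [abs_mul, abs_of_pos hdr]
  have h1 : |∑ l ∈ (Finset.Icc 1 R).filter (fun l => d ∣ l), mu (l / d) * yy R l| ≤
      ∑ l ∈ (Finset.Icc 1 R).filter (fun l => d ∣ l), |mu (l / d)| / (l * GG R) := by
    refine (Finset.abs_sum_le_sum_abs _ _).trans (Finset.sum_le_sum ?_)
    intro l hl
    simp only [Finset.mem_filter, Finset.mem_Icc] at hl
    unfold yy
    rw [if_pos hl.1.2, abs_mul, abs_div, ← mul_div_assoc]
    have hl0 : (0:ℝ) < l := by exact_mod_cast hl.1.1
    rw [abs_of_pos (show (0 : ℝ) < l * GG R by positivity)]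
    gcongr
    calc |mu (l / d)| * |mu l| ≤ |mu (l / d)| * 1 := by gcongr; exact abs_mu_le l
      _ = _ := by ring
  have h2 : ∑ l ∈ (Finset.Icc 1 R).filter (fun l => d ∣ l), |mu (l / d)| / (l * GG R)
      ≤ ∑ k ∈ Finset.Icc 1 R, |mu k| / ((d * k : ℕ) * GG R) := by
    have hsub : (Finset.Icc 1 R).filter (fun l => d ∣ l) ⊆ (Finset.Icc 1 R).image (fun k => d * k) := by
      intro l hl
      simp only [Finset.mem_filter, Finset.mem_Icc] at hl
      obtain ⟨h1, k, rfl⟩ := hl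
      have hk : 1 ≤ k := Nat.pos_of_ne_zero (by rintro rfl; simp at h1)
      have : k ≤ d * k := Nat.le_mul_of_pos_left _ hd
      exact Finset.mem_image.2 ⟨k, Finset.mem_Icc.2 ⟨hk, by omega⟩, rfl⟩
    calc _ ≤ ∑ l ∈ (Finset.Icc 1 R).image (fun k => d * k), |mu (l / d)| / (l * GG R) := by
          apply Finset.sum_le_sum_of_subset_of_nonneg hsub
          intro l _ _
          positivity
      _ = ∑ k ∈ Finset.Icc 1 R, |mu (d * k / d)| / ((d * k : ℕ) * GG R) := by
          rw [Finset.sum_image]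
          intro a _ b _ h
          exact Nat.eq_of_mul_eq_mul_left hd h
      _ = _ := by
          apply Finset.sum_congr rfl
          intro k _
          rw [Nat.mul_div_cancel_left _ hd]
  calc _ ≤ d * ∑ k ∈ Finset.Icc 1 R, |mu k| / ((d * k : ℕ) * GG R) := by
        gcongr; exact h1.trans h2
    _ = ∑ k ∈ Finset.Icc 1 R, (|mu k| / k) / GG R := by
        rw [Finset.mul_sum]
        apply Finset.sum_congr rfl
        intro k hk
        rw [Finset.mem_Icc] at hk
        have hk0 : (0:ℝ) < k := by exact_mod_cast hk.1
        push_cast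
        field_simp
    _ = 1 := by rw [← Finset.sum_div]; exact div_self hG.ne'
    _ ≤ 1 := le_rfl

/-- bilinear gcd identity -/
lemma bilin (R : ℕ) (f g : ℕ → ℝ) :
    ∑ d ∈ Finset.Icc 1 R, ∑ e ∈ Finset.Icc 1 R, f d * g e / (Nat.lcm d e : ℝ)
      = ∑ l ∈ Finset.Icc 1 R, (Nat.totient l : ℝ) *
        (∑ d ∈ (Finset.Icc 1 R).filter (fun d => l ∣ d), f d / d) *
        (∑ d ∈ (Finset.Icc 1 R).filter (fun d => l ∣ d), g d / d) := by
  have h1 : ∀ d ∈ Finset.Icc 1 R, ∀ e ∈ Finset.Icc 1 R,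
      f d * g e / (Nat.lcm d e : ℝ) = ∑ l ∈ Finset.Icc 1 R,
        if l ∣ d ∧ l ∣ e then (Nat.totient l : ℝ) * (f d / d) * (g e / e) else 0 := by
    intro d hd e he
    rw [Finset.mem_Icc] at hd he
    have hd0 : (d : ℝ) ≠ 0 := by
      have : d ≠ 0 := by omega
      exact_mod_cast this
    have he0 : (e : ℝ) ≠ 0 := by
      have : e ≠ 0 := by omega
      exact_mod_cast this
    have hg : (Nat.gcd d e : ℝ) = ∑ l ∈ Finset.Icc 1 R,
        if l ∣ d ∧ l ∣ e then (Nat.totient l : ℝ) else 0 := by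
      have := Nat.sum_totient (Nat.gcd d e)
      rw [← this]
      push_cast
      rw [← Finset.sum_filter]
      apply Finset.sum_congr _ (fun _ _ => rfl)
      ext l
      simp only [Nat.mem_divisors, Finset.mem_filter, Finset.mem_Icc, Nat.dvd_gcd_iff]
      constructor
      · rintro ⟨⟨a, b⟩, c⟩
        have := Nat.le_of_dvd (by omega) a
        have := Nat.pos_of_dvd_of_pos a (by omega)
        exact ⟨⟨by omega, by omega⟩, a, b⟩
      · rintro ⟨_, a, b⟩
        refine ⟨⟨a, b⟩, ?_⟩
        have := Nat.gcd_pos_of_pos_left e (show 0 < d by omega)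
        omega
    have hgl : (Nat.gcd d e : ℝ) * (Nat.lcm d e : ℝ) = d * e := by
      exact_mod_cast Nat.gcd_mul_lcm d e
    have hl0 : (Nat.lcm d e : ℝ) ≠ 0 := by
      have : Nat.lcm d e ≠ 0 := Nat.lcm_ne_zero (by omega) (by omega)
      exact_mod_cast this
    calc f d * g e / (Nat.lcm d e : ℝ) = (Nat.gcd d e : ℝ) * ((f d / d) * (g e / e)) := by
          field_simp
          linear_combination (-f d * g e) * hgl
      _ = _ := by
          rw [hg, Finset.sum_mul]
          apply Finset.sum_congr rfl
          intro l _
          split_ifs <;> ring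
  rw [Finset.sum_congr rfl (fun d hd => Finset.sum_congr rfl (fun e he => h1 d hd e he))]
  rw [Finset.sum_congr rfl (fun d _ => Finset.sum_comm), Finset.sum_comm]
  apply Finset.sum_congr rfl
  intro l _
  rw [mul_assoc, Finset.sum_mul_sum, Finset.mul_sum, Finset.sum_filter]
  apply Finset.sum_congr rfl
  intro d _
  split_ifs with h
  · rw [Finset.mul_sum, Finset.sum_filter]
    apply Finset.sum_congr rfl
    intro e _
    simp only [h, true_and]
    split_ifs <;> ring
  · simp [h]

/-- quadratic form restricted to `d` coprime to `D`. -/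
noncomputable def TT (R D : ℕ) : ℝ :=
  ∑ d ∈ Finset.Icc 1 R, ∑ e ∈ Finset.Icc 1 R,
    (if Nat.Coprime d D then lam R d else 0) * (if Nat.Coprime e D then lam R e else 0)
      / (Nat.lcm d e : ℝ)

lemma TT_one_nonneg (R D : ℕ) : 0 ≤ TT R D := by
  unfold TT
  rw [bilin R (fun d => if Nat.Coprime d D then lam R d else 0)
    (fun d => if Nat.Coprime d D then lam R d else 0)]
  apply Finset.sum_nonneg
  intro l _
  rw [mul_assoc]
  exact mul_nonneg (by positivity) (mul_self_nonneg _)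

lemma quad_le {R : ℕ} (hR : 1 ≤ R) (K : ℝ) (f : ℕ → ℝ)
    (hf : ∀ l ∈ Finset.Icc 1 R, |∑ d ∈ (Finset.Icc 1 R).filter (fun d => l ∣ d), f d / d|
      ≤ K * (|mu l| / (l * GG R))) :
    ∑ d ∈ Finset.Icc 1 R, ∑ e ∈ Finset.Icc 1 R, f d * f e / (Nat.lcm d e : ℝ) ≤ K ^ 2 / GG R := by
  have hG := GG_pos hR
  rw [bilin]
  have : ∀ l ∈ Finset.Icc 1 R, (Nat.totient l : ℝ) *
        (∑ d ∈ (Finset.Icc 1 R).filter (fun d => l ∣ d), f d / d) *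
        (∑ d ∈ (Finset.Icc 1 R).filter (fun d => l ∣ d), f d / d)
        ≤ (K ^ 2 / (GG R) ^ 2) * (|mu l| / l) := by
    intro l hl
    have h := hf l hl
    rw [Finset.mem_Icc] at hl
    have hl0 : (0:ℝ) < l := by exact_mod_cast hl.1
    set A := ∑ d ∈ (Finset.Icc 1 R).filter (fun d => l ∣ d), f d / d
    have h2 : A * A ≤ (K * (|mu l| / (l * GG R))) * (K * (|mu l| / (l * GG R))) := by
      rw [← abs_mul_abs_self A]
      have := abs_nonneg A
      exact mul_self_le_mul_self this h
    have h3 : (Nat.totient l : ℝ) ≤ l := by exact_mod_cast Nat.totient_le l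
    have h4 : |mu l| * |mu l| ≤ |mu l| := by
      have := abs_mu_le l
      have := abs_nonneg (mu l)
      nlinarith
    calc (Nat.totient l : ℝ) * A * A = (Nat.totient l : ℝ) * (A * A) := by ring
      _ ≤ l * ((K * (|mu l| / (l * GG R))) * (K * (|mu l| / (l * GG R)))) := by
          apply mul_le_mul h3 h2 (mul_self_nonneg _) hl0.le
      _ = (K ^ 2 / (GG R) ^ 2) * ((|mu l| * |mu l|) / l) := by field_simp
      _ ≤ _ := by gcongr
  refine (Finset.sum_le_sum this).trans ?_
  rw [← Finset.mul_sum]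
  change K ^ 2 / (GG R) ^ 2 * GG R ≤ _
  apply le_of_eq
  field_simp

lemma abs_yy {R l : ℕ} (hR : 1 ≤ R) (hl : 1 ≤ l) : |yy R l| ≤ |mu l| / (l * GG R) := by
  have hG := GG_pos hR
  have hl0 : (0:ℝ) < l := by exact_mod_cast hl
  unfold yy
  split_ifs
  · rw [abs_div, abs_of_pos (show (0:ℝ) < l * GG R by positivity)]
  · rw [abs_zero]; positivity

lemma TT_one_le {R : ℕ} (hR : 1 ≤ R) : TT R 1 ≤ 1 / GG R := by
  unfold TT
  have := quad_le hR 1 (fun d => if Nat.Coprime d 1 then lam R d else 0) (by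
    intro l hl
    rw [Finset.mem_Icc] at hl
    simp only [Nat.coprime_one_right_iff, if_true]
    rw [sum_lam R l hl.1, one_mul]
    exact abs_yy hR hl.1)
  simpa using this

lemma TT_prime_le {R : ℕ} (hR : 1 ≤ R) (q : ℕ) (hq : q.Prime) : TT R q ≤ 4 / GG R := by
  have hG := GG_pos hR
  unfold TT
  have := quad_le hR 2 (fun d => if Nat.Coprime d q then lam R d else 0) (by
    intro l hl
    rw [Finset.mem_Icc] at hl
    have hl0 : (0:ℝ) < l := by exact_mod_cast hl.1
    by_cases hql : q ∣ l
    · rw [Finset.sum_eq_zero]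
      · rw [abs_zero]; positivity
      · intro d hd
        simp only [Finset.mem_filter] at hd
        have : ¬ Nat.Coprime d q := by
          intro h
          have := Nat.Coprime.eq_one_of_dvd h.symm (hql.trans hd.2)
          exact hq.one_lt.ne' this
        simp [this]
    · have hcop : Nat.Coprime l q := ((Nat.Prime.coprime_iff_not_dvd hq).2 hql).symm
      have e : ∑ d ∈ (Finset.Icc 1 R).filter (fun d => l ∣ d),
          (if Nat.Coprime d q then lam R d else 0) / d = yy R l - yy R (l * q) := by
        rw [← sum_lam R l hl.1, ← sum_lam R (l * q) (Nat.mul_pos hl.1 hq.pos)]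
        rw [eq_sub_iff_add_eq]
        rw [Finset.sum_filter, Finset.sum_filter, Finset.sum_filter, ← Finset.sum_add_distrib]
        apply Finset.sum_congr rfl
        intro d _
        by_cases h1 : l ∣ d
        · by_cases h2 : q ∣ d
          · have h3 : ¬ Nat.Coprime d q := by
              intro h
              exact hq.one_lt.ne' (Nat.Coprime.eq_one_of_dvd h.symm h2)
            have h4 : l * q ∣ d := Nat.Coprime.mul_dvd_of_dvd_of_dvd hcop h1 h2
            simp [h1, h3, h4]
          · have h3 : Nat.Coprime d q := ((Nat.Prime.coprime_iff_not_dvd hq).2 h2).symm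
            have h4 : ¬ l * q ∣ d := fun h => h2 ((dvd_mul_left _ _).trans h)
            rw [if_pos h1, if_pos h3, if_neg h4, if_pos h1, add_zero]
        · have h4 : ¬ l * q ∣ d := fun h => h1 ((dvd_mul_right _ _).trans h)
          simp [h1, h4]
      rw [e]
      have h1 := abs_yy hR hl.1
      have h2 := abs_yy hR (l := l * q) (Nat.mul_pos hl.1 hq.pos)
      have h3 : |mu (l * q)| / ((l * q : ℕ) * GG R) ≤ |mu l| / (l * GG R) := by
        have hlq : (l : ℝ) ≤ (l * q : ℕ) := by
          exact_mod_cast Nat.le_mul_of_pos_right _ hq.pos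
        have := abs_mu_mul_le q l
        rw [mul_comm] at this
        gcongr
      calc _ ≤ |yy R l| + |yy R (l * q)| := abs_sub _ _
        _ ≤ _ := by linarith)
  refine this.trans (le_of_eq (by norm_num))

end Sel

namespace Sel

lemma HH_nonneg (R : ℕ) : 0 ≤ HH R := by unfold HH; positivity

lemma sum_mult_le (R m : ℕ) (hm : 1 ≤ m) :
    ∑ d ∈ (Finset.Icc 1 R).filter (fun d => m ∣ d), 1 / (d : ℝ) ≤ HH R / m := by
  have hsub : (Finset.Icc 1 R).filter (fun l => m ∣ l) ⊆ (Finset.Icc 1 R).image (fun k => m * k) := by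
    intro l hl
    simp only [Finset.mem_filter, Finset.mem_Icc] at hl
    obtain ⟨h1, k, rfl⟩ := hl
    have hk : 1 ≤ k := Nat.pos_of_ne_zero (by rintro rfl; simp at h1)
    have : k ≤ m * k := Nat.le_mul_of_pos_left _ hm
    exact Finset.mem_image.2 ⟨k, Finset.mem_Icc.2 ⟨hk, by omega⟩, rfl⟩
  calc _ ≤ ∑ l ∈ (Finset.Icc 1 R).image (fun k => m * k), 1 / (l : ℝ) := by
        apply Finset.sum_le_sum_of_subset_of_nonneg hsub
        intro l _ _
        positivity
    _ = ∑ k ∈ Finset.Icc 1 R, 1 / ((m * k : ℕ) : ℝ) := by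
        rw [Finset.sum_image]
        intro a _ b _ h
        exact Nat.eq_of_mul_eq_mul_left hm h
    _ = HH R / m := by
        unfold HH
        rw [Finset.sum_div]
        apply Finset.sum_congr rfl
        intro k _
        push_cast
        rw [div_div, mul_comm]

lemma U_le (R q : ℕ) (hq : q.Prime) :
    ∑ d ∈ Finset.Icc 1 R, ∑ e ∈ Finset.Icc 1 R,
      (if q ∣ d then (1:ℝ) else 0) * 1 / (Nat.lcm d e : ℝ) ≤ 2 * HH R ^ 3 / q := by
  have hH := HH_nonneg R
  have hq0 : (0:ℝ) < q := by exact_mod_cast hq.pos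
  rw [bilin R (fun d => if q ∣ d then (1:ℝ) else 0) (fun _ => 1)]
  have h1 : ∀ l ∈ Finset.Icc 1 R, (Nat.totient l : ℝ) *
        (∑ d ∈ (Finset.Icc 1 R).filter (fun d => l ∣ d), (if q ∣ d then (1:ℝ) else 0) / d) *
        (∑ d ∈ (Finset.Icc 1 R).filter (fun d => l ∣ d), 1 / (d:ℝ)) ≤
        HH R ^ 2 * ((1 / l) / q + if q ∣ l then 1 / (l : ℝ) else 0) := by
    intro l hl
    rw [Finset.mem_Icc] at hl
    have hl0 : (0:ℝ) < l := by exact_mod_cast hl.1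
    have hB := sum_mult_le R l hl.1
    have hA : ∑ d ∈ (Finset.Icc 1 R).filter (fun d => l ∣ d), (if q ∣ d then (1:ℝ) else 0) / d
        ≤ HH R * ((1 / l) / q + if q ∣ l then 1 / (l : ℝ) else 0) := by
      by_cases h : q ∣ l
      · calc _ ≤ ∑ d ∈ (Finset.Icc 1 R).filter (fun d => l ∣ d), 1 / (d : ℝ) := by
              apply Finset.sum_le_sum
              intro d _
              gcongr
              split_ifs <;> norm_num
          _ ≤ HH R / l := hB
          _ = HH R * (1 / l) := by ring
          _ ≤ _ := by
              rw [if_pos h]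
              gcongr
              have : 0 ≤ (1 / (l:ℝ)) / q := by positivity
              linarith
      · have hcop : Nat.Coprime l q := ((Nat.Prime.coprime_iff_not_dvd hq).2 h).symm
        calc _ = ∑ d ∈ (Finset.Icc 1 R).filter (fun d => l * q ∣ d), 1 / (d : ℝ) := by
              rw [Finset.sum_filter, Finset.sum_filter]
              apply Finset.sum_congr rfl
              intro d _
              by_cases h1 : l ∣ d
              · by_cases h2 : q ∣ d
                · have h4 : l * q ∣ d := Nat.Coprime.mul_dvd_of_dvd_of_dvd hcop h1 h2
                  rw [if_pos h1, if_pos h2, if_pos h4]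
                · have h4 : ¬ l * q ∣ d := fun h => h2 ((dvd_mul_left _ _).trans h)
                  rw [if_pos h1, if_neg h2, if_neg h4, zero_div]
              · have h4 : ¬ l * q ∣ d := fun h => h1 ((dvd_mul_right _ _).trans h)
                rw [if_neg h1, if_neg h4]
          _ ≤ HH R / (l * q : ℕ) := sum_mult_le R _ (Nat.mul_pos hl.1 hq.pos)
          _ = HH R * ((1 / l) / q + 0) := by push_cast; field_simp; ring
          _ = _ := by rw [if_neg h]
    have hφ : (Nat.totient l : ℝ) ≤ l := by exact_mod_cast Nat.totient_le l
    have hE : 0 ≤ ((1 / (l:ℝ)) / q + if q ∣ l then 1 / (l : ℝ) else 0) := by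
      split_ifs <;> positivity
    set E := ((1 / (l:ℝ)) / q + if q ∣ l then 1 / (l : ℝ) else 0)
    calc _ ≤ (l : ℝ) * (HH R * E) * (HH R / l) := by
          gcongr
      _ = HH R ^ 2 * E := by field_simp
  refine (Finset.sum_le_sum h1).trans ?_
  rw [← Finset.mul_sum, Finset.sum_add_distrib, ← Finset.sum_div, ← Finset.sum_filter]
  have h2 := sum_mult_le R q hq.pos
  calc _ ≤ HH R ^ 2 * (HH R / q + HH R / q) := by
        gcongr
        exact le_rfl
    _ = _ := by ring

lemma TT_diff {R : ℕ} (hR : 1 ≤ R) (D : ℕ) (hD : D ≠ 0) :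
    |TT R D - TT R 1| ≤ ∑ q ∈ D.primeFactors, 4 * HH R ^ 3 / q := by
  have key : ∀ d ∈ Finset.Icc 1 R, ∀ e ∈ Finset.Icc 1 R,
      |(if Nat.Coprime d D then lam R d else 0) * (if Nat.Coprime e D then lam R e else 0)
      / (Nat.lcm d e : ℝ) - (if Nat.Coprime d 1 then lam R d else 0) *
        (if Nat.Coprime e 1 then lam R e else 0) / (Nat.lcm d e : ℝ)| ≤
      ∑ q ∈ D.primeFactors, ((if q ∣ d then (1:ℝ) else 0) * 1 / (Nat.lcm d e : ℝ) +
        (if q ∣ e then (1:ℝ) else 0) * 1 / (Nat.lcm e d : ℝ)) := by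
    intro d hd e he
    have hnn : 0 ≤ ∑ q ∈ D.primeFactors, ((if q ∣ d then (1:ℝ) else 0) * 1 / (Nat.lcm d e : ℝ) +
        (if q ∣ e then (1:ℝ) else 0) * 1 / (Nat.lcm e d : ℝ)) := by
      apply Finset.sum_nonneg
      intro q _
      split_ifs <;> positivity
    have hprod : |lam R d * lam R e / (Nat.lcm d e : ℝ)| ≤ 1 / (Nat.lcm d e : ℝ) := by
      rw [abs_div, abs_mul, Nat.abs_cast]
      gcongr
      have h1 := abs_lam_le hR d
      have h2 := abs_lam_le hR e
      have := mul_le_mul h1 h2 (abs_nonneg _) zero_le_one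
      linarith
    by_cases hc : Nat.Coprime d D ∧ Nat.Coprime e D
    · rw [if_pos hc.1, if_pos hc.2, if_pos (Nat.coprime_one_right _), if_pos (Nat.coprime_one_right _), sub_self, abs_zero]
      exact hnn
    · have e1 : (if Nat.Coprime d D then lam R d else 0) * (if Nat.Coprime e D then lam R e else 0)
        / (Nat.lcm d e : ℝ) = 0 := by
        by_cases h1 : Nat.Coprime d D
        · have : ¬ Nat.Coprime e D := fun h => hc ⟨h1, h⟩
          rw [if_neg this]; simp
        · rw [if_neg h1]; simp
      rw [e1]
      simp only [Nat.coprime_one_right_iff, if_true, zero_sub, abs_neg]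
      refine hprod.trans ?_
      have hex : ∃ q ∈ D.primeFactors, q ∣ d ∨ q ∣ e := by
        rw [not_and_or] at hc
        rcases hc with h | h
        · obtain ⟨q, hq, h1, h2⟩ := Nat.Prime.not_coprime_iff_dvd.1 h
          exact ⟨q, Nat.mem_primeFactors.2 ⟨hq, h2, hD⟩, Or.inl h1⟩
        · obtain ⟨q, hq, h1, h2⟩ := Nat.Prime.not_coprime_iff_dvd.1 h
          exact ⟨q, Nat.mem_primeFactors.2 ⟨hq, h2, hD⟩, Or.inr h1⟩
      obtain ⟨q, hq, hqd⟩ := hex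
      refine le_trans ?_ (Finset.single_le_sum (f := fun q => ((if q ∣ d then (1:ℝ) else 0) * 1 / (Nat.lcm d e : ℝ) +
        (if q ∣ e then (1:ℝ) else 0) * 1 / (Nat.lcm e d : ℝ))) (fun i _ => by split_ifs <;> positivity) hq)
      rcases hqd with h | h
      · simp only [h, if_true]
        have : 0 ≤ (if q ∣ e then (1:ℝ) else 0) * 1 / (Nat.lcm e d : ℝ) := by
          split_ifs <;> positivity
        linarith
      · simp only [h, if_true]
        have : 0 ≤ (if q ∣ d then (1:ℝ) else 0) * 1 / (Nat.lcm d e : ℝ) := by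
          split_ifs <;> positivity
        rw [Nat.lcm_comm e d]
        linarith
  unfold TT
  rw [← Finset.sum_sub_distrib]
  rw [Finset.sum_congr rfl (fun d _ => (Finset.sum_sub_distrib _ _).symm)]
  calc _ ≤ ∑ d ∈ Finset.Icc 1 R, ∑ e ∈ Finset.Icc 1 R, ∑ q ∈ D.primeFactors,
        ((if q ∣ d then (1:ℝ) else 0) * 1 / (Nat.lcm d e : ℝ) +
        (if q ∣ e then (1:ℝ) else 0) * 1 / (Nat.lcm e d : ℝ)) := by
        refine (Finset.abs_sum_le_sum_abs _ _).trans (Finset.sum_le_sum fun d hd => ?_)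
        exact (Finset.abs_sum_le_sum_abs _ _).trans (Finset.sum_le_sum fun e he => key d hd e he)
    _ = ∑ q ∈ D.primeFactors, ((∑ d ∈ Finset.Icc 1 R, ∑ e ∈ Finset.Icc 1 R,
          (if q ∣ d then (1:ℝ) else 0) * 1 / (Nat.lcm d e : ℝ)) +
          ∑ d ∈ Finset.Icc 1 R, ∑ e ∈ Finset.Icc 1 R,
          (if q ∣ e then (1:ℝ) else 0) * 1 / (Nat.lcm e d : ℝ)) := by
        rw [Finset.sum_congr rfl (fun d _ => Finset.sum_comm), Finset.sum_comm]
        apply Finset.sum_congr rfl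
        intro q _
        simp only [Finset.sum_add_distrib]
    _ ≤ _ := by
        apply Finset.sum_le_sum
        intro q hq
        have hqp := Nat.prime_of_mem_primeFactors hq
        have h1 := U_le R q hqp
        have h2 := h1
        rw [Finset.sum_comm] at h2
        rw [Finset.sum_comm (s := Finset.Icc 1 R) (t := Finset.Icc 1 R)
          (f := fun d e => (if q ∣ e then (1:ℝ) else 0) * 1 / (Nat.lcm e d : ℝ))]
        calc _ ≤ 2 * HH R ^ 3 / q + 2 * HH R ^ 3 / q := add_le_add h1 h1
          _ = _ := by ring

/-- `G ≥ (log R)/2`. -/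
lemma GG_ge (R : ℕ) : Real.log (R + 1) / 2 ≤ GG R := by
  have h1 : Real.log (R + 1) ≤ HH R := by
    have := log_add_one_le_harmonic R
    rw [harmonic_eq_sum_Icc] at this
    unfold HH
    push_cast at this
    simpa using this
  have h2 : HH R ≤ GG R * 2 := by
    have hb : ∑ t ∈ Finset.Icc 1 R, 1 / (t : ℝ) ^ 2 ≤ 2 := by
      have := sum_Ioo_inv_sq_le (α := ℝ) 1 (R + 1)
      rcases Nat.eq_zero_or_pos R with h | h
      · simp [h]
      have e : Finset.Icc 1 R = insert 1 (Finset.Ioo 1 (R + 1)) := by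
        ext k; simp only [Finset.mem_Icc, Finset.mem_insert, Finset.mem_Ioo]; omega
      rw [e, Finset.sum_insert (by simp)]
      norm_num at this ⊢
      linarith
    have hG0 : 0 ≤ GG R := by unfold GG; positivity
    calc HH R ≤ ∑ x ∈ (Finset.Icc 1 R) ×ˢ (Finset.Icc 1 R), (|mu x.1| / x.1) * (1 / (x.2 : ℝ) ^ 2) := by
          unfold HH
          choose sq sf hsf using fun n : ℕ => Nat.sq_mul_squarefree n
          have hmem : ∀ n ∈ Finset.Icc 1 R, 1 ≤ sq n ∧ sq n ≤ R ∧ 1 ≤ sf n ∧ sf n ≤ R := by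
            intro n hn
            rw [Finset.mem_Icc] at hn
            have h := hsf n
            have ha : sq n ≠ 0 := by intro h0; simp [h0] at h
            have hb : sf n ≠ 0 := by intro h0; simp [h0] at h; omega
            have h3 : sq n ≤ n := by
              conv_rhs => rw [← h.1]
              exact Nat.le_mul_of_pos_left _ (by positivity)
            have h4 : sf n ≤ n := by
              conv_rhs => rw [← h.1]
              calc sf n ≤ sf n ^ 2 := Nat.le_self_pow (by norm_num) _
                _ ≤ _ := Nat.le_mul_of_pos_right _ (by omega)
            omega
          have : ∑ n ∈ Finset.Icc 1 R, 1 / (n : ℝ) = ∑ x ∈ (Finset.Icc 1 R).image (fun n => (sq n, sf n)),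
              (|mu x.1| / x.1) * (1 / (x.2 : ℝ) ^ 2) := by
            rw [Finset.sum_image]
            · apply Finset.sum_congr rfl
              intro n hn
              have h := hsf n
              have hmu : |mu (sq n)| = 1 := by
                unfold mu
                have := ArithmeticFunction.abs_moebius_eq_one_of_squarefree h.2
                exact_mod_cast this
              have hc : (n : ℝ) = (sf n : ℝ) ^ 2 * sq n := by exact_mod_cast h.1.symm
              simp only [hmu]
              rw [hc]
              have := hmem n hn
              have : (0:ℝ) < sq n := by exact_mod_cast this.1
              have : (0:ℝ) < sf n := by exact_mod_cast (hmem n hn).2.2.1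
              field_simp
            · intro a _ b _ hab
              simp only [Prod.mk.injEq] at hab
              rw [← (hsf a).1, ← (hsf b).1, hab.1, hab.2]
          rw [this]
          apply Finset.sum_le_sum_of_subset_of_nonneg
          · intro x hx
            obtain ⟨n, hn, rfl⟩ := Finset.mem_image.1 hx
            have := hmem n hn
            simp only [Finset.mem_product, Finset.mem_Icc]
            omega
          · intro x _ _
            positivity
      _ = GG R * ∑ t ∈ Finset.Icc 1 R, 1 / (t : ℝ) ^ 2 := by
          unfold GG
          rw [Finset.sum_mul_sum, Finset.sum_product]
      _ ≤ GG R * 2 := by gcongr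
  linarith

lemma HH_le (R : ℕ) : HH R ≤ 1 + Real.log R := by
  have := harmonic_le_one_add_log R
  rw [harmonic_eq_sum_Icc] at this
  unfold HH
  push_cast at this
  simpa using this

end Sel

namespace Sel

lemma cnt_mod (N M r : ℕ) (hM : 0 < M) :
    |((((Finset.Ioc 0 N).filter (fun n => n ≡ r [MOD M])).card : ℕ) : ℝ) - (N : ℝ) / M| ≤ 1 := by
  have h := Nat.Ioc_filter_modEq_card 0 N hM r
  have h1 : (0:ℤ) ≤ ⌊((N:ℚ) - r) / M⌋ - ⌊(((0:ℕ):ℚ) - r) / M⌋ := by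
    rw [sub_nonneg]
    apply Int.floor_le_floor
    gcongr
    simp
  rw [max_eq_left h1] at h
  have f1 := Int.floor_le (((N:ℚ) - r) / M)
  have f2 := Int.lt_floor_add_one (((N:ℚ) - r) / M)
  have f3 := Int.floor_le ((((0:ℕ):ℚ) - r) / M)
  have f4 := Int.lt_floor_add_one ((((0:ℕ):ℚ) - r) / M)
  have h2 : (((((Finset.Ioc 0 N).filter (fun n => n ≡ r [MOD M])).card : ℕ) : ℤ) : ℚ) =
     (⌊((N:ℚ) - r) / M⌋:ℚ) - ⌊(((0:ℕ):ℚ) - r) / M⌋ := by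
    rw [h]; push_cast; rfl
  have h3 : ((N:ℚ) - r) / M - (((0:ℕ):ℚ) - r) / M = (N:ℚ) / M := by
    push_cast; ring
  have : |((((Finset.Ioc 0 N).filter (fun n => n ≡ r [MOD M])).card : ℕ) : ℚ) - (N : ℚ) / M| ≤ 1 := by
    rw [abs_le]
    push_cast at h2 ⊢
    rw [h2]
    push_cast at *
    constructor <;> linarith
  have h5 : (((|((((Finset.Ioc 0 N).filter (fun n => n ≡ r [MOD M])).card : ℕ) : ℚ) - (N : ℚ) / M|) : ℚ) : ℝ) ≤ ((1:ℚ):ℝ) :=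
    Rat.cast_le.2 this
  push_cast at h5
  exact h5

noncomputable def nu (R n : ℕ) : ℝ := (∑ d ∈ Finset.Icc 1 R, if d ∣ n then lam R d else 0) ^ 2

lemma nu_nonneg (R n : ℕ) : 0 ≤ nu R n := sq_nonneg _

lemma nu_prime {R p : ℕ} (hR : 1 ≤ R) (hp : p.Prime) (hpR : R < p) : nu R p = 1 := by
  unfold nu
  rw [Finset.sum_eq_single 1]
  · simp [lam_one hR]
  · intro d hd h1
    rw [Finset.mem_Icc] at hd
    rw [if_neg]
    intro h
    rcases (Nat.dvd_prime hp).1 h with h | h <;> omega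
  · intro h; simp [hR] at h

noncomputable def WW (R D N : ℕ) : ℝ :=
  ∑ n ∈ (Finset.Ioc 0 N).filter (fun n => n ≡ 1 [MOD D]), nu R n

lemma cnt_pair (N D d e : ℕ) (hD : 0 < D) (hd : 0 < d) (he : 0 < e) :
    |((((Finset.Ioc 0 N).filter (fun n => n ≡ 1 [MOD D] ∧ d ∣ n ∧ e ∣ n)).card : ℕ) : ℝ)
      - (N : ℝ) / D * (if Nat.Coprime d D then 1 else 0) * (if Nat.Coprime e D then 1 else 0)
        / (Nat.lcm d e : ℝ)| ≤ 1 := by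
  have hno : ∀ c, ¬ Nat.Coprime c D → ∀ n, n ≡ 1 [MOD D] → ¬ c ∣ n := by
    intro c hc n hn hcn
    obtain ⟨q, hq, h1, h2⟩ := Nat.Prime.not_coprime_iff_dvd.1 hc
    have h3 : n ≡ 1 [MOD q] := hn.of_dvd h2
    have h4 : n ≡ 0 [MOD q] := (Nat.modEq_zero_iff_dvd.2 (h1.trans hcn))
    have h5 : 1 ≡ 0 [MOD q] := h3.symm.trans h4
    exact hq.one_lt.ne' (Nat.dvd_one.1 (Nat.modEq_zero_iff_dvd.1 h5))
  by_cases h1 : Nat.Coprime d D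
  · by_cases h2 : Nat.Coprime e D
    · rw [if_pos h1, if_pos h2]
      have hl : Nat.Coprime D (Nat.lcm d e) := by
        exact Nat.Coprime.coprime_dvd_right (Nat.lcm_dvd_mul d e) (Nat.Coprime.mul_right h1.symm h2.symm)
      have hl0 : 0 < Nat.lcm d e := Nat.lcm_pos hd he
      obtain ⟨k, hk1, hk2⟩ := Nat.chineseRemainder hl 1 0
      have hset : (Finset.Ioc 0 N).filter (fun n => n ≡ 1 [MOD D] ∧ d ∣ n ∧ e ∣ n) =
          (Finset.Ioc 0 N).filter (fun n => n ≡ k [MOD (D * Nat.lcm d e)]) := by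
        apply Finset.filter_congr
        intro n _
        rw [← Nat.modEq_and_modEq_iff_modEq_mul hl]
        constructor
        · rintro ⟨ha, hb, hc⟩
          exact ⟨ha.trans hk1.symm, (Nat.modEq_zero_iff_dvd.2 (Nat.lcm_dvd hb hc)).trans hk2.symm⟩
        · rintro ⟨ha, hb⟩
          have := Nat.modEq_zero_iff_dvd.1 (hb.trans hk2)
          exact ⟨ha.trans hk1, (Nat.dvd_lcm_left d e).trans this, (Nat.dvd_lcm_right d e).trans this⟩
      rw [hset]
      have := cnt_mod N (D * Nat.lcm d e) k (by positivity)
      convert this using 3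
      push_cast
      rw [mul_one, mul_one, div_div]
    · rw [if_neg h2, Finset.filter_eq_empty_iff.2]
      · simp
      · rintro n _ ⟨ha, _, hc⟩; exact hno e h2 n ha hc
  · rw [if_neg h1, Finset.filter_eq_empty_iff.2]
    · simp
    · rintro n _ ⟨ha, hc, _⟩; exact hno d h1 n ha hc

lemma WW_est {R : ℕ} (hR : 1 ≤ R) (D N : ℕ) (hD : 0 < D) :
    |WW R D N - (N : ℝ) / D * TT R D| ≤ (R : ℝ) ^ 2 := by
  have e1 : WW R D N = ∑ d ∈ Finset.Icc 1 R, ∑ e ∈ Finset.Icc 1 R, lam R d * lam R e *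
      (((Finset.Ioc 0 N).filter (fun n => n ≡ 1 [MOD D] ∧ d ∣ n ∧ e ∣ n)).card : ℕ) := by
    unfold WW nu
    simp only [sq, Finset.sum_mul_sum]
    rw [Finset.sum_comm]
    apply Finset.sum_congr rfl
    intro d _
    rw [Finset.sum_comm]
    apply Finset.sum_congr rfl
    intro e _
    rw [Finset.card_filter, Nat.cast_sum, Finset.mul_sum, Finset.sum_filter]
    apply Finset.sum_congr rfl
    intro n _
    by_cases h1 : n ≡ 1 [MOD D] <;> by_cases h2 : d ∣ n <;> by_cases h3 : e ∣ n <;> simp [h1, h2, h3]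
  rw [e1]
  unfold TT
  rw [Finset.mul_sum, ← Finset.sum_sub_distrib]
  refine (Finset.abs_sum_le_sum_abs _ _).trans ?_
  have : ∀ d ∈ Finset.Icc 1 R, |∑ e ∈ Finset.Icc 1 R, lam R d * lam R e *
      (((Finset.Ioc 0 N).filter (fun n => n ≡ 1 [MOD D] ∧ d ∣ n ∧ e ∣ n)).card : ℕ) -
      (N : ℝ) / D * ∑ e ∈ Finset.Icc 1 R, (if Nat.Coprime d D then lam R d else 0) *
        (if Nat.Coprime e D then lam R e else 0) / (Nat.lcm d e : ℝ)| ≤ R := by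
    intro d hd
    rw [Finset.mul_sum, ← Finset.sum_sub_distrib]
    refine (Finset.abs_sum_le_sum_abs _ _).trans ?_
    have : ∀ e ∈ Finset.Icc 1 R, |lam R d * lam R e *
      (((Finset.Ioc 0 N).filter (fun n => n ≡ 1 [MOD D] ∧ d ∣ n ∧ e ∣ n)).card : ℕ) -
      (N : ℝ) / D * ((if Nat.Coprime d D then lam R d else 0) *
        (if Nat.Coprime e D then lam R e else 0) / (Nat.lcm d e : ℝ))| ≤ 1 := by
      intro e he
      rw [Finset.mem_Icc] at hd he
      have h := cnt_pair N D d e hD (by omega) (by omega)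
      have e2 : lam R d * lam R e *
        (((Finset.Ioc 0 N).filter (fun n => n ≡ 1 [MOD D] ∧ d ∣ n ∧ e ∣ n)).card : ℕ) -
        (N : ℝ) / D * ((if Nat.Coprime d D then lam R d else 0) *
        (if Nat.Coprime e D then lam R e else 0) / (Nat.lcm d e : ℝ)) =
        lam R d * lam R e * ((((Finset.Ioc 0 N).filter (fun n => n ≡ 1 [MOD D] ∧ d ∣ n ∧ e ∣ n)).card : ℕ)
      - (N : ℝ) / D * (if Nat.Coprime d D then 1 else 0) * (if Nat.Coprime e D then 1 else 0)
        / (Nat.lcm d e : ℝ)) := by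
        split_ifs <;> ring
      rw [e2, abs_mul, abs_mul]
      have h1 := abs_lam_le hR d
      have h2 := abs_lam_le hR e
      have h3 := mul_le_mul h1 h2 (abs_nonneg _) zero_le_one
      have h4 := mul_le_mul h3 h (abs_nonneg _) (by norm_num)
      linarith
    refine (Finset.sum_le_sum this).trans ?_
    simp
  refine (Finset.sum_le_sum this).trans ?_
  simp [sq]

end Sel

lemma sum_le_sum_inj {α β : Type*} [DecidableEq β] {s : Finset α} {t : Finset β} {f : α → ℝ} {g : β → ℝ}
    (i : α → β) (hinj : Set.InjOn i s) (hmem : ∀ x ∈ s, i x ∈ t) (hle : ∀ x ∈ s, f x ≤ g (i x))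
    (hg : ∀ y ∈ t, 0 ≤ g y) : ∑ x ∈ s, f x ≤ ∑ y ∈ t, g y := by
  calc ∑ x ∈ s, f x ≤ ∑ x ∈ s, g (i x) := Finset.sum_le_sum hle
    _ = ∑ y ∈ s.image i, g y := (Finset.sum_image hinj).symm
    _ ≤ _ := Finset.sum_le_sum_of_subset_of_nonneg (Finset.image_subset_iff.2 hmem)
      (fun y hy _ => hg y hy)

/-- abstract second moment inequality -/
lemma variance_abs (S : Finset ℕ) (ν : ℕ → ℝ) (Q : Finset ℕ) (E : ℕ → ℕ → Prop) [∀ q n, Decidable (E q n)]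
    (g : ℕ → ℝ) (X δ ρ L : ℝ) (hg : ∀ q ∈ Q, 0 ≤ g q) (hL : L = ∑ q ∈ Q, g q)
    (hρ : 0 ≤ ρ) (hδ : 0 ≤ δ)  (hX : 0 ≤ X)
    (h1 : ∑ n ∈ S, ν n ≤ X + ρ)
    (h2 : ∀ q ∈ Q, (X - δ) * g q - ρ ≤ ∑ n ∈ S.filter (fun n => E q n), ν n)
    (h2' : ∀ q ∈ Q, ∑ n ∈ S.filter (fun n => E q n), ν n ≤ (X + δ) * g q + ρ)
    (h3 : ∀ q ∈ Q, ∀ q' ∈ Q, q ≠ q' →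
      ∑ n ∈ S.filter (fun n => E q n ∧ E q' n), ν n ≤ (X + δ) * (g q * g q') + ρ) :
    ∑ n ∈ S, ν n * (((Q.filter (fun q => E q n)).card : ℝ) - L) ^ 2 ≤
      X * L + δ * (3 * L ^ 2 + L) + ρ * ((Q.card + L) ^ 2 + Q.card) := by
  have hL0 : 0 ≤ L := by rw [hL]; exact Finset.sum_nonneg hg
  have e1 : ∑ n ∈ S, ν n * (((Q.filter (fun q => E q n)).card : ℝ) - L) ^ 2 =
     ∑ q ∈ Q, ∑ q' ∈ Q, ∑ n ∈ S.filter (fun n => E q n ∧ E q' n), ν n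
       - 2 * L * ∑ q ∈ Q, ∑ n ∈ S.filter (fun n => E q n), ν n + L ^ 2 * ∑ n ∈ S, ν n := by
    have a1 : ∑ q ∈ Q, ∑ n ∈ S.filter (fun n => E q n), ν n =
        ∑ n ∈ S, ν n * ((Q.filter (fun q => E q n)).card : ℝ) := by
      simp only [Finset.sum_filter]
      rw [Finset.sum_comm]
      apply Finset.sum_congr rfl
      intro n _
      rw [Finset.card_filter, Nat.cast_sum, Finset.mul_sum]
      apply Finset.sum_congr rfl
      intro q _
      split_ifs <;> simp
    have a2 : ∑ q ∈ Q, ∑ q' ∈ Q, ∑ n ∈ S.filter (fun n => E q n ∧ E q' n), ν n =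
        ∑ n ∈ S, ν n * (((Q.filter (fun q => E q n)).card : ℝ) * ((Q.filter (fun q => E q n)).card : ℝ)) := by
      simp only [Finset.sum_filter]
      have : ∀ q ∈ Q, ∑ q' ∈ Q, ∑ n ∈ S, (if E q n ∧ E q' n then ν n else 0) =
         ∑ n ∈ S, ∑ q' ∈ Q, (if E q n ∧ E q' n then ν n else 0) := fun q _ => Finset.sum_comm
      rw [Finset.sum_congr rfl this, Finset.sum_comm]
      apply Finset.sum_congr rfl
      intro n _
      rw [Finset.card_filter, Nat.cast_sum, Finset.sum_mul_sum, Finset.mul_sum]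
      apply Finset.sum_congr rfl
      intro q _
      rw [Finset.mul_sum]
      apply Finset.sum_congr rfl
      intro q' _
      by_cases b1 : E q n <;> by_cases b2 : E q' n <;> simp [b1, b2]
    rw [a1, a2, Finset.mul_sum, Finset.mul_sum, ← Finset.sum_sub_distrib, ← Finset.sum_add_distrib]
    apply Finset.sum_congr rfl
    intro n _
    ring
  have b1 : ∑ q ∈ Q, ((X - δ) * g q - ρ) ≤ ∑ q ∈ Q, ∑ n ∈ S.filter (fun n => E q n), ν n :=
    Finset.sum_le_sum h2
  have b2 : ∑ q ∈ Q, ∑ q' ∈ Q, ∑ n ∈ S.filter (fun n => E q n ∧ E q' n), ν n ≤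
      ∑ q ∈ Q, (∑ q' ∈ Q, ((X + δ) * (g q * g q') + ρ) + ((X + δ) * g q + ρ)) := by
    apply Finset.sum_le_sum
    intro q hq
    have : ∀ q' ∈ Q, ∑ n ∈ S.filter (fun n => E q n ∧ E q' n), ν n ≤
       ((X + δ) * (g q * g q') + ρ) + (if q = q' then ((X + δ) * g q + ρ) else 0) := by
      intro q' hq'
      have n1 : 0 ≤ (X + δ) * (g q * g q') := by
        have := hg q hq; have := hg q' hq'; positivity
      split_ifs with h
      · subst h
        simp only [and_self]
        linarith [h2' q hq]
      · linarith [h3 q hq q' hq' h]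
    refine (Finset.sum_le_sum this).trans ?_
    rw [Finset.sum_add_distrib, Finset.sum_ite_eq Q q, if_pos hq]
  have c1 : ∑ q ∈ Q, ((X - δ) * g q - ρ) = (X - δ) * L - Q.card * ρ := by
    rw [Finset.sum_sub_distrib, ← Finset.mul_sum, ← hL]; simp
  have c2 : ∑ q ∈ Q, (∑ q' ∈ Q, ((X + δ) * (g q * g q') + ρ) + ((X + δ) * g q + ρ)) =
      (X + δ) * L ^ 2 + Q.card ^ 2 * ρ + (X + δ) * L + Q.card * ρ := by
    have : ∀ q ∈ Q, (∑ q' ∈ Q, ((X + δ) * (g q * g q') + ρ) + ((X + δ) * g q + ρ)) =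
       (X + δ) * L * g q + Q.card * ρ + ((X + δ) * g q + ρ) := by
      intro q _
      rw [Finset.sum_add_distrib, ← Finset.mul_sum, ← Finset.mul_sum, ← hL]
      simp; ring
    have s1 : ∑ q ∈ Q, (X + δ) * g q = (X + δ) * L := by rw [← Finset.mul_sum, hL]
    have s2 : ∑ q ∈ Q, (X + δ) * L * g q = (X + δ) * L * L := by rw [← Finset.mul_sum, ← hL]
    rw [Finset.sum_congr rfl this, Finset.sum_add_distrib, Finset.sum_add_distrib, Finset.sum_add_distrib,
      s1, s2]
    simp only [Finset.sum_const, nsmul_eq_mul]; ring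
  rw [e1]
  have d1 := mul_le_mul_of_nonneg_left (c1 ▸ b1) (by positivity : 0 ≤ 2 * L)
  have d2 := mul_le_mul_of_nonneg_left h1 (by positivity : 0 ≤ L ^ 2)
  rw [c2] at b2
  nlinarith

/-- sums over squarefree rough numbers in short logarithmic windows -/
lemma rough_sum : ∃ C : ℝ, 1 ≤ C ∧ ∀ (P : Finset ℕ) (Y1 Y2 B : ℝ), (∀ q ∈ P, q.Prime) →
    1 < Y1 → Y1 ≤ Y2 →
    ∑ s ∈ P.powerset.filter (fun s => Y1 ≤ ((∏ q ∈ s, q : ℕ) : ℝ) ∧ ((∏ q ∈ s, q : ℕ) : ℝ) ≤ Y2 ∧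
      (s.card : ℝ) ≤ B), 1 / ((∏ q ∈ s, q : ℕ) : ℝ) ≤
      (2:ℝ) ^ B * ((Real.log Y2 - Real.log Y1 + C) / Real.log Y1) * Real.exp (1/2 * ∑ q ∈ P, 1 / (q : ℝ)) := by
  obtain ⟨C, hC, hm⟩ := mertens
  refine ⟨C + 1, by linarith, ?_⟩
  intro P Y1 Y2 B hP hY1 hY
  have hl : 0 < Real.log Y1 := Real.log_pos hY1
  set f : Finset ℕ → ℝ := fun s => ∏ q ∈ s, 1 / (2 * (q : ℝ)) with hf
  have hf0 : ∀ s, 0 ≤ f s := fun s => Finset.prod_nonneg (fun q _ => by positivity)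
  have hpp : ∀ s ∈ P.powerset, 0 < ((∏ q ∈ s, q : ℕ) : ℝ) := by
    intro s hs
    rw [Finset.mem_powerset] at hs
    exact_mod_cast Finset.prod_pos (fun q hq => (hP q (hs hq)).pos)
  set F := P.powerset.filter (fun s => Y1 ≤ ((∏ q ∈ s, q : ℕ) : ℝ) ∧ ((∏ q ∈ s, q : ℕ) : ℝ) ≤ Y2 ∧
      (s.card : ℝ) ≤ B) with hF
  set F2 := P.powerset.filter (fun s => Y1 ≤ ((∏ q ∈ s, q : ℕ) : ℝ) ∧ ((∏ q ∈ s, q : ℕ) : ℝ) ≤ Y2) with hF2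
  have step1 : ∑ s ∈ F, 1 / ((∏ q ∈ s, q : ℕ) : ℝ) ≤ (2:ℝ) ^ B * ∑ s ∈ F2, f s := by
    rw [Finset.mul_sum]
    have hsub : F ⊆ F2 := by
      intro s hs
      rw [hF, Finset.mem_filter] at hs
      rw [hF2, Finset.mem_filter]
      exact ⟨hs.1, hs.2.1, hs.2.2.1⟩
    refine le_trans ?_ (Finset.sum_le_sum_of_subset_of_nonneg hsub
      (fun s _ _ => mul_nonneg (by positivity) (hf0 s)))
    apply Finset.sum_le_sum
    intro s hs
    rw [hF, Finset.mem_filter] at hs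
    have e : f s = (1 / ((∏ q ∈ s, q : ℕ) : ℝ)) * (1 / (2:ℝ) ^ (s.card : ℝ)) := by
      simp only [hf, one_div, mul_inv, Finset.prod_mul_distrib, Finset.prod_const, Real.rpow_natCast]
      push_cast
      rw [Finset.prod_inv_distrib, inv_pow, mul_comm]
    rw [e]
    have h2 : (2:ℝ) ^ (s.card : ℝ) ≤ 2 ^ B := Real.rpow_le_rpow_of_exponent_le (by norm_num) hs.2.2.2
    have h3 : 1 ≤ (2:ℝ) ^ B * (1 / (2:ℝ) ^ (s.card : ℝ)) := by
      rw [mul_one_div, le_div_iff₀ (by positivity)]; linarith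
    have h4 := hpp s hs.1
    have h5 : 0 ≤ 1 / ((∏ q ∈ s, q : ℕ) : ℝ) := by positivity
    nlinarith [mul_le_mul_of_nonneg_left h3 h5]
  have step2 : Real.log Y1 * ∑ s ∈ F2, f s ≤ (Real.log Y2 - Real.log Y1 + (C + 1)) * ∑ s ∈ P.powerset, f s := by
    have a1 : Real.log Y1 * ∑ s ∈ F2, f s ≤ ∑ s ∈ F2, ∑ q ∈ s, f s * Real.log q := by
      rw [Finset.mul_sum]
      apply Finset.sum_le_sum
      intro s hs
      rw [hF2, Finset.mem_filter] at hs
      rw [← Finset.mul_sum, mul_comm]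
      apply mul_le_mul_of_nonneg_left _ (hf0 s)
      have h1 := hs.1
      rw [Finset.mem_powerset] at h1
      have : ∑ q ∈ s, Real.log q = Real.log ((∏ q ∈ s, q : ℕ) : ℝ) := by
        push_cast
        rw [Real.log_prod]
        intro q hq
        exact_mod_cast (hP q (h1 hq)).ne_zero
      rw [this]
      exact Real.log_le_log (by linarith) hs.2.1
    refine a1.trans ?_
    have a2 : ∑ s ∈ F2, ∑ q ∈ s, f s * Real.log q ≤
        ∑ t ∈ P.powerset, ∑ q ∈ P.filter (fun q : ℕ => Y1 ≤ (q:ℝ) * ((∏ q ∈ t, q : ℕ) : ℝ) ∧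
          (q:ℝ) * ((∏ q ∈ t, q : ℕ) : ℝ) ≤ Y2), f t * (Real.log q / (2 * q)) := by
      rw [Finset.sum_sigma', Finset.sum_sigma']
      apply sum_le_sum_inj (fun x => (⟨x.1.erase x.2, x.2⟩ : (_ : Finset ℕ) × ℕ))
      · rintro ⟨s, q⟩ hx ⟨s', q'⟩ hx' h
        simp only [Finset.coe_sigma, Set.mem_sigma_iff, Finset.mem_coe] at hx hx'
        simp only [Sigma.mk.injEq, heq_eq_eq] at h
        obtain ⟨h1, rfl⟩ := h
        have : s = s' := by
          rw [← Finset.insert_erase hx.2, ← Finset.insert_erase hx'.2, h1]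
        rw [this]
      · rintro ⟨s, q⟩ hx
        simp only [Finset.mem_sigma] at hx ⊢
        obtain ⟨h1, h2⟩ := hx
        rw [hF2, Finset.mem_filter, Finset.mem_powerset] at h1
        have hprod : (q:ℝ) * ((∏ q ∈ s.erase q, q : ℕ) : ℝ) = ((∏ q ∈ s, q : ℕ) : ℝ) := by
          exact_mod_cast Finset.mul_prod_erase s (fun q => q) h2
        rw [Finset.mem_filter, Finset.mem_powerset, hprod]
        exact ⟨(Finset.erase_subset _ _).trans h1.1, h1.1 h2, h1.2⟩
      · rintro ⟨s, q⟩ hx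
        simp only [Finset.mem_sigma] at hx
        have : f s = 1 / (2 * (q:ℝ)) * f (s.erase q) := by
          simp only [hf]
          exact (Finset.mul_prod_erase s (fun q => 1 / (2 * (q:ℝ))) hx.2).symm
        simp only [this]
        apply le_of_eq; ring
      · rintro ⟨s, q⟩ _
        have := hf0 s
        have : 0 ≤ Real.log q := Real.log_natCast_nonneg q
        positivity
    refine a2.trans ?_
    rw [Finset.mul_sum]
    apply Finset.sum_le_sum
    intro t ht
    rw [← Finset.mul_sum, mul_comm]
    apply mul_le_mul_of_nonneg_right _ (hf0 t)
    set T : ℝ := ((∏ q ∈ t, q : ℕ) : ℝ) with hT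
    have hT0 : 0 < T := hpp t ht
    have hlog : Real.log Y1 ≤ Real.log Y2 := Real.log_le_log (by linarith) hY
    by_cases hTY : T ≤ Y2
    · have hu1 : 1 ≤ max 1 (Y1 / (2 * T)) := le_max_left _ _
      have hv1 : 1 ≤ Y2 / T := by rwa [one_le_div hT0]
      have huv : max 1 (Y1 / (2 * T)) ≤ Y2 / T := by
        apply max_le hv1
        rw [div_le_div_iff₀ (by positivity) hT0]
        nlinarith
      have hb := hm (max 1 (Y1 / (2 * T))) (Y2 / T) hu1 huv
      have hsub : P.filter (fun q : ℕ => Y1 ≤ (q:ℝ) * T ∧ (q:ℝ) * T ≤ Y2) ⊆ PI (max 1 (Y1 / (2 * T))) (Y2 / T) := by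
        intro q hq
        rw [Finset.mem_filter] at hq
        have hp := hP q hq.1
        rw [mem_PI]
        refine ⟨hp, ?_, ?_⟩
        · apply max_lt
          · exact_mod_cast hp.one_lt
          · rw [div_lt_iff₀ (by positivity)]
            have : 0 < (q:ℝ) := by exact_mod_cast hp.pos
            nlinarith [mul_pos this hT0]
        · rw [le_div_iff₀ hT0]; exact hq.2.2
      have hle : ∑ q ∈ P.filter (fun q : ℕ => Y1 ≤ (q:ℝ) * T ∧ (q:ℝ) * T ≤ Y2), Real.log q / (2 * q) ≤
          ∑ q ∈ PI (max 1 (Y1 / (2 * T))) (Y2 / T), Real.log q / q := by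
        refine le_trans (Finset.sum_le_sum_of_subset_of_nonneg hsub ?_) (Finset.sum_le_sum ?_)
        · intro q _ _
          have : 0 ≤ Real.log q := Real.log_natCast_nonneg q
          positivity
        · intro q hq
          rw [mem_PI] at hq
          have h0 : 0 ≤ Real.log q := Real.log_natCast_nonneg q
          have : 0 < (q:ℝ) := by exact_mod_cast hq.1.pos
          gcongr
          linarith
      have hl1 : Real.log (Y2 / T) = Real.log Y2 - Real.log T := Real.log_div (by linarith) hT0.ne'
      have hl2 : Real.log Y1 - Real.log 2 - Real.log T ≤ Real.log (max 1 (Y1 / (2 * T))) := by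
        have : Real.log (Y1 / (2 * T)) = Real.log Y1 - (Real.log 2 + Real.log T) := by
          rw [Real.log_div (by linarith) (by positivity), Real.log_mul (by norm_num) hT0.ne']
        have h3 := Real.log_le_log (by positivity : 0 < Y1 / (2 * T)) (le_max_right 1 (Y1 / (2 * T)))
        linarith
      have h4 : Real.log 2 < 1 := by linarith [Real.log_two_lt_d9]
      rw [abs_le] at hb
      linarith [hb.2]
    · rw [Finset.filter_eq_empty_iff.2]
      · rw [Finset.sum_empty]; linarith
      · rintro q hq ⟨_, h⟩
        have : 1 ≤ (q:ℝ) := by exact_mod_cast (hP q hq).one_le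
        nlinarith
  have step3 : ∑ s ∈ P.powerset, f s ≤ Real.exp (1/2 * ∑ q ∈ P, 1 / (q : ℝ)) := by
    rw [hf, ← Finset.prod_one_add, Finset.mul_sum, Real.exp_sum]
    apply Finset.prod_le_prod
    · intro q _; positivity
    · intro q _
      have := Real.add_one_le_exp (1 / 2 * (1 / (q:ℝ)))
      have e : 1 / (2 * (q:ℝ)) = 1 / 2 * (1 / (q:ℝ)) := by
        rw [one_div_mul_one_div]
      rw [e]; linarith
  have hlog : Real.log Y1 ≤ Real.log Y2 := Real.log_le_log (by linarith) hY
  have step4 : ∑ s ∈ F2, f s ≤ ((Real.log Y2 - Real.log Y1 + (C + 1)) / Real.log Y1) *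
      Real.exp (1/2 * ∑ q ∈ P, 1 / (q : ℝ)) := by
    rw [div_mul_eq_mul_div, le_div_iff₀ hl, mul_comm]
    refine step2.trans ?_
    apply mul_le_mul_of_nonneg_left step3; linarith
  refine step1.trans ?_
  rw [mul_assoc]
  exact mul_le_mul_of_nonneg_left step4 (by positivity)

lemma rough_decomp (m : ℕ) (z : ℝ) (hm : 1 ≤ m) : ∃ t : ℕ, 1 ≤ t ∧ t ^ 2 ∣ m ∧
    m ≤ t ^ 2 * ((∏ q ∈ m.primeFactors.filter (fun q : ℕ => z < (q:ℝ)), q) *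
      ∏ q ∈ m.primeFactors.filter (fun q : ℕ => ¬ z < (q:ℝ)), q) := by
  obtain ⟨r, t, h1, h2⟩ := Nat.sq_mul_squarefree m
  have hr : r ≠ 0 := by rintro rfl; simp at h1; omega
  have ht : t ≠ 0 := by rintro rfl; simp at h1; omega
  refine ⟨t, by omega, ⟨r, h1.symm⟩, ?_⟩
  rw [Finset.prod_filter_mul_prod_filter_not]
  have h3 : r ≤ ∏ q ∈ m.primeFactors, q := by
    apply Nat.le_of_dvd
    · exact Finset.prod_pos (fun q hq => (Nat.prime_of_mem_primeFactors hq).pos)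
    · have : r = ∏ q ∈ r.primeFactors, q := (Nat.prod_primeFactors_of_squarefree h2).symm
      rw [this]
      apply Finset.prod_dvd_prod_of_subset
      apply Nat.primeFactors_mono ⟨t^2, by rw [mul_comm]; exact h1.symm⟩ (by omega)
  conv_lhs => rw [← h1]
  exact Nat.mul_le_mul_left _ h3

lemma ev_pow (k : ℕ) (C θ : ℝ) (hθ : 0 < θ) : ∀ᶠ x : ℝ in atTop, C * (Real.log x) ^ k ≤ x ^ θ := by
  have h := isLittleO_log_rpow_rpow_atTop (s := θ) (k : ℝ) hθ
  have h2 := h.bound (c := 1 / (|C| + 1)) (by positivity)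
  filter_upwards [h2, eventually_ge_atTop 1] with x hx hx1
  have hl : 0 ≤ Real.log x := Real.log_nonneg hx1
  rw [Real.rpow_natCast, Real.norm_of_nonneg (by positivity), Real.norm_of_nonneg (by positivity)] at hx
  have hc : 0 < |C| + 1 := by positivity
  rw [one_div_mul_eq_div, le_div_iff₀ hc] at hx
  have : C ≤ |C| + 1 := by linarith [le_abs_self C]
  have := mul_le_mul_of_nonneg_right this (by positivity : 0 ≤ Real.log x ^ k)
  linarith

noncomputable def Rx (x : ℝ) : ℕ := ⌊x ^ (1/20 : ℝ)⌋₊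

lemma Rx_facts : ∀ᶠ x : ℝ in atTop, 1 ≤ Rx x ∧ ((Rx x : ℝ)) ^ 2 ≤ x ^ (1/10 : ℝ) ∧
    1 / Sel.GG (Rx x) ≤ 40 / Real.log x ∧ Sel.HH (Rx x) ≤ 1 + Real.log x := by
  filter_upwards [eventually_ge_atTop 3] with x hx
  have hx0 : 0 < x := by linarith
  have h1 : 1 ≤ x ^ (1/20 : ℝ) := Real.one_le_rpow (by linarith) (by norm_num)
  have hR : 1 ≤ Rx x := Nat.one_le_floor_iff _ |>.2 h1
  have hRle : (Rx x : ℝ) ≤ x ^ (1/20 : ℝ) := Nat.floor_le (by positivity)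
  have hlx : 0 < Real.log x := Real.log_pos (by linarith)
  have hl20 : Real.log (x ^ (1/20 : ℝ)) = 1/20 * Real.log x := Real.log_rpow hx0 _
  refine ⟨hR, ?_, ?_, ?_⟩
  · calc ((Rx x : ℝ)) ^ 2 ≤ (x ^ (1/20 : ℝ)) ^ 2 := by gcongr
      _ = x ^ (1/10 : ℝ) := by
        rw [← Real.rpow_natCast, ← Real.rpow_mul hx0.le]; norm_num
  · have h2 := Sel.GG_ge (Rx x)
    have h3 : Real.log (x ^ (1/20 : ℝ)) ≤ Real.log (Rx x + 1) :=
      Real.log_le_log (by positivity) (Nat.lt_floor_add_one _).le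
    have h4 : Real.log x / 40 ≤ Sel.GG (Rx x) := by linarith
    calc 1 / Sel.GG (Rx x) ≤ 1 / (Real.log x / 40) := by gcongr
      _ = 40 / Real.log x := by rw [one_div_div]
  · have h2 := Sel.HH_le (Rx x)
    have h3 : Real.log (Rx x) ≤ Real.log (x ^ (1/20 : ℝ)) :=
      Real.log_le_log (by exact_mod_cast hR) hRle
    linarith

lemma rpow_div_log {x e : ℝ} (hx : 1 < x) (h : Real.log x ≤ x ^ e) (hx0 : 0 < x := by linarith) :
    x ^ (1 - e) ≤ x / Real.log x := by
  have hl : 0 < Real.log x := Real.log_pos hx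
  rw [le_div_iff₀ hl]
  calc x ^ (1 - e) * Real.log x ≤ x ^ (1 - e) * x ^ e := by gcongr
    _ = x := by rw [← Real.rpow_add hx0]; norm_num

lemma WW_prime : ∀ᶠ x : ℝ in atTop, ∀ q : ℕ, q.Prime → (q:ℝ) ≤ x ^ (1/2 : ℝ) →
    Sel.WW (Rx x) q ⌊x⌋₊ ≤ 161 * (x / Real.log x) * (1 / q) := by
  filter_upwards [Rx_facts, eventually_gt_atTop 1, ev_pow 1 1 (1/4) (by norm_num)] with x hR hx hl q hq hqx
  obtain ⟨h1, h2, h3, h4⟩ := hR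
  have hx0 : 0 < x := by linarith
  have hl0 : 0 < Real.log x := Real.log_pos hx
  have hw := (abs_le.1 (Sel.WW_est h1 q ⌊x⌋₊ hq.pos)).2
  have ht := Sel.TT_prime_le h1 q hq
  have hq0 : (0:ℝ) < q := by exact_mod_cast hq.pos
  have hN : (⌊x⌋₊ : ℝ) ≤ x := Nat.floor_le hx0.le
  have ht2 : Sel.TT (Rx x) q ≤ 160 / Real.log x := by
    calc _ ≤ 4 * (1 / Sel.GG (Rx x)) := by rw [mul_one_div]; exact ht
      _ ≤ 4 * (40 / Real.log x) := by gcongr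
      _ = _ := by ring
  have ht0 := Sel.TT_one_nonneg (Rx x) q
  have e1 : (⌊x⌋₊ : ℝ) / q * Sel.TT (Rx x) q ≤ x / q * (160 / Real.log x) := by gcongr
  have e2 : x ^ (1/10:ℝ) ≤ (x / Real.log x) * (1 / q) := by
    rw [mul_one_div, le_div_iff₀ hq0]
    have h5 : x ^ (1 - 1/4:ℝ) ≤ x / Real.log x := rpow_div_log hx (by simpa using hl)
    calc x ^ (1/10:ℝ) * q ≤ x ^ (1/10:ℝ) * x ^ (1/2:ℝ) := by gcongr
      _ = x ^ (1/10 + 1/2 : ℝ) := by rw [← Real.rpow_add hx0]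
      _ ≤ x ^ (1 - 1/4:ℝ) := Real.rpow_le_rpow_of_exponent_le hx.le (by norm_num)
      _ ≤ _ := h5
  have e3 : x / q * (160 / Real.log x) = 160 * (x / Real.log x) * (1 / q) := by ring
  linarith

lemma TT_rough (θ : ℝ) (hθ : 0 < θ) : ∀ᶠ x : ℝ in atTop, ∀ D : ℕ, 1 ≤ D → (D:ℝ) ≤ x →
    (∀ q ∈ D.primeFactors, x ^ θ < (q:ℝ)) →
    |Sel.TT (Rx x) D - Sel.TT (Rx x) 1| ≤ 1 / (Real.log x) ^ 2 := by
  filter_upwards [Rx_facts, eventually_gt_atTop 1, ev_log_ge 1, ev_pow 6 64 θ hθ] with x hR hx hl1 hl D hD hDx hq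
  obtain ⟨h1, h2, h3, h4⟩ := hR
  have hx0 : 0 < x := by linarith
  have hl0 : 0 < Real.log x := Real.log_pos hx
  refine (Sel.TT_diff h1 D (by omega)).trans ?_
  have hH0 := Sel.HH_nonneg (Rx x)
  have hcard : (D.primeFactors.card : ℝ) ≤ 2 * Real.log x := by
    have a1 : 2 ^ D.primeFactors.card ≤ D := by
      calc 2 ^ D.primeFactors.card ≤ ∏ q ∈ D.primeFactors, q :=
            Finset.pow_card_le_prod _ _ _ (fun q hq => (Nat.prime_of_mem_primeFactors hq).two_le)
        _ ≤ D := Nat.le_of_dvd (by omega) (Nat.prod_primeFactors_dvd D)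
    have a2 : ((2:ℝ)) ^ D.primeFactors.card ≤ x := by
      refine le_trans ?_ hDx
      exact_mod_cast a1
    have a3 := Real.log_le_log (by positivity) a2
    rw [Real.log_pow] at a3
    have := Real.log_two_gt_d9
    have a4 : (D.primeFactors.card : ℝ) * (1/2) ≤ D.primeFactors.card * Real.log 2 := by
      gcongr; linarith
    linarith
  have hterm : ∀ q ∈ D.primeFactors, 4 * Sel.HH (Rx x) ^ 3 / q ≤ 4 * (2 * Real.log x) ^ 3 / x ^ θ := by
    intro q hq'
    have : Sel.HH (Rx x) ≤ 2 * Real.log x := by linarith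
    have := (hq q hq').le
    gcongr
  refine (Finset.sum_le_sum hterm).trans ?_
  rw [Finset.sum_const, nsmul_eq_mul]
  have hxt : 0 < x ^ θ := by positivity
  rw [← mul_div_assoc, div_le_div_iff₀ hxt (by positivity)]
  have : (D.primeFactors.card : ℝ) * (4 * (2 * Real.log x) ^ 3) * Real.log x ^ 2 ≤
      2 * Real.log x * (4 * (2 * Real.log x) ^ 3) * Real.log x ^ 2 := by gcongr
  calc _ ≤ _ := this
    _ = 64 * Real.log x ^ 6 := by ring
    _ ≤ _ := by linarith

lemma TT_one_le' : ∀ᶠ x : ℝ in atTop, Sel.TT (Rx x) 1 ≤ 40 / Real.log x := by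
  filter_upwards [Rx_facts] with x hR
  exact (Sel.TT_one_le hR.1).trans hR.2.2.1

lemma WW_rough (θ : ℝ) (hθ : 0 < θ) : ∀ᶠ x : ℝ in atTop, ∀ D : ℕ, 1 ≤ D → (D:ℝ) ≤ x ^ (4/5:ℝ) →
    (∀ q ∈ D.primeFactors, x ^ θ < (q:ℝ)) →
    Sel.WW (Rx x) D ⌊x⌋₊ ≤ 42 * (x / Real.log x) * (1 / D) := by
  filter_upwards [Rx_facts, TT_rough θ hθ, TT_one_le', eventually_gt_atTop 1, ev_log_ge 1,
    ev_pow 1 1 (1/20) (by norm_num)] with x hR hT hT1 hx hl1 hl D hD hDx hq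
  obtain ⟨h1, h2, h3, h4⟩ := hR
  have hx0 : 0 < x := by linarith
  have hl0 : 0 < Real.log x := Real.log_pos hx
  have hD0 : (0:ℝ) < D := by exact_mod_cast hD
  have hDx' : (D:ℝ) ≤ x := hDx.trans (by
    conv_rhs => rw [← Real.rpow_one x]
    exact Real.rpow_le_rpow_of_exponent_le hx.le (by norm_num))
  have hT2 := (abs_le.1 (hT D hD hDx' hq)).2
  have hw := (abs_le.1 (Sel.WW_est h1 D ⌊x⌋₊ (by omega))).2
  have hN : (⌊x⌋₊ : ℝ) ≤ x := Nat.floor_le hx0.le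
  have h6 : 1 / Real.log x ^ 2 ≤ 1 / Real.log x := by
    apply one_div_le_one_div_of_le hl0
    nlinarith
  have hT3 : Sel.TT (Rx x) D ≤ 41 / Real.log x := by
    have : 41 / Real.log x = 40 / Real.log x + 1 / Real.log x := by ring
    linarith
  have ht0 := Sel.TT_one_nonneg (Rx x) D
  have e1 : (⌊x⌋₊ : ℝ) / D * Sel.TT (Rx x) D ≤ x / D * (41 / Real.log x) := by gcongr
  have e2 : x ^ (1/10:ℝ) ≤ (x / Real.log x) * (1 / D) := by
    rw [mul_one_div, le_div_iff₀ hD0]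
    have h5 : x ^ (1 - 1/20:ℝ) ≤ x / Real.log x := rpow_div_log hx (by simpa using hl)
    calc x ^ (1/10:ℝ) * D ≤ x ^ (1/10:ℝ) * x ^ (4/5:ℝ) := by gcongr
      _ = x ^ (1/10 + 4/5 : ℝ) := by rw [← Real.rpow_add hx0]
      _ ≤ x ^ (1 - 1/20:ℝ) := Real.rpow_le_rpow_of_exponent_le hx.le (by norm_num)
      _ ≤ _ := h5
  have e3 : x / D * (41 / Real.log x) = 41 * (x / Real.log x) * (1 / D) := by ring
  linarith

lemma small_mass (θ H : ℝ) (hθ : 0 < θ) (hθ1 : θ ≤ 1/10) (hH : 0 < H) : ∀ᶠ x : ℝ in atTop,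
    ∑ n ∈ (Finset.Ioc 0 ⌊x⌋₊).filter (fun n => H * θ * Real.log x ≤
      ∑ q ∈ (PI 1 (x ^ θ)).filter (fun q => n ≡ 1 [MOD q]), Real.log q), Sel.nu (Rx x) n ≤
      200 / H * (x / Real.log x) := by
  obtain ⟨C, hC, hm⟩ := mertens
  filter_upwards [WW_prime, eventually_gt_atTop 1, ev_log_ge (161 * C / (39 * θ))] with x hW hx hl
  have hx0 : 0 < x := by linarith
  have hl0 : 0 < Real.log x := Real.log_pos hx
  rw [div_le_iff₀ (by positivity)] at hl
  set S := (Finset.Ioc 0 ⌊x⌋₊).filter (fun n => H * θ * Real.log x ≤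
      ∑ q ∈ (PI 1 (x ^ θ)).filter (fun q => n ≡ 1 [MOD q]), Real.log q)
  have hlog : ∀ q : ℕ, 0 ≤ Real.log q := fun q => Real.log_natCast_nonneg q
  have h1 : H * θ * Real.log x * ∑ n ∈ S, Sel.nu (Rx x) n ≤
      ∑ q ∈ PI 1 (x ^ θ), Real.log q * Sel.WW (Rx x) q ⌊x⌋₊ := by
    calc H * θ * Real.log x * ∑ n ∈ S, Sel.nu (Rx x) n
        ≤ ∑ n ∈ S, (∑ q ∈ (PI 1 (x ^ θ)).filter (fun q => n ≡ 1 [MOD q]), Real.log q) * Sel.nu (Rx x) n := by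
          rw [Finset.mul_sum]
          apply Finset.sum_le_sum
          intro n hn
          rw [Finset.mem_filter] at hn
          exact mul_le_mul_of_nonneg_right hn.2 (Sel.nu_nonneg _ _)
      _ ≤ ∑ n ∈ Finset.Ioc 0 ⌊x⌋₊, (∑ q ∈ (PI 1 (x ^ θ)).filter (fun q => n ≡ 1 [MOD q]), Real.log q) * Sel.nu (Rx x) n := by
          apply Finset.sum_le_sum_of_subset_of_nonneg (Finset.filter_subset _ _)
          intro n _ _
          exact mul_nonneg (Finset.sum_nonneg (fun q _ => hlog q)) (Sel.nu_nonneg _ _)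
      _ = _ := by
          unfold Sel.WW
          simp only [Finset.sum_filter, Finset.sum_mul, Finset.mul_sum]
          rw [Finset.sum_comm]
          apply Finset.sum_congr rfl
          intro q _
          apply Finset.sum_congr rfl
          intro n _
          split_ifs <;> simp
  have hxθ : 1 ≤ x ^ θ := Real.one_le_rpow hx.le hθ.le
  have h2 : ∑ q ∈ PI 1 (x ^ θ), Real.log q * Sel.WW (Rx x) q ⌊x⌋₊ ≤
      161 * (x / Real.log x) * ∑ q ∈ PI 1 (x ^ θ), Real.log q / q := by
    rw [Finset.mul_sum]
    apply Finset.sum_le_sum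
    intro q hq
    rw [mem_PI] at hq
    have := hW q hq.1 (hq.2.2.trans (Real.rpow_le_rpow_of_exponent_le hx.le (by linarith)))
    calc Real.log q * Sel.WW (Rx x) q ⌊x⌋₊ ≤ Real.log q * (161 * (x / Real.log x) * (1 / q)) := by
          gcongr
      _ = _ := by ring
  have h3 := (abs_le.1 (hm 1 (x ^ θ) le_rfl hxθ)).2
  rw [Real.log_rpow hx0, Real.log_one] at h3
  have hxl : 0 < x / Real.log x := by positivity
  have h4 : 161 * (x / Real.log x) * ∑ q ∈ PI 1 (x ^ θ), Real.log q / q ≤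
      (x / Real.log x) * (200 * (θ * Real.log x)) := by
    rw [mul_comm (161:ℝ), mul_assoc]
    apply mul_le_mul_of_nonneg_left _ hxl.le
    linarith
  have h5 := (h1.trans h2).trans h4
  have h6 : 0 < H * θ * Real.log x := by positivity
  rw [← mul_le_mul_iff_right₀ h6]
  calc _ ≤ _ := h5
    _ = _ := by field_simp

lemma card_PI_le (u v : ℝ) (hv : 0 ≤ v) : ((PI u v).card : ℝ) ≤ v := by
  have : PI u v ⊆ Finset.Ioc 0 ⌊v⌋₊ := by
    intro p hp
    rw [mem_PI] at hp
    rw [Finset.mem_Ioc]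
    exact ⟨hp.1.pos, Nat.le_floor hp.2.2⟩
  have h := Finset.card_le_card this
  simp at h
  exact le_trans (by exact_mod_cast h) (Nat.floor_le hv)

set_option maxHeartbeats 1000000 in
lemma var_mass (J : ℕ) (hJ : 12 ≤ J) : ∀ᶠ x : ℝ in atTop,
    ∑ n ∈ (Finset.Ioc 0 ⌊x⌋₊).filter (fun n => 0.1112 * (J:ℝ) <
      (((PI (x ^ th J) (x ^ (1/10:ℝ))).filter (fun q => n ≡ 1 [MOD q])).card : ℝ)), Sel.nu (Rx x) n ≤
      100000 / J * (x / Real.log x) := by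
  filter_upwards [Rx_facts, TT_rough (th J) (th_pos J), TT_one_le', recip_block J, eventually_gt_atTop 1, 
    ev_log_ge (4 * (J:ℝ) + 1), ev_pow 1 6 (1/10) (by norm_num)] with x hR hT hT1 hL hx hl hl2
  obtain ⟨h1, h2, h3, h4⟩ := hR
  have hx0 : 0 < x := by linarith
  have hl0 : 0 < Real.log x := Real.log_pos hx
  have hJ' : (12:ℝ) ≤ J := by exact_mod_cast hJ
  set Q := PI (x ^ th J) (x ^ (1/10:ℝ)) with hQ
  set L := ∑ q ∈ Q, 1 / (q:ℝ) with hLdef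
  have hL1 : 1 ≤ L := by linarith [hL.1]
  set N := ⌊x⌋₊ with hN'
  have hN : (N : ℝ) ≤ x := Nat.floor_le hx0.le
  set R := Rx x with hRdef
  set X := (N:ℝ) * Sel.TT R 1 with hX
  set δ := x / (Real.log x) ^ 2 with hδ
  set ρ := x ^ (1/10:ℝ) with hρ
  have hρ0 : 0 < ρ := by positivity
  have hδ0 : 0 < δ := by positivity
  have hX0 : 0 ≤ X := mul_nonneg (by positivity) (Sel.TT_one_nonneg R 1)
  have hXle : X ≤ 40 * (x / Real.log x) := by
    calc X ≤ x * (40 / Real.log x) := by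
          apply mul_le_mul hN hT1 (Sel.TT_one_nonneg R 1) hx0.le
      _ = _ := by ring
  have hρx : ρ ^ 2 ≤ x := by
    rw [hρ, ← Real.rpow_natCast, ← Real.rpow_mul hx0.le]
    conv_rhs => rw [← Real.rpow_one x]
    apply Real.rpow_le_rpow_of_exponent_le hx.le (by norm_num)
  -- estimates for general D
  have hest : ∀ D : ℕ, 1 ≤ D → (D:ℝ) ≤ x → (∀ q ∈ D.primeFactors, x ^ th J < (q:ℝ)) →
      (X - δ) * (1 / D) - ρ ≤ Sel.WW R D N ∧ Sel.WW R D N ≤ (X + δ) * (1 / D) + ρ := by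
    intro D hD hDx hq
    have hD0 : (0:ℝ) < D := by exact_mod_cast hD
    have a1 := abs_le.1 (Sel.WW_est h1 D N (by omega))
    have a2 := abs_le.1 (hT D hD hDx hq)
    have a3 : (N:ℝ) / D * (1 / (Real.log x) ^ 2) ≤ δ * (1 / D) := by
      rw [hδ]
      calc (N:ℝ) / D * (1 / (Real.log x) ^ 2) ≤ x / D * (1 / (Real.log x) ^ 2) := by gcongr
        _ = _ := by ring
    have a4 : 0 ≤ (N:ℝ) / D := by positivity
    have a5 : (N:ℝ) / D * Sel.TT R 1 = X * (1 / D) := by rw [hX]; ring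
    have a6 := mul_le_mul_of_nonneg_left a2.1 a4
    have a7 := mul_le_mul_of_nonneg_left a2.2 a4
    constructor <;> nlinarith [a1.1, a1.2]
  have hvar := variance_abs (Finset.Ioc 0 N) (Sel.nu R) Q (fun q n => n ≡ 1 [MOD q]) (fun q => 1 / (q:ℝ))
    X δ ρ L (fun q _ => by positivity) hLdef hρ0.le hδ0.le hX0
    (by
      have a1 := (abs_le.1 (Sel.WW_est h1 1 N (by norm_num))).2
      have : Sel.WW R 1 N = ∑ n ∈ Finset.Ioc 0 N, Sel.nu R n := by
        unfold Sel.WW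
        rw [Finset.filter_true_of_mem]
        intro n _; exact Nat.modEq_one
      rw [this] at a1
      norm_num at a1
      linarith)
    (by
      intro q hq
      rw [hQ, mem_PI] at hq
      refine (hest q hq.1.one_le (hq.2.2.trans ?_) ?_).1
      · nlinarith [Real.one_le_rpow hx.le (by norm_num : (0:ℝ) ≤ 1/10)]
      · intro r hr
        rw [hq.1.primeFactors, Finset.mem_singleton] at hr
        rw [hr]; exact hq.2.1)
    (by
      intro q hq
      rw [hQ, mem_PI] at hq
      refine (hest q hq.1.one_le (hq.2.2.trans ?_) ?_).2
      · nlinarith [Real.one_le_rpow hx.le (by norm_num : (0:ℝ) ≤ 1/10)]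
      · intro r hr
        rw [hq.1.primeFactors, Finset.mem_singleton] at hr
        rw [hr]; exact hq.2.1)
    (by
      intro q hq q' hq' hne
      rw [hQ, mem_PI] at hq hq'
      have hco : Nat.Coprime q q' := (Nat.coprime_primes hq.1 hq'.1).2 hne
      have a1 := (hest (q * q') (Nat.mul_pos hq.1.pos hq'.1.pos) (by
        push_cast
        refine le_trans ?_ hρx
        rw [sq]
        exact mul_le_mul hq.2.2 hq'.2.2 (by positivity) hρ0.le) (by
        intro r hr
        rw [Nat.Coprime.primeFactors_mul hco, hq.1.primeFactors, hq'.1.primeFactors] at hr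
        simp at hr
        rcases hr with rfl | rfl
        · exact hq.2.1
        · exact hq'.2.1)).2
      have a2 : Sel.WW R (q * q') N = ∑ n ∈ (Finset.Ioc 0 N).filter (fun n => n ≡ 1 [MOD q] ∧ n ≡ 1 [MOD q']), Sel.nu R n := by
        unfold Sel.WW
        congr 1
        apply Finset.filter_congr
        intro n _
        exact (Nat.modEq_and_modEq_iff_modEq_mul hco).symm
      rw [a2] at a1
      convert a1 using 3
      push_cast
      rw [one_div_mul_one_div])
  have hQc : (Q.card : ℝ) ≤ ρ := card_PI_le _ _ hρ0.le
  have hρ1 : 1 ≤ ρ := Real.one_le_rpow hx.le (by norm_num)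
  have hl2' : 6 * Real.log x ≤ ρ := by simpa using hl2
  have hLρ : L ≤ ρ := by linarith [hL.2]
  have hxl : 0 < x / Real.log x := by positivity
  have t2 : δ * (3 * L ^ 2 + L) ≤ L * (x / Real.log x) := by
    have : 3 * L ^ 2 + L ≤ L * Real.log x := by
      have a0 : 3 * L + 1 ≤ Real.log x := by linarith [hL.2]
      have := mul_le_mul_of_nonneg_left a0 (by linarith : 0 ≤ L)
      linarith
    calc δ * (3 * L ^ 2 + L) ≤ δ * (L * Real.log x) := by gcongr
      _ = _ := by rw [hδ]; field_simp
  have t3 : ρ * ((Q.card + L) ^ 2 + Q.card) ≤ L * (x / Real.log x) := by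
    have a1 : (Q.card + L) ^ 2 + Q.card ≤ 5 * ρ ^ 2 := by
      have : (Q.card + L) ^ 2 ≤ (ρ + ρ) ^ 2 := by gcongr
      nlinarith
    have a2 : ρ * ((Q.card + L) ^ 2 + Q.card) ≤ ρ * (5 * ρ ^ 2) := by gcongr
    have a3 : ρ ^ 10 = x := by
      rw [hρ, ← Real.rpow_natCast, ← Real.rpow_mul hx0.le]; norm_num
    have a4 : ρ * (5 * ρ ^ 2) ≤ x / Real.log x := by
      rw [le_div_iff₀ hl0]
      calc ρ * (5 * ρ ^ 2) * Real.log x = (ρ^3) * (5 * Real.log x) := by ring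
        _ ≤ ρ ^ 3 * ρ := by gcongr; linarith
        _ = ρ ^ 4 := by ring
        _ ≤ ρ ^ 10 := pow_le_pow_right₀ hρ1 (by norm_num)
        _ = x := a3
    nlinarith
  have hvar2 : ∑ n ∈ Finset.Ioc 0 N, Sel.nu R n * (((Q.filter (fun q => n ≡ 1 [MOD q])).card : ℝ) - L) ^ 2 ≤
      42 * L * (x / Real.log x) := by
    refine hvar.trans ?_
    have := mul_le_mul_of_nonneg_right hXle (by linarith : 0 ≤ L)
    linarith
  have hmk : (0.1 * L) ^ 2 * ∑ n ∈ (Finset.Ioc 0 N).filter (fun n => 0.1112 * (J:ℝ) <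
      ((Q.filter (fun q => n ≡ 1 [MOD q])).card : ℝ)), Sel.nu R n ≤ 42 * L * (x / Real.log x) := by
    refine le_trans ?_ hvar2
    rw [Finset.mul_sum]
    refine le_trans ?_ (Finset.sum_le_sum_of_subset_of_nonneg (Finset.filter_subset (fun n => 0.1112 * (J:ℝ) <
      ((Q.filter (fun q => n ≡ 1 [MOD q])).card : ℝ)) _) ?_)
    · apply Finset.sum_le_sum
      intro n hn
      rw [Finset.mem_filter] at hn
      rw [mul_comm]
      apply mul_le_mul_of_nonneg_left _ (Sel.nu_nonneg _ _)
      apply pow_le_pow_left₀ (by linarith)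
      have := hL.2
      linarith [hn.2]
    · intro n _ _
      exact mul_nonneg (Sel.nu_nonneg _ _) (sq_nonneg _)
  have hL0 : 0 < L := by linarith
  set Msum := ∑ n ∈ (Finset.Ioc 0 N).filter (fun n => 0.1112 * (J:ℝ) <
      ((Q.filter (fun q => n ≡ 1 [MOD q])).card : ℝ)), Sel.nu R n
  have h7 : L * Msum ≤ 4200 * (x / Real.log x) := by
    have : L * (L * Msum) ≤ L * (4200 * (x / Real.log x)) := by nlinarith
    exact le_of_mul_le_mul_left this hL0
  have hM0 : 0 ≤ Msum := Finset.sum_nonneg (fun n _ => Sel.nu_nonneg _ _)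
  have h8 : 0.09 * (J:ℝ) * Msum ≤ 4200 * (x / Real.log x) :=
    (mul_le_mul_of_nonneg_right hL.1 hM0).trans h7
  rw [div_mul_eq_mul_div, le_div_iff₀ (by linarith)]
  nlinarith

open Classical in
lemma sq_count (N : ℕ) (T : ℝ) (hT : 0 < T) :
    (((Finset.Ioc 0 N).filter (fun n => ∃ t : ℕ, T < t ∧ t ^ 2 ∣ n)).card : ℝ) ≤ 2 * N / T := by
  have h1 : (Finset.Ioc 0 N).filter (fun n => ∃ t : ℕ, T < t ∧ t ^ 2 ∣ n) ⊆
      (Finset.Ioo ⌊T⌋₊ (N + 1)).biUnion (fun t => (Finset.Ioc 0 N).filter (fun n => t ^ 2 ∣ n)) := by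
    intro n hn
    rw [Finset.mem_filter, Finset.mem_Ioc] at hn
    obtain ⟨⟨hn0, hnN⟩, t, ht, htn⟩ := hn
    rw [Finset.mem_biUnion]
    refine ⟨t, ?_, ?_⟩
    · rw [Finset.mem_Ioo]
      have h2 := Nat.le_of_dvd hn0 htn
      have h3 : t ≤ t ^ 2 := Nat.le_self_pow (by norm_num) t
      exact ⟨(Nat.floor_lt hT.le).2 ht, by omega⟩
    · rw [Finset.mem_filter, Finset.mem_Ioc]; exact ⟨⟨hn0, hnN⟩, htn⟩
  have h2 := (Finset.card_le_card h1).trans Finset.card_biUnion_le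
  calc (((Finset.Ioc 0 N).filter (fun n => ∃ t : ℕ, T < t ∧ t ^ 2 ∣ n)).card : ℝ)
      ≤ ∑ t ∈ Finset.Ioo ⌊T⌋₊ (N + 1), (((Finset.Ioc 0 N).filter (fun n => t ^ 2 ∣ n)).card : ℝ) := by
        exact_mod_cast h2
    _ ≤ ∑ t ∈ Finset.Ioo ⌊T⌋₊ (N + 1), (N:ℝ) * ((t:ℝ) ^ 2)⁻¹ := by
        apply Finset.sum_le_sum
        intro t _
        rw [Nat.Ioc_filter_dvd_card_eq_div]
        refine (Nat.cast_div_le).trans ?_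
        push_cast
        rw [div_eq_mul_inv]
    _ ≤ (N:ℝ) * (2 / (⌊T⌋₊ + 1)) := by
        rw [← Finset.mul_sum]
        gcongr
        exact sum_Ioo_inv_sq_le _ _
    _ ≤ (N:ℝ) * (2 / T) := by
        gcongr
        exact (Nat.lt_floor_add_one T).le
    _ = _ := by ring

lemma prod_primes_dvd (s : Finset ℕ) (n : ℕ) (hs : ∀ q ∈ s, q.Prime ∧ q ∣ n) : ∏ q ∈ s, q ∣ n := by
  apply Finset.prod_primes_dvd n
  · intro q hq; exact (hs q hq).1.prime
  · intro q hq; exact (hs q hq).2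

lemma split_window (m D : ℕ) (hm : 1 ≤ m) (hD : D ∣ m) (s : Finset ℕ) (hs : ∀ q ∈ s, q.Prime ∧ q ∣ m)
    (c0 : ℝ) (hc : (m:ℝ) ≤ c0 * ((∏ q ∈ s, q : ℕ) : ℝ)) :
    ∃ sD sE : Finset ℕ, sD ⊆ s ∧ sE ⊆ s ∧ sD.card + sE.card = s.card ∧
      ((∏ q ∈ sD, q : ℕ) : ℝ) ≤ D ∧ (D:ℝ) ≤ c0 * ((∏ q ∈ sD, q : ℕ) : ℝ) ∧
      ((∏ q ∈ sE, q : ℕ) : ℝ) * D ≤ m ∧ (m:ℝ) ≤ c0 * D * ((∏ q ∈ sE, q : ℕ) : ℝ) := by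
  have hD0 : 0 < D := Nat.pos_of_dvd_of_pos hD hm
  obtain ⟨E, rfl⟩ := hD
  have hE0 : 0 < E := by
    rcases Nat.eq_zero_or_pos E with h | h
    · subst h; simp at hm
    · exact h
  refine ⟨s.filter (fun q => q ∣ D), s.filter (fun q => ¬ q ∣ D), Finset.filter_subset _ _,
    Finset.filter_subset _ _, Finset.card_filter_add_card_filter_not _, ?_⟩
  have hprod := Finset.prod_filter_mul_prod_filter_not s (fun q => q ∣ D) (fun q => q)
  set U := ∏ q ∈ s.filter (fun q => q ∣ D), q
  set V := ∏ q ∈ s.filter (fun q => ¬ q ∣ D), q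
  have hU : U ∣ D := by
    apply prod_primes_dvd
    intro q hq
    rw [Finset.mem_filter] at hq
    exact ⟨(hs q hq.1).1, hq.2⟩
  have hV : V ∣ E := by
    apply prod_primes_dvd
    intro q hq
    rw [Finset.mem_filter] at hq
    exact ⟨(hs q hq.1).1, ((hs q hq.1).1.dvd_mul.1 (hs q hq.1).2).resolve_left hq.2⟩
  have hU1 : (U:ℝ) ≤ D := by exact_mod_cast Nat.le_of_dvd hD0 hU
  have hV1 : (V:ℝ) ≤ E := by exact_mod_cast Nat.le_of_dvd hE0 hV
  have hV0 : (0:ℝ) < V := by exact_mod_cast Nat.pos_of_dvd_of_pos hV hE0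
  have hU0 : (0:ℝ) < U := by exact_mod_cast Nat.pos_of_dvd_of_pos hU hD0
  have hD0' : (0:ℝ) < D := by exact_mod_cast hD0
  have hE0' : (0:ℝ) < E := by exact_mod_cast hE0
  rw [← hprod] at hc
  push_cast at hc ⊢
  have hc0 : 0 < c0 := by
    by_contra h
    push Not at h
    have : c0 * ((U:ℝ) * V) ≤ 0 := mul_nonpos_of_nonpos_of_nonneg h (by positivity)
    have : (0:ℝ) < D * E := by positivity
    linarith
  refine ⟨hU1, ?_, by nlinarith, ?_⟩
  · have : V * (D:ℝ) ≤ V * (c0 * U) := by nlinarith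
    exact le_of_mul_le_mul_left this hV0
  · have : c0 * ((U:ℝ) * V) ≤ c0 * (D * V) := by gcongr
    linarith

open Classical in
lemma window_count : ∃ C : ℝ, 1 ≤ C ∧ ∀ (J : ℕ) (A α1 α2 B : ℝ), 2 ≤ A → 1/4 ≤ α1 → α1 ≤ α2 → α2 ≤ 4/5 →
    ∀ᶠ x : ℝ in atTop,
    (((PI (x / A) x).filter (fun p => ∃ s ⊆ PI (x ^ th J) x, ∏ q ∈ s, q ∣ p - 1 ∧
      x ^ α1 ≤ ((∏ q ∈ s, q : ℕ) : ℝ) ∧ ((∏ q ∈ s, q : ℕ) : ℝ) ≤ x ^ α2 ∧ (s.card : ℝ) ≤ B)).card : ℝ) ≤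
      C * (x / Real.log x) * (2:ℝ) ^ B * (α2 - α1 + th J) * Real.exp (0.0505 * J) := by
  obtain ⟨C, hC, hrs⟩ := rough_sum
  refine ⟨42 * 4 * Real.exp 5, by nlinarith [Real.add_one_le_exp 5], ?_⟩
  intro J A α1 α2 B hA h1 h12 h2
  have hA0 : 0 < A := by linarith
  filter_upwards [Rx_facts, WW_rough (th J) (th_pos J), recip_block J, recip_top, eventually_gt_atTop 1,
    ev_log_ge (C / th J), ev_pow 0 A (1/2) (by norm_num)] with x hR hW hrb hrt hx hl hAx
  have hx0 : 0 < x := by linarith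
  have hl0 : 0 < Real.log x := Real.log_pos hx
  have hxl : 0 < x / Real.log x := by positivity
  have hth := th_pos J
  set P := PI (x ^ th J) x with hP
  set F := P.powerset.filter (fun s => x ^ α1 ≤ ((∏ q ∈ s, q : ℕ) : ℝ) ∧ ((∏ q ∈ s, q : ℕ) : ℝ) ≤ x ^ α2 ∧
      (s.card : ℝ) ≤ B) with hF
  have hPp : ∀ q ∈ P, q.Prime := fun q hq => (mem_PI.1 hq).1
  have hRp : ∀ p ∈ PI (x / A) x, Rx x < p := by
    intro p hp
    rw [mem_PI] at hp
    have a1 : (Rx x : ℝ) ≤ x ^ (1/20 : ℝ) := Nat.floor_le (by positivity)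
    have a2 : x ^ (1/20 : ℝ) ≤ x ^ (1/2:ℝ) := Real.rpow_le_rpow_of_exponent_le hx.le (by norm_num)
    have a3 : x ^ (1/2:ℝ) ≤ x / A := by
      rw [le_div_iff₀ hA0]
      have a4 : x ^ (1/2:ℝ) * x ^ (1/2:ℝ) = x := by rw [← Real.rpow_add hx0]; norm_num
      simp only [pow_zero, mul_one] at hAx
      calc x ^ (1/2:ℝ) * A ≤ x ^ (1/2:ℝ) * x ^ (1/2:ℝ) := by gcongr
        _ = x := a4
    have : (Rx x : ℝ) < p := by linarith [hp.2.1]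
    exact_mod_cast this
  have hsub : (PI (x / A) x).filter (fun p => ∃ s ⊆ P, ∏ q ∈ s, q ∣ p - 1 ∧
      x ^ α1 ≤ ((∏ q ∈ s, q : ℕ) : ℝ) ∧ ((∏ q ∈ s, q : ℕ) : ℝ) ≤ x ^ α2 ∧ (s.card : ℝ) ≤ B) ⊆
      F.biUnion (fun s => (PI (x / A) x).filter (fun p => p ≡ 1 [MOD ∏ q ∈ s, q])) := by
    intro p hp
    rw [Finset.mem_filter] at hp
    obtain ⟨hp, s, hs, hd, a1, a2, a3⟩ := hp
    rw [Finset.mem_biUnion]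
    refine ⟨s, ?_, ?_⟩
    · rw [hF, Finset.mem_filter, Finset.mem_powerset]; exact ⟨hs, a1, a2, a3⟩
    · rw [Finset.mem_filter]
      refine ⟨hp, ?_⟩
      exact ((Nat.modEq_iff_dvd' (mem_PI.1 hp).1.one_le).2 hd).symm
  have hcard := (Finset.card_le_card hsub).trans Finset.card_biUnion_le
  have hcard' : (((PI (x / A) x).filter (fun p => ∃ s ⊆ P, ∏ q ∈ s, q ∣ p - 1 ∧
      x ^ α1 ≤ ((∏ q ∈ s, q : ℕ) : ℝ) ∧ ((∏ q ∈ s, q : ℕ) : ℝ) ≤ x ^ α2 ∧ (s.card : ℝ) ≤ B)).card : ℝ) ≤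
      ∑ s ∈ F, (((PI (x / A) x).filter (fun p => p ≡ 1 [MOD ∏ q ∈ s, q])).card : ℝ) := by
    exact_mod_cast hcard
  refine hcard'.trans ?_
  have hterm : ∀ s ∈ F, (((PI (x / A) x).filter (fun p => p ≡ 1 [MOD ∏ q ∈ s, q])).card : ℝ) ≤
      42 * (x / Real.log x) * (1 / ((∏ q ∈ s, q : ℕ) : ℝ)) := by
    intro s hs
    rw [hF, Finset.mem_filter, Finset.mem_powerset] at hs
    refine le_trans ?_ (hW (∏ q ∈ s, q) ?_ ?_ ?_)
    · unfold Sel.WW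
      rw [Finset.card_eq_sum_ones, Nat.cast_sum]
      have hs2 : (PI (x / A) x).filter (fun p => p ≡ 1 [MOD ∏ q ∈ s, q]) ⊆
         (Finset.Ioc 0 ⌊x⌋₊).filter (fun p => p ≡ 1 [MOD ∏ q ∈ s, q]) := by
        apply Finset.filter_subset_filter
        intro p hp
        rw [mem_PI] at hp
        rw [Finset.mem_Ioc]
        exact ⟨hp.1.pos, Nat.le_floor hp.2.2⟩
      refine le_trans (Finset.sum_le_sum ?_) (Finset.sum_le_sum_of_subset_of_nonneg hs2
        (fun n _ _ => Sel.nu_nonneg _ _))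
      intro p hp
      rw [Finset.mem_filter] at hp
      rw [Sel.nu_prime hR.1 (mem_PI.1 hp.1).1 (hRp p hp.1)]
      simp
    · exact Finset.prod_pos (fun q hq => (hPp q (hs.1 hq)).pos)
    · exact hs.2.2.1.trans (Real.rpow_le_rpow_of_exponent_le hx.le h2)
    · intro q hq
      rw [Nat.primeFactors_prod (fun q hq => hPp q (hs.1 hq))] at hq
      exact (mem_PI.1 (hs.1 hq)).2.1
  refine (Finset.sum_le_sum hterm).trans ?_
  rw [← Finset.mul_sum]
  have hr := hrs P (x ^ α1) (x ^ α2) B hPp (Real.one_lt_rpow hx (by linarith))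
    (Real.rpow_le_rpow_of_exponent_le hx.le h12)
  rw [Real.log_rpow hx0, Real.log_rpow hx0] at hr
  have e1 : (α2 * Real.log x - α1 * Real.log x + C) / (α1 * Real.log x) ≤ 4 * (α2 - α1 + th J) := by
    rw [div_le_iff₀ (by positivity)]
    rw [div_le_iff₀ hth] at hl
    have : 0 ≤ α2 - α1 := by linarith
    have a1 : 1 ≤ 4 * α1 := by linarith
    have a2 : 0 ≤ (α2 - α1 + th J) * Real.log x := by positivity
    nlinarith
  have e2 : 1/2 * ∑ q ∈ P, 1 / (q:ℝ) ≤ 0.0505 * J + 5 := by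
    have hsplit : ∑ q ∈ PI (x ^ th J) x, (1 / (q:ℝ)) = _ := sum_PI_split (fun q => 1 / (q:ℝ)) (u := x ^ th J) (v := x ^ (1/10:ℝ)) (w := x)
      (Real.rpow_le_rpow_of_exponent_le hx.le (th_le J))
      (by
        conv_rhs => rw [← Real.rpow_one x]
        exact Real.rpow_le_rpow_of_exponent_le hx.le (by norm_num))
    rw [hP, hsplit]
    linarith [hrb.2]
  have e3 : Real.exp (1/2 * ∑ q ∈ P, 1 / (q:ℝ)) ≤ Real.exp 5 * Real.exp (0.0505 * J) := by
    rw [← Real.exp_add]; apply Real.exp_le_exp.2; linarith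
  have hnn : 0 ≤ α2 - α1 + th J := by linarith
  calc 42 * (x / Real.log x) * ∑ s ∈ F, 1 / ((∏ q ∈ s, q : ℕ) : ℝ)
      ≤ 42 * (x / Real.log x) * ((2:ℝ) ^ B * (4 * (α2 - α1 + th J)) * (Real.exp 5 * Real.exp (0.0505 * J))) := by
        apply mul_le_mul_of_nonneg_left _ (by positivity)
        refine hr.trans ?_
        gcongr
    _ = _ := by ring

lemma exp_num : Real.exp 0.09 * (10/11) < 1 := by
  have h1 : Real.exp 0.09 ^ 100 = Real.exp 1 ^ 9 := by
    rw [← Real.exp_nat_mul, ← Real.exp_nat_mul]; norm_num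
  have h2 : Real.exp 1 ^ 9 < (11/10 : ℝ) ^ 100 := by
    have := Real.exp_one_lt_d9
    calc Real.exp 1 ^ 9 < 2.7182818286 ^ 9 := by gcongr
      _ < _ := by norm_num
  have h3 : Real.exp 0.09 < 11/10 := by
    apply lt_of_pow_lt_pow_left₀ 100 (by norm_num)
    rw [h1]; exact h2
  linarith

lemma choose_J (C K ε : ℝ) (hC : 0 ≤ C) (hK : 0 ≤ K) (hε : 0 < ε) : ∀ᶠ J : ℕ in atTop,
    C * (2:ℝ) ^ (0.0556 * (J:ℝ) + 5) * (K * th J) * Real.exp (0.0505 * J) ≤ ε := by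
  have h := tendsto_pow_atTop_nhds_zero_of_lt_one (by positivity) exp_num
  have h2 := h.const_mul (C * 32 * K)
  rw [mul_zero] at h2
  filter_upwards [h2.eventually (gt_mem_nhds hε)] with J hJ
  refine le_trans ?_ hJ.le
  have e1 : (2:ℝ) ^ (0.0556 * (J:ℝ) + 5) ≤ 32 * Real.exp (0.0395 * J) := by
    rw [Real.rpow_add (by norm_num)]
    have a1 : (2:ℝ) ^ (5:ℝ) = 32 := by norm_num
    rw [a1, mul_comm]
    gcongr
    rw [Real.rpow_def_of_pos (by norm_num)]
    apply Real.exp_le_exp.2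
    have := Real.log_two_lt_d9
    have hJ0 : (0:ℝ) ≤ J := by positivity
    nlinarith
  have e2 : Real.exp (0.0395 * J) * Real.exp (0.0505 * J) = Real.exp 0.09 ^ J := by
    rw [← Real.exp_add, ← Real.exp_nat_mul]; congr 1; ring
  unfold th
  calc C * (2:ℝ) ^ (0.0556 * (J:ℝ) + 5) * (K * (1 / 10 * (10 / 11) ^ J)) * Real.exp (0.0505 * J)
      ≤ C * (32 * Real.exp (0.0395 * J)) * (K * (1 * (10 / 11) ^ J)) * Real.exp (0.0505 * J) := by
        gcongr; norm_num
    _ = C * 32 * K * ((Real.exp (0.0395 * J) * Real.exp (0.0505 * J)) * (10/11) ^ J) := by ring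
    _ = C * 32 * K * (Real.exp 0.09 * (10/11)) ^ J := by rw [e2, mul_pow]

lemma th_tendsto : Tendsto th atTop (nhds 0) := by
  have h := (tendsto_pow_atTop_nhds_zero_of_lt_one (by norm_num : (0:ℝ) ≤ 10/11) (by norm_num)).const_mul (1/10)
  rw [mul_zero] at h
  exact h

open Classical in
/-- count of primes below the sieve mass -/
lemma prime_count_le_mass (A : ℝ) (hA : 2 ≤ A) : ∀ᶠ x : ℝ in atTop, ∀ (Pr : ℕ → Prop),
    (((PI (x / A) x).filter Pr).card : ℝ) ≤ ∑ n ∈ (Finset.Ioc 0 ⌊x⌋₊).filter Pr, Sel.nu (Rx x) n := by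
  have hA0 : 0 < A := by linarith
  filter_upwards [Rx_facts, eventually_gt_atTop 1, ev_pow 0 A (1/2) (by norm_num)] with x hR hx hAx Pr
  have hx0 : 0 < x := by linarith
  have hRp : ∀ p ∈ PI (x / A) x, Rx x < p := by
    intro p hp
    rw [mem_PI] at hp
    have a1 : (Rx x : ℝ) ≤ x ^ (1/20 : ℝ) := Nat.floor_le (by positivity)
    have a2 : x ^ (1/20 : ℝ) ≤ x ^ (1/2:ℝ) := Real.rpow_le_rpow_of_exponent_le hx.le (by norm_num)
    have a3 : x ^ (1/2:ℝ) ≤ x / A := by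
      rw [le_div_iff₀ hA0]
      have a4 : x ^ (1/2:ℝ) * x ^ (1/2:ℝ) = x := by rw [← Real.rpow_add hx0]; norm_num
      simp only [pow_zero, mul_one] at hAx
      calc x ^ (1/2:ℝ) * A ≤ x ^ (1/2:ℝ) * x ^ (1/2:ℝ) := by gcongr
        _ = x := a4
    have : (Rx x : ℝ) < p := by linarith [hp.2.1]
    exact_mod_cast this
  rw [Finset.card_eq_sum_ones, Nat.cast_sum]
  have hs2 : (PI (x / A) x).filter Pr ⊆ (Finset.Ioc 0 ⌊x⌋₊).filter Pr := by
    apply Finset.filter_subset_filter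
    intro p hp
    rw [mem_PI] at hp
    rw [Finset.mem_Ioc]
    exact ⟨hp.1.pos, Nat.le_floor hp.2.2⟩
  refine le_trans (Finset.sum_le_sum ?_) (Finset.sum_le_sum_of_subset_of_nonneg hs2
    (fun n _ _ => Sel.nu_nonneg _ _))
  intro p hp
  rw [Finset.mem_filter] at hp
  rw [Sel.nu_prime hR.1 (mem_PI.1 hp.1).1 (hRp p hp.1)]
  simp

/-- at most ten prime factors above `x^(1/10)` -/
lemma card_big (x : ℝ) (hx : 1 < x) (s : Finset ℕ) (m : ℕ) (hm : 1 ≤ m) (hmx : (m:ℝ) ≤ x)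
    (hs : ∀ q ∈ s, q.Prime ∧ q ∣ m) (e : ℝ) (he : 0 < e) (hb : ∀ q ∈ s, x ^ e < (q:ℝ)) : (s.card : ℝ) ≤ 1 / e := by
  have hx0 : 0 < x := by linarith
  have h1 : (x ^ e) ^ s.card ≤ ∏ q ∈ s, (q:ℝ) :=
    by rw [← Finset.prod_const]; exact Finset.prod_le_prod (fun q _ => by positivity) (fun q hq => (hb q hq).le)
  have h2 : ∏ q ∈ s, (q:ℝ) ≤ x := by
    refine le_trans ?_ hmx
    have h := (Nat.cast_le (α := ℝ)).2 (Nat.le_of_dvd hm (prod_primes_dvd s m hs))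
    push_cast at h
    exact h
  have h3 : x ^ (e * s.card) ≤ x ^ (1:ℝ) := by
    rw [Real.rpow_mul hx0.le, Real.rpow_natCast, Real.rpow_one]; linarith
  have := (Real.rpow_le_rpow_left_iff hx).1 h3
  rw [le_div_iff₀ he]; linarith

open Classical in
set_option maxHeartbeats 1000000 in
/-- Erdos type lemma: few shifted primes have a divisor in a narrow window. -/
lemma div_primes (ε0 A : ℝ) (hε0 : 0 < ε0) (hA : 2 ≤ A) : ∃ θ : ℝ, 0 < θ ∧ θ ≤ 1/100 ∧
    ∀ᶠ x : ℝ in atTop, (((PI (x / A) x).filter (fun p => ∃ D : ℕ, D ∣ p - 1 ∧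
      x ^ (1/3 - θ) ≤ (D:ℝ) ∧ (D:ℝ) ≤ x ^ (1/3 + θ))).card : ℝ) ≤ ε0 * (x / Real.log x) := by
  have hA0 : 0 < A := by linarith
  obtain ⟨C, hC, hwc⟩ := window_count
  set H : ℝ := 1000 / ε0 with hH
  have hH0 : 0 < H := by positivity
  set K : ℝ := H + 2 with hK
  have hJ1 := choose_J C (K + 4) (ε0 / 5) (by linarith) (by linarith) (by positivity)
  have hJ2 : ∀ᶠ J : ℕ in atTop, th J < min (1/100) (1 / (12 * (K + 2))) :=
    th_tendsto.eventually (gt_mem_nhds (by positivity))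
  have hJ3 : ∀ᶠ J : ℕ in atTop, 100000 * 5 / ε0 ≤ (J:ℝ) := tendsto_natCast_atTop_atTop.eventually_ge_atTop _
  obtain ⟨J, hJ1, hJ2, hJ3, hJ4⟩ := (hJ1.and (hJ2.and (hJ3.and (eventually_ge_atTop 12)))).exists
  set θ := th J with hθ
  have hθ0 : 0 < θ := th_pos J
  have hθ1 : θ < 1/100 := lt_of_lt_of_le hJ2 (min_le_left _ _)
  have hθ2 : (K + 2) * θ < 1/12 := by
    have := lt_of_lt_of_le hJ2 (min_le_right _ _)
    rw [lt_div_iff₀ (by positivity)] at this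
    linarith
  refine ⟨θ, hθ0, hθ1.le, ?_⟩
  have hK0 : 0 < K := by positivity
  have hKθ : 0 < K * θ := by positivity
  set B : ℝ := 0.0556 * (J:ℝ) + 5 with hB
  have w1 := hwc J A (1/3 - (K + 1) * θ) (1/3 + θ) B hA (by nlinarith) (by nlinarith) (by linarith)
  have w2 := hwc J A (2/3 - (K + 2) * θ) (2/3 + θ) B hA (by nlinarith) (by nlinarith) (by linarith)
  filter_upwards [w1, w2, prime_count_le_mass A hA, small_mass θ H hθ0 (by linarith) hH0, var_mass J hJ4,
    eventually_gt_atTop 1, ev_pow 0 (2 * A) θ hθ0, eventually_ge_atTop (2 * A), 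
    ev_pow 1 (10 / ε0) θ hθ0] with x hw1 hw2 hpc hsm hvm hx hAx hxA hlx
  have hx0 : 0 < x := by linarith
  have hl0 : 0 < Real.log x := Real.log_pos hx
  have hxl : 0 < x / Real.log x := by positivity
  simp only [pow_zero, mul_one, pow_one] at hAx hlx
  set P1 : ℕ → Prop := fun p => ∃ t : ℕ, x ^ θ < t ∧ t ^ 2 ∣ p - 1 with hP1
  set P2 : ℕ → Prop := fun n => H * θ * Real.log x ≤
      ∑ q ∈ (PI 1 (x ^ θ)).filter (fun q => n ≡ 1 [MOD q]), Real.log q with hP2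
  set P3 : ℕ → Prop := fun n => 0.1112 * (J:ℝ) <
      (((PI (x ^ th J) (x ^ (1/10:ℝ))).filter (fun q => n ≡ 1 [MOD q])).card : ℝ) with hP3
  set P4 : ℕ → Prop := fun p => ∃ s ⊆ PI (x ^ th J) x, ∏ q ∈ s, q ∣ p - 1 ∧
      x ^ (1/3 - (K + 1) * θ) ≤ ((∏ q ∈ s, q : ℕ) : ℝ) ∧ ((∏ q ∈ s, q : ℕ) : ℝ) ≤ x ^ (1/3 + θ) ∧ (s.card : ℝ) ≤ B with hP4
  set P5 : ℕ → Prop := fun p => ∃ s ⊆ PI (x ^ th J) x, ∏ q ∈ s, q ∣ p - 1 ∧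
      x ^ (2/3 - (K + 2) * θ) ≤ ((∏ q ∈ s, q : ℕ) : ℝ) ∧ ((∏ q ∈ s, q : ℕ) : ℝ) ≤ x ^ (2/3 + θ) ∧ (s.card : ℝ) ≤ B with hP5
  set S := PI (x / A) x with hS
  have hsub : S.filter (fun p => ∃ D : ℕ, D ∣ p - 1 ∧
      x ^ (1/3 - θ) ≤ (D:ℝ) ∧ (D:ℝ) ≤ x ^ (1/3 + θ)) ⊆
      S.filter P1 ∪ (S.filter P2 ∪ (S.filter P3 ∪ (S.filter P4 ∪ S.filter P5))) := by
    intro p hp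
    rw [Finset.mem_filter] at hp
    obtain ⟨hpS, D, hDm, hD1, hD2⟩ := hp
    by_cases c1 : P1 p
    · exact Finset.mem_union_left _ (Finset.mem_filter.2 ⟨hpS, c1⟩)
    by_cases c2 : P2 p
    · exact Finset.mem_union_right _ (Finset.mem_union_left _ (Finset.mem_filter.2 ⟨hpS, c2⟩))
    by_cases c3 : P3 p
    · exact Finset.mem_union_right _ (Finset.mem_union_right _ (Finset.mem_union_left _ (Finset.mem_filter.2 ⟨hpS, c3⟩)))
    apply Finset.mem_union_right _ (Finset.mem_union_right _ (Finset.mem_union_right _ _))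
    suffices P4 p ∨ P5 p by
      rcases this with h | h
      · exact Finset.mem_union_left _ (Finset.mem_filter.2 ⟨hpS, h⟩)
      · exact Finset.mem_union_right _ (Finset.mem_filter.2 ⟨hpS, h⟩)
    rw [hS, mem_PI] at hpS
    obtain ⟨hpp, hp1, hp2⟩ := hpS
    set m := p - 1 with hm
    have hm1 : 1 ≤ m := by have := hpp.two_le; omega
    have hmp : (m:ℝ) = p - 1 := by rw [hm, Nat.cast_sub hpp.one_le]; simp
    have hmx : (m:ℝ) ≤ x := by rw [hmp]; linarith
    have hmlow : x / (2 * A) ≤ m := by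
      have : x / (2 * A) = x / A - x / (2 * A) := by field_simp; ring
      have : 1 ≤ x / (2 * A) := by rw [one_le_div (by positivity)]; exact hxA
      rw [hmp]; linarith
    have hmod : ∀ q : ℕ, p ≡ 1 [MOD q] ↔ q ∣ m := fun q => by
      rw [hm, ← Nat.modEq_iff_dvd' hpp.one_le]
      exact ⟨fun h => h.symm, fun h => h.symm⟩
    obtain ⟨t, ht1, htm, hmle⟩ := rough_decomp m (x ^ θ) hm1
    have ht : (t:ℝ) ≤ x ^ θ := by
      by_contra h
      push Not at h
      exact c1 ⟨t, h, htm⟩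
    set s := m.primeFactors.filter (fun q : ℕ => x ^ θ < (q:ℝ)) with hs
    set w := ∏ q ∈ s, q with hw
    set Pp := ∏ q ∈ m.primeFactors.filter (fun q : ℕ => ¬ x ^ θ < (q:ℝ)), q with hPp
    have hPp0 : 0 < Pp := Finset.prod_pos (fun q hq => 
      (Nat.prime_of_mem_primeFactors (Finset.mem_filter.1 hq).1).pos)
    have hPx : (Pp:ℝ) ≤ x ^ (H * θ) := by
      have a1 : Real.log Pp < H * θ * Real.log x := by
        rw [hP2] at c2
        push Not at c2
        refine lt_of_le_of_lt ?_ c2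
        rw [hPp]
        push_cast
        rw [Real.log_prod (fun q hq => by
          exact_mod_cast (Nat.prime_of_mem_primeFactors (Finset.mem_filter.1 hq).1).ne_zero)]
        apply Finset.sum_le_sum_of_subset_of_nonneg
        · intro q hq
          rw [Finset.mem_filter, Nat.mem_primeFactors] at hq
          rw [Finset.mem_filter, mem_PI, hmod]
          exact ⟨⟨hq.1.1, by exact_mod_cast hq.1.1.one_lt, not_lt.1 hq.2⟩, hq.1.2.1⟩
        · intro q _ _; exact Real.log_natCast_nonneg q
      rw [← Real.log_rpow hx0] at a1
      exact ((Real.log_lt_log_iff (by exact_mod_cast hPp0) (by positivity)).1 a1).le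
    set c0 := x ^ (K * θ) with hc0
    have hc00 : 0 < c0 := by positivity
    have hmc : (m:ℝ) ≤ c0 * ((∏ q ∈ s, q : ℕ) : ℝ) := by
      have a1 : (m:ℝ) ≤ (t:ℝ) ^ 2 * ((w:ℝ) * Pp) := by exact_mod_cast hmle
      have a2 : (t:ℝ) ^ 2 * Pp ≤ c0 := by
        calc (t:ℝ) ^ 2 * Pp ≤ (x ^ θ) ^ 2 * x ^ (H * θ) := by gcongr
          _ = c0 := by
            rw [← Real.rpow_natCast, ← Real.rpow_mul hx0.le, ← Real.rpow_add hx0, hc0, hK]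
            congr 1; push_cast; ring
      calc (m:ℝ) ≤ (t:ℝ) ^ 2 * Pp * w := by linarith
        _ ≤ c0 * w := by gcongr
    have hsm : ∀ q ∈ s, q.Prime ∧ q ∣ m := by
      intro q hq
      rw [hs, Finset.mem_filter, Nat.mem_primeFactors] at hq
      exact ⟨hq.1.1, hq.1.2.1⟩
    have hsz : ∀ q ∈ s, x ^ θ < (q:ℝ) := fun q hq => (Finset.mem_filter.1 hq).2
    have hsPI : s ⊆ PI (x ^ th J) x := by
      intro q hq
      rw [mem_PI]
      refine ⟨(hsm q hq).1, hsz q hq, le_trans ?_ hmx⟩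
      exact_mod_cast Nat.le_of_dvd hm1 (hsm q hq).2
    have hscard : (s.card : ℝ) ≤ 0.1112 * J + 10 := by
      have a1 := Finset.card_filter_add_card_filter_not (s := s) (fun q : ℕ => (q:ℝ) ≤ x ^ (1/10:ℝ))
      have a2 : ((s.filter (fun q : ℕ => (q:ℝ) ≤ x ^ (1/10:ℝ))).card : ℝ) ≤ 0.1112 * J := by
        rw [hP3] at c3
        push Not at c3
        refine le_trans ?_ c3
        have : s.filter (fun q : ℕ => (q:ℝ) ≤ x ^ (1/10:ℝ)) ⊆ 
            (PI (x ^ th J) (x ^ (1/10:ℝ))).filter (fun q => p ≡ 1 [MOD q]) := by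
          intro q hq
          rw [Finset.mem_filter] at hq
          rw [Finset.mem_filter, mem_PI, hmod]
          exact ⟨⟨(hsm q hq.1).1, hsz q hq.1, hq.2⟩, (hsm q hq.1).2⟩
        exact_mod_cast Finset.card_le_card this
      have a3 := card_big x hx (s.filter (fun q : ℕ => ¬ (q:ℝ) ≤ x ^ (1/10:ℝ))) m hm1 hmx
        (fun q hq => hsm q (Finset.mem_filter.1 hq).1) (1/10) (by norm_num) 
        (fun q hq => not_le.1 (Finset.mem_filter.1 hq).2)
      have a4 : (s.card : ℝ) = ((s.filter (fun q : ℕ => (q:ℝ) ≤ x ^ (1/10:ℝ))).card : ℝ) +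
         ((s.filter (fun q : ℕ => ¬ (q:ℝ) ≤ x ^ (1/10:ℝ))).card : ℝ) := by exact_mod_cast a1.symm
      rw [a4]
      have a5 : (1:ℝ) / (1/10) = 10 := by norm_num
      rw [a5] at a3
      linarith
    obtain ⟨sD, sE, hsD, hsE, hcard, b1, b2, b3, b4⟩ := split_window m D hm1 hDm s hsm c0 hmc
    have hcard' : (sD.card : ℝ) + sE.card = s.card := by exact_mod_cast hcard
    have hD0 : (0:ℝ) < D := lt_of_lt_of_le (by positivity) hD1
    by_cases hc : (sD.card : ℝ) ≤ B
    · left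
      refine ⟨sD, hsD.trans hsPI, prod_primes_dvd _ _ (fun q hq => hsm q (hsD hq)), ?_, b1.trans hD2, hc⟩
      have a1 : x ^ (1/3 - (K + 1) * θ) * c0 = x ^ (1/3 - θ) := by
        rw [hc0, ← Real.rpow_add hx0]; congr 1; ring
      have a2 : x ^ (1/3 - (K + 1) * θ) * c0 ≤ ((∏ q ∈ sD, q : ℕ) : ℝ) * c0 := by
        rw [a1]; linarith
      exact le_of_mul_le_mul_right a2 hc00
    · right
      push Not at hc
      have hcE : (sE.card : ℝ) ≤ B := by rw [hB] at hc ⊢; linarith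
      refine ⟨sE, hsE.trans hsPI, prod_primes_dvd _ _ (fun q hq => hsm q (hsE hq)), ?_, ?_, hcE⟩
      · have a1 : x / (2 * A) ≤ c0 * x ^ (1/3 + θ) * ((∏ q ∈ sE, q : ℕ) : ℝ) := by
          refine (hmlow.trans b4).trans ?_
          gcongr
        have a2 : x ≤ x ^ θ * (c0 * x ^ (1/3 + θ) * ((∏ q ∈ sE, q : ℕ) : ℝ)) := by
          rw [div_le_iff₀ (by positivity)] at a1
          refine a1.trans ?_
          rw [mul_comm]
          gcongr
        have a3 : x ^ (2/3 - (K + 2) * θ) * (x ^ θ * c0 * x ^ (1/3 + θ)) = x := by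
          rw [hc0, ← Real.rpow_add hx0, ← Real.rpow_add hx0, ← Real.rpow_add hx0]
          conv_rhs => rw [← Real.rpow_one x]
          congr 1; ring
        have a4 : x ^ (2/3 - (K + 2) * θ) * (x ^ θ * c0 * x ^ (1/3 + θ)) ≤ 
            ((∏ q ∈ sE, q : ℕ) : ℝ) * (x ^ θ * c0 * x ^ (1/3 + θ)) := by
          rw [a3]; linarith
        exact le_of_mul_le_mul_right a4 (by positivity)
      · have a1 : x ^ (2/3 + θ) * x ^ (1/3 - θ) = x := by
          rw [← Real.rpow_add hx0]
          conv_rhs => rw [← Real.rpow_one x]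
          congr 1; ring
        have a2 : ((∏ q ∈ sE, q : ℕ) : ℝ) * x ^ (1/3 - θ) ≤ x ^ (2/3 + θ) * x ^ (1/3 - θ) := by
          rw [a1]
          refine le_trans ?_ hmx
          refine le_trans ?_ b3
          gcongr
        exact le_of_mul_le_mul_right a2 (by positivity)
  have hc1 : ((S.filter P1).card : ℝ) ≤ ε0 / 5 * (x / Real.log x) := by
    have a1 : (S.filter P1).card ≤ ((Finset.Ioc 0 ⌊x⌋₊).filter (fun n => ∃ t : ℕ, x ^ θ < t ∧ t ^ 2 ∣ n)).card := by
      apply Finset.card_le_card_of_injOn (fun p => p - 1)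
      · intro p hp
        rw [Finset.mem_coe, Finset.mem_filter, hS, mem_PI] at hp
        rw [Finset.mem_coe, Finset.mem_filter, Finset.mem_Ioc]
        have := hp.1.1.two_le
        have := Nat.le_floor hp.1.2.2
        exact ⟨⟨by show 0 < p - 1; omega, by show p - 1 ≤ _; omega⟩, hp.2⟩
      · intro p hp p' hp' h
        rw [Finset.mem_coe, Finset.mem_filter, hS, mem_PI] at hp hp'
        have := hp.1.1.two_le
        have := hp'.1.1.two_le
        simp only at h
        omega
    have a2 := sq_count ⌊x⌋₊ (x ^ θ) (by positivity)
    have a3 : ((S.filter P1).card : ℝ) ≤ 2 * x / x ^ θ := by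
      refine le_trans (by exact_mod_cast a1) (a2.trans ?_)
      gcongr
      exact Nat.floor_le hx0.le
    refine a3.trans ?_
    rw [div_le_iff₀ (by positivity)]
    have : ε0 / 5 * (x / Real.log x) * (10 / ε0 * Real.log x) = 2 * x := by field_simp; norm_num
    rw [← this]
    gcongr
  have hc2 : ((S.filter P2).card : ℝ) ≤ ε0 / 5 * (x / Real.log x) := by
    refine (hpc P2).trans ?_
    have e : 200 / H = ε0 / 5 := by rw [hH]; field_simp; norm_num
    rw [← e]
    convert hsm using 2
  have hc3 : ((S.filter P3).card : ℝ) ≤ ε0 / 5 * (x / Real.log x) := by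
    refine (hpc P3).trans ?_
    have e : 100000 / (J:ℝ) ≤ ε0 / 5 := by
      rw [div_le_iff₀ hε0] at hJ3
      have : (0:ℝ) < J := by exact_mod_cast (by omega : 0 < J)
      rw [div_le_iff₀ this]; linarith
    refine le_trans ?_ (mul_le_mul_of_nonneg_right e hxl.le)
    convert hvm using 2
  have hfin : C * (x / Real.log x) * (2:ℝ) ^ B * ((K + 4) * θ) * Real.exp (0.0505 * J) ≤ ε0 / 5 * (x / Real.log x) := by
    have := mul_le_mul_of_nonneg_right hJ1 hxl.le
    linarith
  have hc4 : ((S.filter P4).card : ℝ) ≤ ε0 / 5 * (x / Real.log x) := by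
    refine le_trans ?_ hfin
    refine hw1.trans ?_
    gcongr
    rw [← hθ]
    nlinarith
  have hc5 : ((S.filter P5).card : ℝ) ≤ ε0 / 5 * (x / Real.log x) := by
    refine le_trans ?_ hfin
    refine hw2.trans ?_
    gcongr
    rw [← hθ]
    nlinarith
  have hun : ((S.filter (fun p => ∃ D : ℕ, D ∣ p - 1 ∧
      x ^ (1/3 - θ) ≤ (D:ℝ) ∧ (D:ℝ) ≤ x ^ (1/3 + θ))).card : ℝ) ≤
      (S.filter P1).card + ((S.filter P2).card + ((S.filter P3).card + ((S.filter P4).card + (S.filter P5).card))) := by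
    have h := Finset.card_le_card hsub
    have u1 := Finset.card_union_le (S.filter P1) (S.filter P2 ∪ (S.filter P3 ∪ (S.filter P4 ∪ S.filter P5)))
    have u2 := Finset.card_union_le (S.filter P2) (S.filter P3 ∪ (S.filter P4 ∪ S.filter P5))
    have u3 := Finset.card_union_le (S.filter P3) (S.filter P4 ∪ S.filter P5)
    have u4 := Finset.card_union_le (S.filter P4) (S.filter P5)
    have : (S.filter (fun p => ∃ D : ℕ, D ∣ p - 1 ∧
      x ^ (1/3 - θ) ≤ (D:ℝ) ∧ (D:ℝ) ≤ x ^ (1/3 + θ))).card ≤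
      (S.filter P1).card + ((S.filter P2).card + ((S.filter P3).card + ((S.filter P4).card + (S.filter P5).card))) := by
      omega
    exact_mod_cast this
  linarith

/-- primes `p` such that `p-1` has no divisor near `p^(1/3)` -/
def Good (δ : ℝ) (p : ℕ) : Prop := ∀ D : ℕ, D ∣ p - 1 → (D:ℝ) ≤ (p:ℝ) ^ (1/3 + δ) → (D:ℝ) < (p:ℝ) ^ (1/3 - δ)

open Classical in
lemma good_block : ∃ δ A c : ℝ, 0 < δ ∧ δ ≤ 1/100 ∧ 2 ≤ A ∧ 0 < c ∧ ∀ᶠ x : ℝ in atTop,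
    c / Real.log x ≤ ∑ p ∈ PI (x / A) x, if Good δ p then 1 / (p:ℝ) else 0 := by
  obtain ⟨A, c, hA, hc, hpi⟩ := pi_lower
  obtain ⟨θ, hθ0, hθ1, hdiv⟩ := div_primes (c / 2) A (by positivity) hA
  have hA0 : 0 < A := by linarith
  refine ⟨θ / 2, A, c / 2, by positivity, by linarith, hA, by positivity, ?_⟩
  filter_upwards [hpi, hdiv, eventually_gt_atTop 1, ev_pow 0 A (θ/2) (by positivity)] with x hpi hdiv hx hAx
  have hx0 : 0 < x := by linarith
  have hl0 : 0 < Real.log x := Real.log_pos hx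
  simp only [pow_zero, mul_one] at hAx
  have h1 : (PI (x / A) x).filter (fun p => ¬ Good (θ/2) p) ⊆ (PI (x / A) x).filter (fun p => ∃ D : ℕ, D ∣ p - 1 ∧
      x ^ (1/3 - θ) ≤ (D:ℝ) ∧ (D:ℝ) ≤ x ^ (1/3 + θ)) := by
    intro p hp
    rw [Finset.mem_filter] at hp ⊢
    refine ⟨hp.1, ?_⟩
    have hp1 := mem_PI.1 hp.1
    have hng := hp.2
    unfold Good at hng
    push Not at hng
    obtain ⟨D, hD, h2, h3⟩ := hng
    have hp0 : (0:ℝ) < p := by exact_mod_cast hp1.1.pos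
    refine ⟨D, hD, ?_, ?_⟩
    · refine le_trans ?_ h3
      have a1 : (x / A) ^ (1/3 - θ/2) ≤ (p:ℝ) ^ (1/3 - θ/2) :=
        Real.rpow_le_rpow (by positivity) hp1.2.1.le (by linarith)
      refine le_trans ?_ a1
      have hxt : 1 ≤ x ^ (θ/2) := Real.one_le_rpow hx.le (by positivity)
      have a2 : x / x ^ (θ/2) ≤ x / A := by gcongr
      have a3 : (x ^ (1 - θ/2)) ^ (1/3 - θ/2) ≤ (x / A) ^ (1/3 - θ/2) := by
        apply Real.rpow_le_rpow (by positivity) _ (by linarith)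
        rw [Real.rpow_sub hx0, Real.rpow_one]; exact a2
      refine le_trans ?_ a3
      rw [← Real.rpow_mul hx0.le]
      apply Real.rpow_le_rpow_of_exponent_le hx.le
      nlinarith
    · refine h2.trans ?_
      calc (p:ℝ) ^ (1/3 + θ/2) ≤ x ^ (1/3 + θ/2) := Real.rpow_le_rpow hp0.le hp1.2.2 (by linarith)
        _ ≤ x ^ (1/3 + θ) := Real.rpow_le_rpow_of_exponent_le hx.le (by linarith)
  have h2 : (((PI (x / A) x).filter (fun p => ¬ Good (θ/2) p)).card : ℝ) ≤ c / 2 * (x / Real.log x) :=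
    le_trans (by exact_mod_cast Finset.card_le_card h1) hdiv
  have h3 := Finset.card_filter_add_card_filter_not (s := PI (x / A) x) (fun p => Good (θ/2) p)
  have h4 : (((PI (x / A) x).filter (fun p => Good (θ/2) p)).card : ℝ) +
     (((PI (x / A) x).filter (fun p => ¬ Good (θ/2) p)).card : ℝ) = ((PI (x / A) x).card : ℝ) := by
    exact_mod_cast h3
  have e1 : c * x / Real.log x = c * (x / Real.log x) := by ring
  have h5 : c / 2 * (x / Real.log x) ≤ (((PI (x / A) x).filter (fun p => Good (θ/2) p)).card : ℝ) := by
    linarith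
  rw [← Finset.sum_filter]
  have h6 : ∑ p ∈ (PI (x / A) x).filter (fun p => Good (θ/2) p), (1 / x) ≤
     ∑ p ∈ (PI (x / A) x).filter (fun p => Good (θ/2) p), 1 / (p:ℝ) := by
    apply Finset.sum_le_sum
    intro p hp
    have hp1 := mem_PI.1 (Finset.mem_filter.1 hp).1
    apply one_div_le_one_div_of_le
    · exact_mod_cast hp1.1.pos
    · exact hp1.2.2
  refine le_trans ?_ h6
  rw [Finset.sum_const, nsmul_eq_mul]
  calc c / 2 / Real.log x = c / 2 * (x / Real.log x) * (1 / x) := by field_simp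
    _ ≤ _ := by gcongr

lemma PI_blocks (f : ℕ → ℝ) (A b : ℝ) (hA : 1 ≤ A) (K j : ℕ)
    (h : ∀ k, K < k → k ≤ K + j → b ≤ ∑ p ∈ PI (A ^ k / A) (A ^ k), f p) :
    j * b ≤ ∑ p ∈ PI (A ^ K) (A ^ (K + j)), f p := by
  induction j with
  | zero =>
    have : PI (A ^ K) (A ^ (K + 0)) = ∅ := by
      ext p; rw [mem_PI]; simp only [add_zero, Finset.notMem_empty, iff_false]
      rintro ⟨_, h1, h2⟩; linarith
    rw [this]; simp
  | succ j ih =>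
    have ih' := ih (fun k h1 h2 => h k h1 (by omega))
    rw [sum_PI_split f (v := A ^ (K + j)) (pow_le_pow_right₀ hA (by omega)) (pow_le_pow_right₀ hA (by omega))]
    have h2 := h (K + (j + 1)) (by omega) le_rfl
    have hA0 : A ≠ 0 := by linarith
    have e : A ^ (K + (j + 1)) / A = A ^ (K + j) := by
      rw [← add_assoc, pow_succ]; field_simp
    rw [e] at h2
    push_cast
    linarith

open Classical in
lemma good_scale : ∃ δ c : ℝ, 0 < δ ∧ δ ≤ 1/100 ∧ 0 < c ∧ ∀ᶠ z : ℝ in atTop,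
    c ≤ ∑ p ∈ PI z (z ^ (4:ℝ)), if Good δ p then 1 / (p:ℝ) else 0 := by
  obtain ⟨δ, A, c, hδ, hδ1, hA, hc, hb⟩ := good_block
  have hA0 : 0 < A := by linarith
  have hA1 : 1 < A := by linarith
  have hlA : 0 < Real.log A := Real.log_pos hA1
  obtain ⟨y0, hy0⟩ := eventually_atTop.1 hb
  refine ⟨δ, c / (2 * Real.log A), hδ, hδ1, by positivity, ?_⟩
  filter_upwards [eventually_ge_atTop y0, eventually_ge_atTop A] with z hz hzA
  have hz1 : 1 < z := by linarith
  have hz0 : 0 < z := by linarith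
  set K := ⌊Real.log z / Real.log A⌋₊ + 1 with hK
  have hlz : 0 < Real.log z := Real.log_pos hz1
  have hK1 : Real.log z < K * Real.log A := by
    have := Nat.lt_floor_add_one (Real.log z / Real.log A)
    rw [div_lt_iff₀ hlA] at this
    rw [hK]; push_cast; exact this
  have hK2 : ((K:ℝ) - 1) * Real.log A ≤ Real.log z := by
    have := Nat.floor_le (by positivity : 0 ≤ Real.log z / Real.log A)
    rw [le_div_iff₀ hlA] at this
    rw [hK]; push_cast; linarith
  have hzK : z ≤ A ^ K := by
    apply (Real.log_le_log_iff hz0 (by positivity)).1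
    rw [Real.log_pow]; exact hK1.le
  have hlAz : Real.log A ≤ Real.log z := Real.log_le_log hA0 hzA
  have hKz : A ^ (K + K) ≤ z ^ (4:ℝ) := by
    apply (Real.log_le_log_iff (by positivity) (by positivity)).1
    rw [Real.log_pow, Real.log_rpow hz0]; push_cast; linarith
  have hKpos : (0:ℝ) < K := by rw [hK]; positivity
  have hbl := PI_blocks (fun p => if Good δ p then 1 / (p:ℝ) else 0) A (c / (2 * K * Real.log A)) hA1.le K K (by
    intro k hk1 hk2
    have hzk : z ≤ A ^ k := hzK.trans (pow_le_pow_right₀ hA1.le hk1.le)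
    refine le_trans ?_ (hy0 (A ^ k) (hz.trans hzk))
    rw [Real.log_pow]
    have : (k:ℝ) ≤ 2 * K := by exact_mod_cast (by omega : k ≤ 2 * K)
    have hk0 : (0:ℝ) < k := by exact_mod_cast (by omega : 0 < k)
    gcongr)
  have e : (K:ℝ) * (c / (2 * K * Real.log A)) = c / (2 * Real.log A) := by field_simp
  rw [e] at hbl
  refine hbl.trans ?_
  apply Finset.sum_le_sum_of_subset_of_nonneg
  · intro p hp
    rw [mem_PI] at hp ⊢
    exact ⟨hp.1, by linarith, by linarith⟩
  · intro p _ _; split_ifs <;> positivity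

open Classical in
lemma good_recip : ∃ δ : ℝ, 0 < δ ∧ δ ≤ 1/100 ∧ ∀ V : ℝ, ∃ c' : ℝ, 0 < c' ∧ c' < 1/3 ∧ ∀ᶠ x : ℝ in atTop,
    V ≤ ∑ p ∈ PI (x ^ c') (x ^ (1/3:ℝ)), if Good δ p then 1 / (p:ℝ) else 0 := by
  obtain ⟨δ, c, hδ, hδ1, hc, hs⟩ := good_scale
  refine ⟨δ, hδ, hδ1, ?_⟩
  have main : ∀ M : ℕ, ∀ᶠ x : ℝ in atTop,
      M * c ≤ ∑ p ∈ PI (x ^ (1/3 * (1/4:ℝ) ^ M)) (x ^ (1/3:ℝ)), if Good δ p then 1 / (p:ℝ) else 0 := by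
    intro M
    induction M with
    | zero =>
      filter_upwards with x
      simp only [Nat.cast_zero, zero_mul]
      exact Finset.sum_nonneg (fun p _ => by split_ifs <;> positivity)
    | succ M ih =>
      have ht : Tendsto (fun x : ℝ => x ^ (1/3 * (1/4:ℝ) ^ (M+1))) atTop atTop := tendsto_rpow_atTop (by positivity)
      filter_upwards [ih, ht.eventually hs, eventually_gt_atTop 1] with x h1 h2 hx
      have hx0 : 0 < x := by linarith
      have e : (x ^ (1/3 * (1/4:ℝ) ^ (M+1))) ^ (4:ℝ) = x ^ (1/3 * (1/4:ℝ) ^ M) := by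
        rw [← Real.rpow_mul hx0.le]; congr 1; rw [pow_succ]; ring
      rw [e] at h2
      have q1 : (1/4:ℝ) ^ (M+1) ≤ (1/4:ℝ) ^ M := pow_le_pow_of_le_one (by norm_num) (by norm_num) (by omega)
      have q2 : (1/4:ℝ) ^ M ≤ 1 := pow_le_one₀ (by norm_num) (by norm_num)
      rw [sum_PI_split _ (v := x ^ (1/3 * (1/4:ℝ) ^ M))
        (Real.rpow_le_rpow_of_exponent_le hx.le (by linarith))
        (Real.rpow_le_rpow_of_exponent_le hx.le (by linarith))]
      push_cast
      linarith
  intro V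
  obtain ⟨M, hM⟩ := exists_nat_ge (V / c)
  refine ⟨1/3 * (1/4:ℝ) ^ (M+1), by positivity, ?_, ?_⟩
  · have : (1/4:ℝ) ^ (M+1) < 1 := pow_lt_one₀ (by norm_num) (by norm_num) (by omega)
    linarith
  · filter_upwards [main (M+1)] with x hx
    refine le_trans ?_ hx
    rw [div_le_iff₀ hc] at hM
    push_cast
    linarith

/-- subgroup generated by `a`, `b` modulo `p` -/
def Gam (a b : ℤ) (p : ℕ) : Subgroup (ZMod p)ˣ :=
  Subgroup.closure {u : (ZMod p)ˣ | (u : ZMod p) = (a : ZMod p) ∨ (u : ZMod p) = (b : ZMod p)}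

lemma group_pigeon {G : Type*} [CommGroup G] [Finite G] (H : Subgroup G) (A B : G) (hA : A ∈ H) (hB : B ∈ H)
    (S : ℕ) (hS : Nat.card H < (S+1)^2) :
    ∃ u v : ℕ, u ≤ S ∧ v ≤ S ∧ (u ≠ 0 ∨ v ≠ 0) ∧ (A^u * B^v = 1 ∨ A^u = B^v) := by
  classical
  have := Fintype.ofFinite G
  have key : ∀ i j i' j' : ℕ, i ≤ S → j ≤ S → i' ≤ S → j' ≤ S → (i,j) ≠ (i',j') → A^i*B^j = A^i'*B^j' → i' ≤ i →
      ∃ u v : ℕ, u ≤ S ∧ v ≤ S ∧ (u ≠ 0 ∨ v ≠ 0) ∧ (A^u * B^v = 1 ∨ A^u = B^v) := by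
    intro i j i' j' hi hj hi' hj' hne h hle
    obtain ⟨u, rfl⟩ := Nat.exists_eq_add_of_le hle
    rw [pow_add, mul_assoc] at h
    have h := mul_left_cancel h
    rcases le_total j' j with h2 | h2
    · obtain ⟨v, rfl⟩ := Nat.exists_eq_add_of_le h2
      refine ⟨u, v, by omega, by omega, ?_, Or.inl ?_⟩
      · by_contra hc
        push Not at hc
        apply hne
        simp [hc.1, hc.2]
      · rw [pow_add, mul_left_comm] at h
        simpa using h
    · obtain ⟨v, rfl⟩ := Nat.exists_eq_add_of_le h2
      refine ⟨u, v, by omega, by omega, ?_, Or.inr ?_⟩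
      · by_contra hc
        push Not at hc
        apply hne
        simp [hc.1, hc.2]
      · rw [pow_add, mul_comm] at h
        exact mul_left_cancel h
  have hc : ((Finset.univ.filter (fun z : G => z ∈ H))).card < ((Finset.range (S+1)) ×ˢ (Finset.range (S+1))).card := by
    rw [Finset.card_product, Finset.card_range, ← sq]
    convert hS using 1
    rw [Nat.card_eq_fintype_card, Fintype.card_subtype]
  obtain ⟨⟨i,j⟩, h1, ⟨i',j'⟩, h2, hne, heq⟩ := Finset.exists_ne_map_eq_of_card_lt_of_maps_to hc
    (f := fun q : ℕ × ℕ => A^q.1*B^q.2) (by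
      intro q hq
      simp only [Finset.coe_filter, Finset.mem_univ, true_and, Set.mem_ofPred_eq]
      exact H.mul_mem (H.pow_mem hA _) (H.pow_mem hB _))
  simp only [Finset.mem_product, Finset.mem_range] at h1 h2 heq
  rcases le_total i' i with h | h
  · exact key i j i' j' (by omega) (by omega) (by omega) (by omega) hne heq h
  · exact key i' j' i j (by omega) (by omega) (by omega) (by omega) hne.symm heq.symm h

lemma units_ab (a : ℤ) (p : ℕ) (hp : p.Prime) (ha : ¬ (p:ℤ) ∣ a) : ∃ A : (ZMod p)ˣ, (A : ZMod p) = (a : ZMod p) := by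
  have := Fact.mk hp
  have h : (a : ZMod p) ≠ 0 := by
    intro h
    exact ha ((ZMod.intCast_zmod_eq_zero_iff_dvd a p).1 h)
  exact ⟨Units.mk0 _ h, rfl⟩

lemma mod_pigeon (a b : ℤ) (p : ℕ) (hp : p.Prime) (ha : ¬ (p:ℤ) ∣ a) (hb : ¬ (p:ℤ) ∣ b)
    (S : ℕ) (hS : Nat.card (Gam a b p) < (S+1)^2) :
    ∃ u v : ℕ, u ≤ S ∧ v ≤ S ∧ (u ≠ 0 ∨ v ≠ 0) ∧ (p:ℤ) ∣ (a^u*b^v-1)*(a^u-b^v) := by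
  have := Fact.mk hp
  obtain ⟨A, hA⟩ := units_ab a p hp ha
  obtain ⟨B, hB⟩ := units_ab b p hp hb
  obtain ⟨u, v, hu, hv, h0, h⟩ := group_pigeon (Gam a b p) A B (Subgroup.subset_closure (Or.inl hA))
    (Subgroup.subset_closure (Or.inr hB)) S hS
  refine ⟨u, v, hu, hv, h0, ?_⟩
  rw [← ZMod.intCast_zmod_eq_zero_iff_dvd]
  push_cast
  rw [← hA, ← hB]
  rcases h with h | h
  · have : (A:ZMod p)^u*(B:ZMod p)^v = 1 := by have := congrArg Units.val h; simpa using this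
    rw [this]; simp
  · have : (A:ZMod p)^u = (B:ZMod p)^v := by exact_mod_cast congrArg Units.val h
    rw [this]; simp

lemma F_ne (a b : ℤ) (ha : a ≠ 0) (hb : b ≠ 0)
    (hind : ∀ m n : ℤ, (a : ℚ) ^ m * (b : ℚ) ^ n = 1 → m = 0 ∧ n = 0) (u v : ℕ) (h0 : u ≠ 0 ∨ v ≠ 0) :
    (a^u*b^v-1)*(a^u-b^v) ≠ 0 := by
  intro h
  rcases mul_eq_zero.1 h with h | h
  · have h1 : (a:ℚ)^u*(b:ℚ)^v = 1 := by
      have : a^u*b^v = 1 := by linarith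
      exact_mod_cast this
    have := hind u v (by simpa using h1)
    omega
  · have h1 : (a:ℚ)^u = (b:ℚ)^v := by
      have : a^u = b^v := by linarith
      exact_mod_cast this
    have hb' : (b:ℚ) ≠ 0 := by exact_mod_cast hb
    have := hind u (-v) (by simp [h1, hb'])
    omega

open Classical in
lemma exc_count (a b : ℤ) (ha : a ≠ 0) (hb : b ≠ 0)
    (hind : ∀ m n : ℤ, (a : ℚ) ^ m * (b : ℚ) ^ n = 1 → m = 0 ∧ n = 0) :
    ∃ C : ℝ, 1 ≤ C ∧ ∀ (M : ℝ), 1 ≤ M → ∀ T : Finset ℕ, (∀ p ∈ T, p.Prime ∧ ¬ (p:ℤ) ∣ a ∧ ¬ (p:ℤ) ∣ b ∧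
      (Nat.card (Gam a b p) : ℝ) ≤ M) → (T.card : ℝ) ≤ C * M ^ (3/2 : ℝ) := by
  set K : ℕ := a.natAbs * b.natAbs with hK
  have ha1 : 1 ≤ a.natAbs := Int.natAbs_pos.2 ha
  have hb1 : 1 ≤ b.natAbs := Int.natAbs_pos.2 hb
  have hKa : a.natAbs ≤ K := Nat.le_mul_of_pos_right _ hb1
  have hKb : b.natAbs ≤ K := Nat.le_mul_of_pos_left _ ha1
  have hK1 : 1 ≤ K := le_trans ha1 hKa
  have hKlog : 0 ≤ Real.logb 2 K := Real.logb_nonneg (by norm_num) (by exact_mod_cast hK1)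
  refine ⟨8 * (2 + 2 * Real.logb 2 K), by linarith, ?_⟩
  intro M hM T hT
  set S : ℕ := ⌊Real.sqrt M⌋₊ with hS
  have hsM : 1 ≤ Real.sqrt M := Real.one_le_sqrt.2 hM
  have hS1 : Real.sqrt M < S + 1 := Nat.lt_floor_add_one _
  have hS2 : (S:ℝ) ≤ Real.sqrt M := Nat.floor_le (by positivity)
  set I := ((Finset.range (S+1)) ×ˢ (Finset.range (S+1))).filter (fun q : ℕ × ℕ => q.1 ≠ 0 ∨ q.2 ≠ 0) with hI
  set F : ℕ × ℕ → ℕ := fun q => ((a^q.1*b^q.2-1)*(a^q.1-b^q.2)).natAbs with hF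
  have hF0 : ∀ q ∈ I, F q ≠ 0 := by
    intro q hq
    rw [hF]; simp only [ne_eq, Int.natAbs_eq_zero]
    exact F_ne a b ha hb hind _ _ (Finset.mem_filter.1 hq).2
  have hP0 : ∏ q ∈ I, F q ≠ 0 := Finset.prod_ne_zero_iff.2 hF0
  have hFle : ∀ q ∈ I, F q ≤ 4 * K^(2*S) := by
    intro q hq
    have hq1 := Finset.mem_product.1 (Finset.mem_filter.1 hq).1
    simp only [Finset.mem_range] at hq1
    rw [hF]; simp only [Int.natAbs_mul]
    have e1 : (a^q.1*b^q.2-1).natAbs ≤ 2 * K^S := by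
      refine le_trans (Int.natAbs_sub_le _ _) ?_
      rw [Int.natAbs_mul, Int.natAbs_pow, Int.natAbs_pow]
      have : a.natAbs^q.1*b.natAbs^q.2 ≤ K^S := by
        rw [hK, mul_pow]
        exact Nat.mul_le_mul (Nat.pow_le_pow_right ha1 (by omega)) (Nat.pow_le_pow_right hb1 (by omega))
      have h1 : 1 ≤ K^S := Nat.one_le_pow _ _ hK1
      simp only [Int.natAbs_one]
      omega
    have e2 : (a^q.1-b^q.2).natAbs ≤ 2 * K^S := by
      refine le_trans (Int.natAbs_sub_le _ _) ?_
      rw [Int.natAbs_pow, Int.natAbs_pow]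
      have h1 : a.natAbs^q.1 ≤ K^S := le_trans (Nat.pow_le_pow_right ha1 (by omega : q.1 ≤ S)) (Nat.pow_le_pow_left hKa S)
      have h2 : b.natAbs^q.2 ≤ K^S := le_trans (Nat.pow_le_pow_right hb1 (by omega : q.2 ≤ S)) (Nat.pow_le_pow_left hKb S)
      omega
    calc _ ≤ (2 * K^S) * (2*K^S) := Nat.mul_le_mul e1 e2
      _ = 4 * K^(2*S) := by ring
  have hIc : I.card ≤ (S+1)^2 := by
    refine le_trans (Finset.card_filter_le _ _) ?_
    rw [Finset.card_product, Finset.card_range, sq]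
  have hPle : ∏ q ∈ I, F q ≤ (4 * K^(2*S))^((S+1)^2) := by
    refine le_trans (Finset.prod_le_pow_card _ _ _ hFle) ?_
    exact Nat.pow_le_pow_right (by have := Nat.one_le_pow (2*S) K hK1; omega) hIc
  have hTd : ∏ p ∈ T, p ∣ ∏ q ∈ I, F q := by
    refine prod_primes_dvd T _ ?_
    intro p hp
    obtain ⟨hp1, hp2, hp3, hp4⟩ := hT p hp
    refine ⟨hp1, ?_⟩
    obtain ⟨u, v, hu, hv, h0, hd⟩ := mod_pigeon a b p hp1 hp2 hp3 S (by
      have : (Nat.card (Gam a b p) : ℝ) < ((S:ℝ)+1)^2 := by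
        have e : M = Real.sqrt M ^ 2 := (Real.sq_sqrt (by linarith)).symm
        have : Real.sqrt M ^ 2 < ((S:ℝ)+1)^2 := by gcongr
        linarith
      exact_mod_cast this)
    have hmem : (u,v) ∈ I := by
      rw [hI, Finset.mem_filter, Finset.mem_product]
      refine ⟨⟨Finset.mem_range.2 (by simpa using Nat.lt_succ_of_le hu), Finset.mem_range.2 (by simpa using Nat.lt_succ_of_le hv)⟩, h0⟩
    refine dvd_trans ?_ (Finset.dvd_prod_of_mem F hmem)
    exact Int.natCast_dvd.1 hd
  have h2T : 2 ^ T.card ≤ ∏ p ∈ T, p := Finset.pow_card_le_prod T _ 2 (fun p hp => (hT p hp).1.two_le)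
  have hall : 2 ^ T.card ≤ (4 * K^(2*S))^((S+1)^2) :=
    h2T.trans ((Nat.le_of_dvd (Nat.pos_of_ne_zero hP0) hTd).trans hPle)
  have hallR : (2:ℝ) ^ T.card ≤ (4 * (K:ℝ)^(2*S))^((S+1)^2) := by exact_mod_cast hall
  have hlog := Real.logb_le_logb_of_le (b := 2) (by norm_num) (by positivity) hallR
  have hKR : (0:ℝ) < K := by exact_mod_cast hK1
  rw [Real.logb_pow, Real.logb_pow, Real.logb_mul (by norm_num) (by positivity), Real.logb_pow, Real.logb_self_eq_one (by norm_num)] at hlog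
  have h4 : Real.logb 2 4 = 2 := by
    rw [show (4:ℝ) = 2^(2:ℕ) by norm_num, Real.logb_pow, Real.logb_self_eq_one (by norm_num)]; norm_num
  rw [h4] at hlog
  push_cast at hlog
  have hM32 : M ^ (3/2:ℝ) = Real.sqrt M ^ 3 := by
    rw [Real.sqrt_eq_rpow, ← Real.rpow_natCast, ← Real.rpow_mul (by linarith)]; norm_num
  rw [hM32]
  set s := Real.sqrt M
  calc (T.card:ℝ) ≤ ((S:ℝ)+1)^2*(2 + 2*S*Real.logb 2 K) := by linarith
    _ ≤ (2*s)^2*((2*s)*(2 + 2 * Real.logb 2 K)) := by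
        have hS0 : (0:ℝ) ≤ S := Nat.cast_nonneg _
        gcongr
        · linarith
        · have : (S:ℝ) * Real.logb 2 K ≤ s * Real.logb 2 K := by gcongr
          nlinarith
    _ = _ := by ring

lemma exc_sum (a b : ℤ) (ha : a ≠ 0) (hb : b ≠ 0)
    (hind : ∀ m n : ℤ, (a : ℚ) ^ m * (b : ℚ) ^ n = 1 → m = 0 ∧ n = 0)
    (δ c τ : ℝ) (hδ : 0 < δ) (hδ1 : δ ≤ 1/2) (hc : 0 < c) (hτ : 0 < τ) :
    ∀ᶠ x : ℝ in atTop, ∀ T : Finset ℕ, (∀ p ∈ T, p.Prime ∧ ¬ (p:ℤ) ∣ a ∧ ¬ (p:ℤ) ∣ b ∧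
      (Nat.card (Gam a b p) : ℝ) ≤ (p:ℝ)^(2/3 - δ) ∧ x^c < (p:ℝ) ∧ (p:ℝ) ≤ x) → ∑ p ∈ T, 1/(p:ℝ) ≤ τ := by
  obtain ⟨C, hC, hcount⟩ := exc_count a b ha hb hind
  set κ := 3*δ/2 with hκ
  have hκ0 : 0 < κ := by positivity
  filter_upwards [ev_pow 1 (6*C/τ) (c*κ) (by positivity), ev_log_ge 1, eventually_ge_atTop 1] with x h1 hl hx T hT
  have hx0 : 0 < x := by linarith
  have hmaps : ∀ p ∈ T, Nat.log 2 p ∈ Finset.range (Nat.log 2 ⌊x⌋₊ + 1) := by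
    intro p hp
    rw [Finset.mem_range, Nat.lt_succ_iff]
    exact Nat.log_mono_right (Nat.le_floor (hT p hp).2.2.2.2.2)
  rw [← Finset.sum_fiberwise_of_maps_to hmaps]
  have hblock : ∀ j ∈ Finset.range (Nat.log 2 ⌊x⌋₊ + 1), ∑ p ∈ T.filter (fun p => Nat.log 2 p = j), 1/(p:ℝ) ≤ 2*C*x^(-(c*κ)) := by
    intro j _
    rcases (T.filter (fun p => Nat.log 2 p = j)).eq_empty_or_nonempty with he | ⟨p0, hp0⟩
    · rw [he]; simp; positivity
    set y : ℝ := (2:ℝ)^(j+1) with hy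
    have hy1 : 1 ≤ y := one_le_pow₀ (by norm_num)
    have hy0 : 0 < y := by linarith
    have hpy : ∀ p ∈ T.filter (fun p => Nat.log 2 p = j), (p:ℝ) < y ∧ y ≤ 2 * p := by
      intro p hp
      obtain ⟨hp1, hp2⟩ := Finset.mem_filter.1 hp
      have hpp := (hT p hp1).1
      have e1 := Nat.lt_pow_succ_log_self (b := 2) (by norm_num) p
      have e2 := Nat.pow_log_le_self 2 hpp.ne_zero
      rw [hp2] at e1 e2
      constructor
      · rw [hy]; exact_mod_cast e1
      · rw [hy, pow_succ]
        have : (2:ℝ)^j ≤ p := by exact_mod_cast e2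
        linarith
    have hcard := hcount (y^(2/3-δ)) (Real.one_le_rpow hy1 (by linarith)) (T.filter (fun p => Nat.log 2 p = j)) (by
      intro p hp
      obtain ⟨t1, t2, t3, t4, _⟩ := hT p (Finset.mem_filter.1 hp).1
      refine ⟨t1, t2, t3, t4.trans ?_⟩
      exact Real.rpow_le_rpow (Nat.cast_nonneg _) (hpy p hp).1.le (by linarith))
    have hxy : x^c < y := (hT p0 (Finset.mem_filter.1 hp0).1).2.2.2.2.1.trans (hpy p0 hp0).1
    calc ∑ p ∈ T.filter (fun p => Nat.log 2 p = j), 1/(p:ℝ) ≤ ∑ p ∈ T.filter (fun p => Nat.log 2 p = j), 2/y := by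
          refine Finset.sum_le_sum (fun p hp => ?_)
          have hpp : (0:ℝ) < p := by exact_mod_cast (hT p (Finset.mem_filter.1 hp).1).1.pos
          rw [div_le_div_iff₀ hpp hy0]
          linarith [(hpy p hp).2]
      _ = (T.filter (fun p => Nat.log 2 p = j)).card * (2/y) := by rw [Finset.sum_const, nsmul_eq_mul]
      _ ≤ (C * (y^(2/3-δ))^(3/2:ℝ)) * (2/y) := by gcongr
      _ = 2*C*y^(-κ) := by
          rw [← Real.rpow_mul hy0.le, show (2/3-δ)*(3/2) = 1 + (-κ) by rw [hκ]; ring, Real.rpow_add hy0, Real.rpow_one]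
          field_simp
      _ ≤ 2*C*(x^c)^(-κ) := by
          gcongr 2*C*?_
          exact Real.rpow_le_rpow_of_nonpos (by positivity) hxy.le (by linarith)
      _ = _ := by rw [← Real.rpow_mul hx0.le]; congr 2; ring
  refine (Finset.sum_le_sum hblock).trans ?_
  rw [Finset.sum_const, Finset.card_range, nsmul_eq_mul]
  have hL : ((Nat.log 2 ⌊x⌋₊ + 1 : ℕ):ℝ) ≤ 3 * Real.log x := by
    have hf : ⌊x⌋₊ ≠ 0 := by
      have := Nat.floor_pos.2 hx
      omega
    have e : (2:ℝ)^(Nat.log 2 ⌊x⌋₊) ≤ x := by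
      have e1 := Nat.pow_log_le_self 2 hf
      have e2 : (((2:ℕ)^(Nat.log 2 ⌊x⌋₊) : ℕ):ℝ) ≤ (⌊x⌋₊:ℝ) := by exact_mod_cast e1
      have e3 := Nat.floor_le hx0.le
      push_cast at e2
      linarith
    have e2 := Real.log_le_log (by positivity) e
    rw [Real.log_pow] at e2
    have := Real.log_two_gt_d9
    push_cast
    have h0 : (0:ℝ) ≤ (Nat.log 2 ⌊x⌋₊ : ℝ) := Nat.cast_nonneg _
    nlinarith
  calc ((Nat.log 2 ⌊x⌋₊ + 1 : ℕ):ℝ) * (2*C*x^(-(c*κ))) ≤ (3*Real.log x) * (2*C*x^(-(c*κ))) := by gcongr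
    _ = (6*C/τ * (Real.log x)^1) * τ * x^(-(c*κ)) := by field_simp; ring
    _ ≤ x^(c*κ) * τ * x^(-(c*κ)) := by gcongr
    _ = τ := by rw [Real.rpow_neg hx0.le]; field_simp

lemma gcd_dvd_of_comb (m k l e i : ℕ) (t : ℕ) (hi : i = 1 ∨ i = 2 ∨ i = 3) (h1 : e ∣ m)
    (h2 : e ∣ i * k) (h3 : e ∣ i * l) (hg : Nat.gcd (Nat.gcd m k) l = 1) (ht : t = i) : e ∣ t := by
  subst ht
  have h4 : e ∣ t * Nat.gcd (Nat.gcd m k) l := by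
    rw [← Nat.gcd_mul_left, ← Nat.gcd_mul_left]
    exact Nat.dvd_gcd (Nat.dvd_gcd (h1.mul_left t) h2) h3
  rwa [hg, mul_one] at h4

lemma five_gcd (m i j : ℕ) (hm : 0 < m) (hg : Nat.gcd (Nat.gcd m i) j = 1) :
    Nat.gcd m i * Nat.gcd m j * Nat.gcd m (i+j) * Nat.gcd m (2*i+j) * Nat.gcd m (i+2*j) ≤ 12 * m := by
  set d1 := Nat.gcd m i with h1
  set d2 := Nat.gcd m j with h2
  set d3 := Nat.gcd m (i+j) with h3
  set d4 := Nat.gcd m (2*i+j) with h4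
  set d5 := Nat.gcd m (i+2*j) with h5
  have m1 : d1 ∣ m := Nat.gcd_dvd_left _ _
  have m2 : d2 ∣ m := Nat.gcd_dvd_left _ _
  have m3 : d3 ∣ m := Nat.gcd_dvd_left _ _
  have m4 : d4 ∣ m := Nat.gcd_dvd_left _ _
  have m5 : d5 ∣ m := Nat.gcd_dvd_left _ _
  have r1 : (d1:ℤ) ∣ i := by exact_mod_cast Nat.gcd_dvd_right m i
  have r2 : (d2:ℤ) ∣ j := by exact_mod_cast Nat.gcd_dvd_right m j
  have r3 : (d3:ℤ) ∣ i+j := by exact_mod_cast Nat.gcd_dvd_right m (i+j)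
  have r4 : (d4:ℤ) ∣ 2*i+j := by exact_mod_cast Nat.gcd_dvd_right m (2*i+j)
  have r5 : (d5:ℤ) ∣ i+2*j := by exact_mod_cast Nat.gcd_dvd_right m (i+2*j)
  have key : ∀ d d' t : ℕ, (t = 1 ∨ t = 2 ∨ t = 3) → d ∣ m → (∀ e : ℤ, e ∣ d → e ∣ d' → e ∣ t * i ∧ e ∣ t * j) → Nat.gcd d d' ∣ t := by
    intro d d' t ht hd h
    obtain ⟨h6, h7⟩ := h (Nat.gcd d d') (by exact_mod_cast Nat.gcd_dvd_left _ _) (by exact_mod_cast Nat.gcd_dvd_right _ _)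
    exact gcd_dvd_of_comb m i j _ t t ht ((Nat.gcd_dvd_left _ _).trans hd) (by exact_mod_cast h6) (by exact_mod_cast h7) hg rfl
  have comb : ∀ (e u v : ℤ) (s t w : ℤ), e ∣ u → e ∣ v → w = s * u + t * v → e ∣ w := by
    intro e u v s t w hu hv h
    rw [h]; exact dvd_add (hu.mul_left s) (hv.mul_left t)
  have g12 : Nat.gcd d1 d2 ∣ 1 := key _ _ 1 (by simp) m1 (fun e he he' =>
    ⟨comb e i j 1 0 _ (he.trans r1) (he'.trans r2) (by push_cast; ring), comb e i j 0 1 _ (he.trans r1) (he'.trans r2) (by push_cast; ring)⟩)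
  have g13 : Nat.gcd d1 d3 ∣ 1 := key _ _ 1 (by simp) m1 (fun e he he' =>
    ⟨comb e i (i+j) 1 0 _ (he.trans r1) (he'.trans r3) (by push_cast; ring), comb e i (i+j) (-1) 1 _ (he.trans r1) (he'.trans r3) (by push_cast; ring)⟩)
  have g23 : Nat.gcd d2 d3 ∣ 1 := key _ _ 1 (by simp) m2 (fun e he he' =>
    ⟨comb e j (i+j) (-1) 1 _ (he.trans r2) (he'.trans r3) (by push_cast; ring), comb e j (i+j) 1 0 _ (he.trans r2) (he'.trans r3) (by push_cast; ring)⟩)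
  have g14 : Nat.gcd d1 d4 ∣ 1 := key _ _ 1 (by simp) m1 (fun e he he' =>
    ⟨comb e i (2*i+j) 1 0 _ (he.trans r1) (he'.trans r4) (by push_cast; ring), comb e i (2*i+j) (-2) 1 _ (he.trans r1) (he'.trans r4) (by push_cast; ring)⟩)
  have g24 : Nat.gcd d2 d4 ∣ 2 := key _ _ 2 (by simp) m2 (fun e he he' =>
    ⟨comb e j (2*i+j) (-1) 1 _ (he.trans r2) (he'.trans r4) (by push_cast; ring), comb e j (2*i+j) 2 0 _ (he.trans r2) (he'.trans r4) (by push_cast; ring)⟩)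
  have g34 : Nat.gcd d3 d4 ∣ 1 := key _ _ 1 (by simp) m3 (fun e he he' =>
    ⟨comb e (i+j) (2*i+j) (-1) 1 _ (he.trans r3) (he'.trans r4) (by push_cast; ring), comb e (i+j) (2*i+j) 2 (-1) _ (he.trans r3) (he'.trans r4) (by push_cast; ring)⟩)
  have g15 : Nat.gcd d1 d5 ∣ 2 := key _ _ 2 (by simp) m1 (fun e he he' =>
    ⟨comb e i (i+2*j) 2 0 _ (he.trans r1) (he'.trans r5) (by push_cast; ring), comb e i (i+2*j) (-1) 1 _ (he.trans r1) (he'.trans r5) (by push_cast; ring)⟩)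
  have g25 : Nat.gcd d2 d5 ∣ 1 := key _ _ 1 (by simp) m2 (fun e he he' =>
    ⟨comb e j (i+2*j) (-2) 1 _ (he.trans r2) (he'.trans r5) (by push_cast; ring), comb e j (i+2*j) 1 0 _ (he.trans r2) (he'.trans r5) (by push_cast; ring)⟩)
  have g35 : Nat.gcd d3 d5 ∣ 1 := key _ _ 1 (by simp) m3 (fun e he he' =>
    ⟨comb e (i+j) (i+2*j) 2 (-1) _ (he.trans r3) (he'.trans r5) (by push_cast; ring), comb e (i+j) (i+2*j) (-1) 1 _ (he.trans r3) (he'.trans r5) (by push_cast; ring)⟩)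
  have g45 : Nat.gcd d4 d5 ∣ 3 := key _ _ 3 (by simp) m4 (fun e he he' =>
    ⟨comb e (2*i+j) (i+2*j) 2 (-1) _ (he.trans r4) (he'.trans r5) (by push_cast; ring), comb e (2*i+j) (i+2*j) (-1) 2 _ (he.trans r4) (he'.trans r5) (by push_cast; ring)⟩)
  have c12 : Nat.Coprime d1 d2 := Nat.dvd_one.1 g12
  have c13 : Nat.Coprime d1 d3 := Nat.dvd_one.1 g13
  have c23 : Nat.Coprime d2 d3 := Nat.dvd_one.1 g23
  have m123 : d1*d2*d3 ∣ m := (Nat.Coprime.mul_left c13 c23).mul_dvd_of_dvd_of_dvd (c12.mul_dvd_of_dvd_of_dvd m1 m2) m3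
  have mulg : ∀ x y z : ℕ, Nat.gcd (x*y) z ∣ Nat.gcd x z * Nat.gcd y z := fun x y z => by
    rw [Nat.gcd_comm, Nat.gcd_comm x, Nat.gcd_comm y]
    exact Nat.gcd_mul_right_dvd_mul_gcd z x y
  have G4 : Nat.gcd (d1*d2*d3) d4 ∣ 2 := by
    refine (mulg _ _ _).trans ((mul_dvd_mul (mulg _ _ _) dvd_rfl).trans ?_)
    exact (mul_dvd_mul (mul_dvd_mul g14 g24) g34)
  have G5 : Nat.gcd (Nat.lcm (d1*d2*d3) d4) d5 ∣ 6 := by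
    have : Nat.gcd (Nat.lcm (d1*d2*d3) d4) d5 ∣ Nat.gcd (d1*d2*d3*d4) d5 :=
      Nat.gcd_dvd_gcd_of_dvd_left _ (Nat.lcm_dvd (Dvd.intro _ rfl) (Dvd.intro_left _ rfl))
    refine this.trans ((mulg _ _ _).trans ((mul_dvd_mul ((mulg _ _ _).trans (mul_dvd_mul (mulg _ _ _) dvd_rfl)) dvd_rfl).trans ?_))
    exact mul_dvd_mul (mul_dvd_mul (mul_dvd_mul g15 g25) g35) g45
  have L5 : Nat.lcm (Nat.lcm (d1*d2*d3) d4) d5 ≤ m := Nat.le_of_dvd hm (Nat.lcm_dvd (Nat.lcm_dvd m123 m4) m5)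
  have e4 := Nat.gcd_mul_lcm (d1*d2*d3) d4
  have e5 := Nat.gcd_mul_lcm (Nat.lcm (d1*d2*d3) d4) d5
  have b4 := Nat.le_of_dvd (by norm_num) G4
  have b5 := Nat.le_of_dvd (by norm_num) G5
  calc d1*d2*d3*d4*d5 = Nat.gcd (d1*d2*d3) d4 * (Nat.lcm (d1*d2*d3) d4 * d5) := by rw [← e4, mul_assoc]
    _ = Nat.gcd (d1*d2*d3) d4 * (Nat.gcd (Nat.lcm (d1*d2*d3) d4) d5 * Nat.lcm (Nat.lcm (d1*d2*d3) d4) d5) := by rw [e5]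
    _ ≤ 2 * (6 * m) := by gcongr
    _ = 12 * m := by ring

lemma group_five {G : Type*} [CommGroup G] [Finite G] [IsCyclic G] (A B : G) :
    (Nat.card (Subgroup.closure {A, B})) ^ 4 ≤
      12 * (orderOf A * orderOf B * orderOf (A*B) * orderOf (A^2*B) * orderOf (A*B^2)) := by
  set H := Subgroup.closure {A, B} with hH
  obtain ⟨g0, hg0⟩ := IsCyclic.exists_generator (α := H)
  set g : G := g0.1 with hg
  have hz : ∀ z ∈ H, z ∈ Subgroup.zpowers g := by
    intro z hz
    obtain ⟨k, hk⟩ := Subgroup.mem_zpowers_iff.1 (hg0 ⟨z, hz⟩)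
    refine Subgroup.mem_zpowers_iff.2 ⟨k, ?_⟩
    have := congrArg Subtype.val hk
    simpa using this
  have hm : orderOf g = Nat.card H := by
    rw [hg, Subgroup.orderOf_coe]
    exact orderOf_eq_card_of_forall_mem_zpowers hg0
  set m := Nat.card H with hmdef
  have hm0 : 0 < m := Nat.card_pos
  have hnat : ∀ z ∈ H, ∃ i : ℕ, g ^ i = z := fun z h => by
    have := (mem_powers_iff_mem_zpowers).2 (hz z h)
    exact (Submonoid.mem_powers_iff _ _).1 this
  obtain ⟨i, hi⟩ := hnat A (Subgroup.subset_closure (by simp))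
  obtain ⟨j, hj⟩ := hnat B (Subgroup.subset_closure (by simp))
  have hgcd : Nat.gcd (Nat.gcd m i) j = 1 := by
    set e := Nat.gcd (Nat.gcd m i) j with he
    have hei : e ∣ i := (Nat.gcd_dvd_left _ _).trans (Nat.gcd_dvd_right _ _)
    have hej : e ∣ j := Nat.gcd_dvd_right _ _
    have hem : e ∣ m := (Nat.gcd_dvd_left _ _).trans (Nat.gcd_dvd_left _ _)
    have hle : H ≤ Subgroup.zpowers (g^e) := by
      rw [hH, Subgroup.closure_le]
      intro z hz
      simp only [Set.mem_insert_iff, Set.mem_singleton_iff] at hz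
      obtain ⟨i', hi'⟩ := hei
      obtain ⟨j', hj'⟩ := hej
      rcases hz with rfl | rfl
      · rw [← hi, hi', pow_mul]; exact Subgroup.pow_mem _ (Subgroup.mem_zpowers _) _
      · rw [← hj, hj', pow_mul]; exact Subgroup.pow_mem _ (Subgroup.mem_zpowers _) _
    have h1 : m ∣ orderOf (g^e) := by
      have := Subgroup.card_dvd_of_le hle
      rwa [Nat.card_zpowers] at this
    rw [orderOf_pow, hm, Nat.gcd_eq_right hem] at h1
    have he0 : 0 < e := Nat.pos_of_dvd_of_pos hem hm0
    have h2 := Nat.le_of_dvd (Nat.div_pos (Nat.le_of_dvd hm0 hem) he0) h1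
    by_contra hne
    have : m / e < m := Nat.div_lt_self hm0 (by omega)
    omega
  have hord : ∀ k : ℕ, orderOf (g^k) * Nat.gcd m k = m := by
    intro k
    rw [orderOf_pow, hm, Nat.div_mul_cancel (Nat.gcd_dvd_left _ _)]
  have o1 := hord i
  have o2 := hord j
  have o3 := hord (i+j)
  have o4 := hord (2*i+j)
  have o5 := hord (i+2*j)
  rw [hi] at o1
  rw [hj] at o2
  rw [pow_add, hi, hj] at o3
  rw [pow_add, mul_comm 2 i, pow_mul, hi, hj, mul_comm i 2] at o4
  rw [pow_add, mul_comm 2 j, pow_mul, hi, hj, mul_comm j 2] at o5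
  have h5 := five_gcd m i j hm0 hgcd
  have hprod : (orderOf A * orderOf B * orderOf (A*B) * orderOf (A^2*B) * orderOf (A*B^2)) *
      (Nat.gcd m i * Nat.gcd m j * Nat.gcd m (i+j) * Nat.gcd m (2*i+j) * Nat.gcd m (i+2*j)) = m^5 := by
    calc _ = (orderOf A * Nat.gcd m i) * (orderOf B * Nat.gcd m j) * (orderOf (A*B) * Nat.gcd m (i+j)) *
        (orderOf (A^2*B) * Nat.gcd m (2*i+j)) * (orderOf (A*B^2) * Nat.gcd m (i+2*j)) := by ring
      _ = m^5 := by rw [o1, o2, o3, o4, o5]; ring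
  have h6 := Nat.mul_le_mul_left (orderOf A * orderOf B * orderOf (A*B) * orderOf (A^2*B) * orderOf (A*B^2)) h5
  rw [hprod] at h6
  have : m * m^4 ≤ m * (12 * (orderOf A * orderOf B * orderOf (A*B) * orderOf (A^2*B) * orderOf (A*B^2))) := by
    calc m * m^4 = m^5 := by ring
      _ ≤ _ := h6
      _ = _ := by ring
  exact Nat.le_of_mul_le_mul_left this hm0

lemma prime_five (a b : ℤ) (p : ℕ) (hp : p.Prime) (ha : ¬ (p:ℤ) ∣ a) (hb : ¬ (p:ℤ) ∣ b) :
    (Nat.card (Gam a b p)) ^ 4 ≤ 12 * (orderOf ((a:ℤ) : ZMod p) * orderOf ((b:ℤ) : ZMod p) * orderOf ((a*b : ℤ) : ZMod p) *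
      orderOf ((a^2*b : ℤ) : ZMod p) * orderOf ((a*b^2 : ℤ) : ZMod p)) := by
  have := Fact.mk hp
  obtain ⟨A, hA⟩ := units_ab a p hp ha
  obtain ⟨B, hB⟩ := units_ab b p hp hb
  have hG : Gam a b p = Subgroup.closure {A, B} := by
    unfold Gam
    congr 1
    ext u
    simp only [Set.mem_ofPred_eq, Set.mem_insert_iff, Set.mem_singleton_iff]
    rw [← hA, ← hB, Units.val_inj, Units.val_inj]
  rw [hG]
  have h := group_five A B
  simp only [← orderOf_units] at h
  push_cast at h ⊢
  rwa [hA, hB] at h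

lemma card_Gam_dvd (a b : ℤ) (p : ℕ) (hp : p.Prime) : Nat.card (Gam a b p) ∣ p - 1 := by
  have := Fact.mk hp
  have h := Subgroup.card_subgroup_dvd_card (Gam a b p)
  rwa [Nat.card_eq_fintype_card (α := (ZMod p)ˣ), ZMod.card_units_eq_totient, Nat.totient_prime hp] at h

lemma good_large (a b : ℤ) (p : ℕ) (hp : p.Prime) (δ δ' : ℝ) (hδ : δ' ≤ δ) (hG : Good δ p)
    (hm : (p:ℝ)^(2/3 - δ') < (Nat.card (Gam a b p) : ℝ)) :
    (p:ℝ)^(2/3 + δ) / 2 ≤ (Nat.card (Gam a b p) : ℝ) := by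
  obtain ⟨D, hD⟩ := card_Gam_dvd a b p hp
  set m := Nat.card (Gam a b p)
  have hp2 : (2:ℝ) ≤ p := by exact_mod_cast hp.two_le
  have hp0 : (0:ℝ) < p := by linarith
  have hR : (m:ℝ) * D = p - 1 := by
    have : ((p - 1 : ℕ):ℝ) = (p:ℝ) - 1 := by rw [Nat.cast_sub hp.one_le]; simp
    rw [← this, hD]; push_cast; ring
  have hm0 : (0:ℝ) < m := lt_trans (by positivity) hm
  have hD0 : (0:ℝ) < D := by
    by_contra hc
    have : (D:ℝ) = 0 := le_antisymm (not_lt.1 hc) (Nat.cast_nonneg _)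
    rw [this] at hR; linarith
  have h1 : (D:ℝ) ≤ (p:ℝ)^(1/3+δ) := by
    have e : (p:ℝ)^(2/3-δ') * (p:ℝ)^(1/3+δ') = p := by
      rw [← Real.rpow_add hp0]; norm_num
    have e1 : (p:ℝ)^(2/3-δ') * D ≤ (p:ℝ)^(2/3-δ') * (p:ℝ)^(1/3+δ') := by
      rw [e]
      have : (p:ℝ)^(2/3-δ') * D ≤ m * D := by gcongr
      linarith
    have e2 := le_of_mul_le_mul_left e1 (by positivity)
    exact e2.trans (Real.rpow_le_rpow_of_exponent_le (by linarith) (by linarith))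
  have h2 := hG D ⟨m, by rw [hD]; ring⟩ h1
  have e : (p:ℝ)^(2/3+δ) * (p:ℝ)^(1/3-δ) = p := by
    rw [← Real.rpow_add hp0]
    rw [show (2/3+δ)+(1/3-δ) = 1 by ring, Real.rpow_one]
  have hq : (0:ℝ) < (p:ℝ)^(1/3-δ) := by positivity
  have h3 : (m:ℝ) * D ≤ m * (p:ℝ)^(1/3-δ) := by gcongr
  have h4 : (p:ℝ)^(2/3+δ)/2 * (p:ℝ)^(1/3-δ) ≤ m * (p:ℝ)^(1/3-δ) := by
    rw [div_mul_eq_mul_div, e]; linarith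
  exact le_of_mul_le_mul_right h4 hq

lemma ellc_spec (a : ℤ) (n : ℕ) (hn : 1 ≤ n) : ∃ n' : ℕ, ellc a n = orderOf (a : ZMod n') ∧ 1 ≤ n' ∧ Nat.Coprime n' a.natAbs ∧
    ∀ p : ℕ, p.Prime → p ∣ n → ¬ (p:ℤ) ∣ a → p ∣ n' := by
  set F := n.divisors.filter (fun d => Nat.Coprime d a.natAbs) with hF
  have h1 : (1:ℕ) ∈ F := by
    rw [hF, Finset.mem_filter]
    exact ⟨Nat.one_mem_divisors.2 (by omega), Nat.coprime_one_left _⟩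
  obtain ⟨n', hn'⟩ := Finset.max_of_mem h1
  have hmem := Finset.mem_of_max hn'
  have hmem' := hmem
  rw [hF, Finset.mem_filter, Nat.mem_divisors] at hmem
  refine ⟨n', ?_, Nat.pos_of_dvd_of_pos hmem.1.1 hn, hmem.2, ?_⟩
  · unfold ellc
    rw [← hF, hn']
  · intro p hp hpn hpa
    by_contra hc
    have hcop : Nat.Coprime p n' := (Nat.Prime.coprime_iff_not_dvd hp).2 hc
    have hmem2 : p * n' ∈ F := by
      rw [hF, Finset.mem_filter, Nat.mem_divisors]
      refine ⟨⟨hcop.mul_dvd_of_dvd_of_dvd hpn hmem.1.1, hmem.1.2⟩, ?_⟩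
      refine Nat.Coprime.mul_left ?_ hmem.2
      rw [Nat.Prime.coprime_iff_not_dvd hp]
      rwa [Int.natCast_dvd] at hpa
    have hle := Finset.le_max_of_eq hmem2 hn'
    have hpos : 0 < n' := Nat.pos_of_dvd_of_pos hmem.1.1 hn
    have := hp.two_le
    nlinarith

lemma ellc_pos (a : ℤ) (n : ℕ) (hn : 1 ≤ n) : 0 < ellc a n := by
  obtain ⟨n', h1, h2, h3, -⟩ := ellc_spec a n hn
  rw [h1]
  have : NeZero n' := ⟨by omega⟩
  have hu : IsUnit (a : ZMod n') := by
    rw [ZMod.coe_int_isUnit_iff_isCoprime]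
    rw [Int.isCoprime_iff_gcd_eq_one]
    simpa [Int.gcd, Nat.Coprime] using (by first | exact h3 | exact h3.symm)
  obtain ⟨u, hu⟩ := hu
  rw [← hu, orderOf_units]
  exact orderOf_pos u

lemma order_dvd_ellc (a : ℤ) (n : ℕ) (hn : 1 ≤ n) (p : ℕ) (hp : p.Prime) (hpn : p ∣ n) (hpa : ¬ (p:ℤ) ∣ a) :
    orderOf (a : ZMod p) ∣ ellc a n := by
  obtain ⟨n', h1, -, -, h4⟩ := ellc_spec a n hn
  have hd := h4 p hp hpn hpa
  rw [h1]
  have := orderOf_map_dvd (ZMod.castHom hd (ZMod p)).toMonoidHom (a : ZMod n')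
  simpa using this

lemma order_dvd_pred (a : ℤ) (p : ℕ) (hp : p.Prime) (hpa : ¬ (p:ℤ) ∣ a) : orderOf (a : ZMod p) ∣ p - 1 := by
  have := Fact.mk hp
  apply ZMod.orderOf_dvd_card_sub_one
  intro h
  exact hpa ((ZMod.intCast_zmod_eq_zero_iff_dvd a p).1 h)

lemma gcd_prod_dvd' (S : Finset ℕ) (f : ℕ → ℕ) (m : ℕ) : Nat.gcd m (∏ q ∈ S, f q) ∣ ∏ q ∈ S, Nat.gcd m (f q) := by
  induction S using Finset.induction_on with
  | empty => simp
  | insert p S hp ih =>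
    rw [Finset.prod_insert hp, Finset.prod_insert hp]
    exact (Nat.gcd_mul_right_dvd_mul_gcd _ _ _).trans (mul_dvd_mul dvd_rfl ih)

lemma prod_le_lcm (S : Finset ℕ) (f : ℕ → ℕ) (Y : ℕ) (hY : 1 ≤ Y) (hf : ∀ p ∈ S, 0 < f p)
    (hg : ∀ p ∈ S, ∀ q ∈ S, p ≠ q → Nat.gcd (f p) (f q) ≤ Y) :
    ∏ p ∈ S, f p ≤ S.lcm f * Y ^ (S.card ^ 2) := by
  induction S using Finset.induction_on with
  | empty => simp
  | insert p S hp ih =>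
    have ih := ih (fun q hq => hf q (Finset.mem_insert_of_mem hq))
      (fun q hq r hr => hg q (Finset.mem_insert_of_mem hq) r (Finset.mem_insert_of_mem hr))
    rw [Finset.prod_insert hp, Finset.lcm_insert, Finset.card_insert_of_notMem hp]
    have hP : 0 < ∏ q ∈ S, Nat.gcd (f p) (f q) :=
      Finset.prod_pos (fun q hq => Nat.gcd_pos_of_pos_left _ (hf p (Finset.mem_insert_self _ _)))
    have h1 : Nat.gcd (f p) (S.lcm f) ≤ Y ^ S.card := by
      have e1 : Nat.gcd (f p) (S.lcm f) ∣ ∏ q ∈ S, Nat.gcd (f p) (f q) := by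
        refine (Nat.gcd_dvd_gcd_of_dvd_right _ ?_).trans (gcd_prod_dvd' S f (f p))
        exact Finset.lcm_dvd (fun q hq => Finset.dvd_prod_of_mem f hq)
      refine (Nat.le_of_dvd hP e1).trans ?_
      refine Finset.prod_le_pow_card _ _ _ (fun q hq => ?_)
      exact hg p (Finset.mem_insert_self _ _) q (Finset.mem_insert_of_mem hq) (by rintro rfl; exact hp hq)
    have e := Nat.gcd_mul_lcm (f p) (S.lcm f)
    calc f p * ∏ q ∈ S, f q ≤ f p * (S.lcm f * Y^(S.card^2)) := by gcongr
      _ = Nat.gcd (f p) (S.lcm f) * Nat.lcm (f p) (S.lcm f) * Y^(S.card^2) := by rw [e]; ring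
      _ ≤ Y^S.card * Nat.lcm (f p) (S.lcm f) * Y^(S.card^2) := by gcongr
      _ = Nat.lcm (f p) (S.lcm f) * Y^(S.card + S.card^2) := by rw [pow_add]; ring
      _ ≤ Nat.lcm (f p) (S.lcm f) * Y^((S.card+1)^2) := by
          gcongr
          nlinarith

lemma prod_order_le (a : ℤ) (n : ℕ) (hn : 1 ≤ n) (S : Finset ℕ) (hS : ∀ p ∈ S, p.Prime ∧ p ∣ n ∧ ¬ (p:ℤ) ∣ a)
    (Y : ℕ) (hY : 1 ≤ Y) (hg : ∀ p ∈ S, ∀ q ∈ S, p ≠ q → Nat.gcd (p-1) (q-1) ≤ Y) :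
    ∏ p ∈ S, orderOf (a : ZMod p) ≤ ellc a n * Y ^ (S.card^2) := by
  have hpos : ∀ p ∈ S, 0 < orderOf (a : ZMod p) := fun p hp => by
    obtain ⟨h1, h2, h3⟩ := hS p hp
    exact Nat.pos_of_dvd_of_pos (order_dvd_pred a p h1 h3) (by have := h1.two_le; omega)
  refine (prod_le_lcm S (fun p => orderOf (a : ZMod p)) Y hY hpos ?_).trans ?_
  · intro p hp q hq hne
    refine le_trans ?_ (hg p hp q hq hne)
    have := (hS p hp).1.two_le
    refine Nat.le_of_dvd (Nat.gcd_pos_of_pos_left _ (by omega)) ?_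
    exact gcd_dvd_gcd (order_dvd_pred a p (hS p hp).1 (hS p hp).2.2) (order_dvd_pred a q (hS q hq).1 (hS q hq).2.2)
  · gcongr
    refine Nat.le_of_dvd (ellc_pos a n hn) ?_
    exact Finset.lcm_dvd (fun p hp => order_dvd_ellc a n hn p (hS p hp).1 (hS p hp).2.1 (hS p hp).2.2)

lemma five_main (a b : ℤ) (n : ℕ) (hn : 1 ≤ n) (S : Finset ℕ) (hS : ∀ p ∈ S, p.Prime ∧ p ∣ n ∧ ¬ (p:ℤ) ∣ a ∧ ¬ (p:ℤ) ∣ b)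
    (Y : ℕ) (hY : 1 ≤ Y) (hg : ∀ p ∈ S, ∀ q ∈ S, p ≠ q → Nat.gcd (p-1) (q-1) ≤ Y) (M : ℝ)
    (hM : (max (max (max (max (ellc a n) (ellc b n)) (ellc (a * b) n))
            (ellc (a ^ 2 * b) n)) (ellc (a * b ^ 2) n) : ℝ) ≤ M) :
    (∏ p ∈ S, (Nat.card (Gam a b p) : ℝ))^4 ≤ 12 ^ S.card * (Y:ℝ)^(5*S.card^2) * M^5 := by
  have hpr : ∀ p ∈ S, Prime (p:ℤ) := fun p hp => Nat.prime_iff_prime_int.1 (hS p hp).1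
  have t1 := prod_order_le a n hn S (fun p hp => ⟨(hS p hp).1, (hS p hp).2.1, (hS p hp).2.2.1⟩) Y hY hg
  have t2 := prod_order_le b n hn S (fun p hp => ⟨(hS p hp).1, (hS p hp).2.1, (hS p hp).2.2.2⟩) Y hY hg
  have t3 := prod_order_le (a*b) n hn S (fun p hp => ⟨(hS p hp).1, (hS p hp).2.1, fun h =>
    ((hpr p hp).dvd_or_dvd h).elim (hS p hp).2.2.1 (hS p hp).2.2.2⟩) Y hY hg
  have t4 := prod_order_le (a^2*b) n hn S (fun p hp => ⟨(hS p hp).1, (hS p hp).2.1, fun h =>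
    ((hpr p hp).dvd_or_dvd h).elim (fun h => (hS p hp).2.2.1 ((hpr p hp).dvd_of_dvd_pow h)) (hS p hp).2.2.2⟩) Y hY hg
  have t5 := prod_order_le (a*b^2) n hn S (fun p hp => ⟨(hS p hp).1, (hS p hp).2.1, fun h =>
    ((hpr p hp).dvd_or_dvd h).elim (hS p hp).2.2.1 (fun h => (hS p hp).2.2.2 ((hpr p hp).dvd_of_dvd_pow h))⟩) Y hY hg
  have key : (∏ p ∈ S, Nat.card (Gam a b p))^4 ≤ 12 ^ S.card * ((ellc a n * Y ^ (S.card^2)) * (ellc b n * Y ^ (S.card^2)) *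
      (ellc (a*b) n * Y ^ (S.card^2)) * (ellc (a^2*b) n * Y ^ (S.card^2)) * (ellc (a*b^2) n * Y ^ (S.card^2))) := by
    rw [← Finset.prod_pow]
    refine (Finset.prod_le_prod' (fun p hp => prime_five a b p (hS p hp).1 (hS p hp).2.2.1 (hS p hp).2.2.2)).trans ?_
    rw [Finset.prod_mul_distrib, Finset.prod_const, Finset.prod_mul_distrib, Finset.prod_mul_distrib, Finset.prod_mul_distrib, Finset.prod_mul_distrib]
    gcongr
  have keyR : (∏ p ∈ S, (Nat.card (Gam a b p) : ℝ))^4 ≤ 12 ^ S.card * (((ellc a n : ℝ) * (Y:ℝ) ^ (S.card^2)) * ((ellc b n : ℝ) * (Y:ℝ) ^ (S.card^2)) *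
      ((ellc (a*b) n : ℝ) * (Y:ℝ) ^ (S.card^2)) * ((ellc (a^2*b) n : ℝ) * (Y:ℝ) ^ (S.card^2)) * ((ellc (a*b^2) n : ℝ) * (Y:ℝ) ^ (S.card^2))) := by
    exact_mod_cast key
  simp only [max_le_iff] at hM
  obtain ⟨⟨⟨⟨m1, m2⟩, m3⟩, m4⟩, m5⟩ := hM
  have hM0 : 0 ≤ M := le_trans (Nat.cast_nonneg _) m1
  refine keyR.trans ?_
  calc _ ≤ 12 ^ S.card * ((M * (Y:ℝ) ^ (S.card^2)) * (M * (Y:ℝ) ^ (S.card^2)) *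
      (M * (Y:ℝ) ^ (S.card^2)) * (M * (Y:ℝ) ^ (S.card^2)) * (M * (Y:ℝ) ^ (S.card^2))) := by gcongr
    _ = _ := by ring

lemma n_final (a b : ℤ) (δ c' c : ℝ) (hδ : 0 < δ) (hδ1 : δ ≤ 1/100) (hc' : 0 < c') (hc'1 : c' < 1/3) (hc : 0 < c) :
    ∀ᶠ x : ℝ in atTop, ∀ n : ℕ, 1 ≤ n → (n:ℝ) ≤ x → ∀ S : Finset ℕ,
      (∀ p ∈ S, p.Prime ∧ p ∣ n ∧ ¬ (p:ℤ) ∣ a ∧ ¬ (p:ℤ) ∣ b ∧ (p:ℝ)^(2/3 - c'*δ/4) < (Nat.card (Gam a b p) : ℝ) ∧ x^c < (p:ℝ)) →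
      x^(1 - c'*δ/4) ≤ ∏ p ∈ S, (p:ℝ) →
      ∀ p0 ∈ S, Good δ p0 → x^c' < (p0:ℝ) → ∀ Y : ℕ, 1 ≤ Y → (Y:ℝ) ≤ (Real.log x)^4 →
      (∀ p ∈ S, ∀ q ∈ S, p ≠ q → Nat.gcd (p-1) (q-1) ≤ Y) → ∀ M : ℝ,
      (max (max (max (max (ellc a n) (ellc b n)) (ellc (a * b) n))
            (ellc (a ^ 2 * b) n)) (ellc (a * b ^ 2) n) : ℝ) ≤ M → x^((8:ℝ)/15 + c'*δ/5) ≤ M := by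
  set k := ⌊1/c⌋₊ with hk
  set θ := c'*δ/4 with hθ
  have hθ0 : 0 < θ := by positivity
  have hcd : c' * δ ≤ 1/300 := by nlinarith
  have hθδ : θ ≤ δ := by rw [hθ]; nlinarith
  filter_upwards [ev_pow (20*k^2) (16*12^k) (c'*δ) (by positivity), eventually_gt_atTop 1, ev_log_ge 1] with x hx1 hx hl n hn hnx S hS hprod p0 hp0 hG hp0x Y hY hYx hg M hM
  have hx0 : 0 < x := by linarith
  have hsk : S.card ≤ k := by
    rw [hk]
    apply Nat.le_floor
    exact card_big x hx S n hn hnx (fun q hq => ⟨(hS q hq).1, (hS q hq).2.1⟩) c hc (fun q hq => (hS q hq).2.2.2.2.2)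
  have hmain := five_main a b n hn S (fun p hp => ⟨(hS p hp).1, (hS p hp).2.1, (hS p hp).2.2.1, (hS p hp).2.2.2.1⟩) Y hY hg M hM
  have hM0 : 0 ≤ M := by
    simp only [max_le_iff] at hM
    exact le_trans (Nat.cast_nonneg _) hM.1.1.1.1
  have hpp : ∀ p ∈ S, (0:ℝ) < p := fun p hp => by exact_mod_cast (hS p hp).1.pos
  have hp00 := hpp p0 hp0
  have hP1 : (∏ p ∈ S, (p:ℝ))^(2/3-θ) * ((p0:ℝ)^(δ+θ)/2) ≤ ∏ p ∈ S, (Nat.card (Gam a b p) : ℝ) := by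
    rw [← Real.finsetProd_rpow _ _ (fun p hp => (hpp p hp).le), ← Finset.mul_prod_erase S _ hp0, ← Finset.mul_prod_erase S (fun p => (Nat.card (Gam a b p) : ℝ)) hp0]
    have h1 := good_large a b p0 (hS p0 hp0).1 δ θ hθδ hG (hS p0 hp0).2.2.2.2.1
    have h2 : (p0:ℝ)^(2/3+δ) = (p0:ℝ)^(2/3-θ) * (p0:ℝ)^(δ+θ) := by
      rw [← Real.rpow_add hp00]; congr 1; ring
    have h3 : ∏ p ∈ S.erase p0, (p:ℝ)^(2/3-θ) ≤ ∏ p ∈ S.erase p0, (Nat.card (Gam a b p) : ℝ) :=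
      Finset.prod_le_prod (fun p hp => by positivity) (fun p hp => (hS p (Finset.mem_of_mem_erase hp)).2.2.2.2.1.le)
    calc _ = ((p0:ℝ)^(2/3+δ)/2) * ∏ p ∈ S.erase p0, (p:ℝ)^(2/3-θ) := by rw [h2]; ring
      _ ≤ _ := by gcongr
  have hP2 : x^(2/3 + 2*θ) / 2 ≤ ∏ p ∈ S, (Nat.card (Gam a b p) : ℝ) := by
    refine le_trans ?_ hP1
    have h1 : x^((1-θ)*(2/3-θ)) ≤ (∏ p ∈ S, (p:ℝ))^(2/3-θ) := by
      rw [Real.rpow_mul hx0.le]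
      exact Real.rpow_le_rpow (by positivity) hprod (by rw [hθ]; linarith)
    have h2 : x^(c'*δ) ≤ (p0:ℝ)^(δ+θ) := by
      calc x^(c'*δ) ≤ x^(c'*(δ+θ)) := Real.rpow_le_rpow_of_exponent_le hx.le (by nlinarith)
        _ = (x^c')^(δ+θ) := Real.rpow_mul hx0.le _ _
        _ ≤ _ := Real.rpow_le_rpow (by positivity) hp0x.le (by linarith)
    calc x^(2/3 + 2*θ) / 2 ≤ x^((1-θ)*(2/3-θ) + c'*δ) / 2 := by
          have : c'*δ = 4*θ := by rw [hθ]; ring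
          have h3 : 2/3 + 2*θ ≤ (1-θ)*(2/3-θ) + c'*δ := by rw [this]; nlinarith
          have h4 := Real.rpow_le_rpow_of_exponent_le hx.le h3
          linarith
      _ = x^((1-θ)*(2/3-θ)) * (x^(c'*δ)/2) := by rw [Real.rpow_add hx0]; ring
      _ ≤ _ := by gcongr
  have hY1 : (1:ℝ) ≤ Y := by exact_mod_cast hY
  have hcst : (12:ℝ)^S.card * (Y:ℝ)^(5*S.card^2) ≤ x^(c'*δ)/16 := by
    calc (12:ℝ)^S.card * (Y:ℝ)^(5*S.card^2) ≤ 12^k * (Y:ℝ)^(5*k^2) := by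
          gcongr
          norm_num
      _ ≤ 12^k * ((Real.log x)^4)^(5*k^2) := by gcongr
      _ = (16*12^k * (Real.log x)^(20*k^2))/16 := by rw [← pow_mul, show 4*(5*k^2) = 20*k^2 by ring]; ring
      _ ≤ _ := by gcongr
  have h4 : (x^(2/3+2*θ)/2)^4 ≤ x^(c'*δ)/16 * M^5 :=
    (by gcongr : (x^(2/3+2*θ)/2)^4 ≤ (∏ p ∈ S, (Nat.card (Gam a b p) : ℝ))^4).trans
      (hmain.trans (by gcongr))
  have h5 : x^(8/3+8*θ) ≤ x^(c'*δ) * M^5 := by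
    have : (x^(2/3+2*θ))^4 = x^(8/3+8*θ) := by
      rw [← Real.rpow_natCast, ← Real.rpow_mul hx0.le]; congr 1; push_cast; ring
    rw [div_pow, this] at h4
    linarith
  have h6 : x^(8/3+c'*δ) ≤ M^5 := by
    have e : x^(8/3+8*θ) = x^(c'*δ) * x^(8/3+c'*δ) := by
      rw [← Real.rpow_add hx0]; congr 1; rw [hθ]; ring
    rw [e] at h5
    exact le_of_mul_le_mul_left h5 (by positivity)
  have h7 : x^((8:ℝ)/15+c'*δ/5) = (x^(8/3+c'*δ))^(1/5:ℝ) := by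
    rw [← Real.rpow_mul hx0.le]; congr 1; ring
  rw [h7]
  calc (x^(8/3+c'*δ))^(1/5:ℝ) ≤ (M^5)^(1/5:ℝ) := Real.rpow_le_rpow (by positivity) h6 (by norm_num)
    _ = M := by rw [← Real.rpow_natCast, ← Real.rpow_mul hM0]; norm_num

lemma card_mult (N q : ℕ) : (((Finset.Ioc 0 N).filter (fun n => q ∣ n)).card : ℝ) ≤ (N:ℝ)/q := by
  rw [Nat.Ioc_filter_dvd_card_eq_div]
  exact Nat.cast_div_le

open Classical in
lemma union_count (N : ℕ) (T : Finset ℕ) :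
    (((Finset.Ioc 0 N).filter (fun n => ∃ p ∈ T, p ∣ n)).card : ℝ) ≤ N * ∑ p ∈ T, 1/(p:ℝ) := by
  have h : (Finset.Ioc 0 N).filter (fun n => ∃ p ∈ T, p ∣ n) ⊆ T.biUnion (fun p => (Finset.Ioc 0 N).filter (fun n => p ∣ n)) := by
    intro n hn
    rw [Finset.mem_filter] at hn
    obtain ⟨h1, p, hp, hd⟩ := hn
    exact Finset.mem_biUnion.2 ⟨p, hp, Finset.mem_filter.2 ⟨h1, hd⟩⟩
  have h2 := (Finset.card_le_card h).trans Finset.card_biUnion_le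
  calc (((Finset.Ioc 0 N).filter (fun n => ∃ p ∈ T, p ∣ n)).card : ℝ) ≤ ((∑ p ∈ T, ((Finset.Ioc 0 N).filter (fun n => p ∣ n)).card : ℕ):ℝ) := by exact_mod_cast h2
    _ = ∑ p ∈ T, (((Finset.Ioc 0 N).filter (fun n => p ∣ n)).card : ℝ) := by push_cast; rfl
    _ ≤ ∑ p ∈ T, (N:ℝ)/p := Finset.sum_le_sum (fun p _ => card_mult N p)
    _ = _ := by rw [Finset.mul_sum]; exact Finset.sum_congr rfl (fun p _ => by ring)

open Classical in
lemma pairs_count (N Y : ℕ) (hY : 1 ≤ Y) (hN : 1 ≤ N) :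
    (((Finset.Ioc 0 N).filter (fun n => ∃ p q : ℕ, p.Prime ∧ q.Prime ∧ p ≠ q ∧ p ∣ n ∧ q ∣ n ∧ Y < Nat.gcd (p-1) (q-1))).card : ℝ)
      ≤ N * (1 + Real.log N)^2 / Y := by
  set W : ℕ → Finset ℕ := fun g => (Finset.Icc 2 N).filter (fun p => g ∣ p - 1) with hW
  have hsub : (Finset.Ioc 0 N).filter (fun n => ∃ p q : ℕ, p.Prime ∧ q.Prime ∧ p ≠ q ∧ p ∣ n ∧ q ∣ n ∧ Y < Nat.gcd (p-1) (q-1)) ⊆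
      (Finset.Ioc Y N).biUnion (fun g => (W g ×ˢ W g).biUnion (fun r => (Finset.Ioc 0 N).filter (fun n => r.1 * r.2 ∣ n))) := by
    intro n hn
    rw [Finset.mem_filter] at hn
    obtain ⟨h1, p, q, hp, hq, hne, hpn, hqn, hg⟩ := hn
    have h1' := Finset.mem_Ioc.1 h1
    have hpN : p ≤ N := (Nat.le_of_dvd h1'.1 hpn).trans h1'.2
    have hqN : q ≤ N := (Nat.le_of_dvd h1'.1 hqn).trans h1'.2
    have hp2 := hp.two_le
    have hgle : Nat.gcd (p-1) (q-1) ≤ p - 1 := Nat.gcd_le_left _ (by omega)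
    refine Finset.mem_biUnion.2 ⟨Nat.gcd (p-1) (q-1), Finset.mem_Ioc.2 ⟨hg, by omega⟩, Finset.mem_biUnion.2 ⟨(p,q), ?_, ?_⟩⟩
    · rw [Finset.mem_product]
      exact ⟨Finset.mem_filter.2 ⟨Finset.mem_Icc.2 ⟨hp2, hpN⟩, Nat.gcd_dvd_left _ _⟩,
        Finset.mem_filter.2 ⟨Finset.mem_Icc.2 ⟨hq.two_le, hqN⟩, Nat.gcd_dvd_right _ _⟩⟩
    · rw [Finset.mem_filter]
      exact ⟨h1, ((Nat.coprime_primes hp hq).2 hne).mul_dvd_of_dvd_of_dvd hpn hqn⟩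
  have hWs : ∀ g ∈ Finset.Ioc Y N, ∑ p ∈ W g, 1/(p:ℝ) ≤ (1 + Real.log N) / g := by
    intro g hg
    have hg1 : 0 < g := by have := (Finset.mem_Ioc.1 hg).1; omega
    have hgR : (0:ℝ) < g := by exact_mod_cast hg1
    have e1 : ∑ p ∈ W g, 1/(p:ℝ) ≤ ∑ k ∈ Finset.Icc 1 N, 1/((g:ℝ) * k) := by
      have hmemW : ∀ p ∈ W g, ∃ k : ℕ, 1 ≤ k ∧ p = g * k + 1 ∧ k ≤ N := by
        intro p hp
        obtain ⟨hp1, k, hk⟩ := Finset.mem_filter.1 hp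
        have hp1 := Finset.mem_Icc.1 hp1
        have hk0 : 1 ≤ k := by
          rcases Nat.eq_zero_or_pos k with h | h
          · subst h; omega
          · exact h
        exact ⟨k, hk0, by omega, by have := Nat.le_mul_of_pos_left k hg1; omega⟩
      refine sum_le_sum_inj (fun p => (p-1)/g) ?_ ?_ ?_ ?_
      · intro p hp q hq h
        obtain ⟨k, -, rfl, -⟩ := hmemW p hp
        obtain ⟨l, -, rfl, -⟩ := hmemW q hq
        simp only [Nat.add_sub_cancel, Nat.mul_div_cancel_left _ hg1] at h
        rw [h]
      · intro p hp
        obtain ⟨k, hk, rfl, hk2⟩ := hmemW p hp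
        simp only [Nat.add_sub_cancel, Nat.mul_div_cancel_left _ hg1]
        exact Finset.mem_Icc.2 ⟨hk, hk2⟩
      · intro p hp
        obtain ⟨k, hk, rfl, hk2⟩ := hmemW p hp
        simp only [Nat.add_sub_cancel, Nat.mul_div_cancel_left _ hg1]
        have hkR : (0:ℝ) < k := by exact_mod_cast hk
        push_cast
        apply one_div_le_one_div_of_le (by positivity)
        linarith
      · intro k _
        positivity
    refine e1.trans ?_
    have e2 : ∑ k ∈ Finset.Icc 1 N, 1/((g:ℝ) * k) = (harmonic N : ℝ) / g := by
      rw [harmonic_eq_sum_Icc]; push_cast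
      rw [Finset.sum_div]
      refine Finset.sum_congr rfl (fun k _ => ?_)
      rw [one_div, mul_inv]; ring
    rw [e2]
    gcongr
    exact harmonic_le_one_add_log N
  have hlog0 : 0 ≤ Real.log N := Real.log_natCast_nonneg N
  calc _ ≤ ((∑ g ∈ Finset.Ioc Y N, ∑ r ∈ W g ×ˢ W g, ((Finset.Ioc 0 N).filter (fun n => r.1 * r.2 ∣ n)).card : ℕ) : ℝ) := by
        exact_mod_cast (Finset.card_le_card hsub).trans (Finset.card_biUnion_le.trans (Finset.sum_le_sum (fun g _ => Finset.card_biUnion_le)))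
    _ = ∑ g ∈ Finset.Ioc Y N, ∑ r ∈ W g ×ˢ W g, (((Finset.Ioc 0 N).filter (fun n => r.1 * r.2 ∣ n)).card : ℝ) := by push_cast; rfl
    _ ≤ ∑ g ∈ Finset.Ioc Y N, ∑ r ∈ W g ×ˢ W g, (N:ℝ) * ((1/(r.1:ℝ)) * (1/(r.2:ℝ))) := by
        refine Finset.sum_le_sum (fun g _ => Finset.sum_le_sum (fun r _ => ?_))
        refine (card_mult N _).trans (le_of_eq ?_)
        push_cast; rw [div_mul_div_comm, one_mul]; ring
    _ = ∑ g ∈ Finset.Ioc Y N, (N:ℝ) * (∑ p ∈ W g, 1/(p:ℝ))^2 := by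
        refine Finset.sum_congr rfl (fun g _ => ?_)
        rw [← Finset.mul_sum, sq, Finset.sum_mul_sum, Finset.sum_product]
    _ ≤ ∑ g ∈ Finset.Ioc Y N, (N:ℝ) * ((1 + Real.log N) / g)^2 := by
        refine Finset.sum_le_sum (fun g hg => ?_)
        have h0 : 0 ≤ ∑ p ∈ W g, 1/(p:ℝ) := Finset.sum_nonneg (fun p _ => by positivity)
        have := hWs g hg
        gcongr
    _ = N * (1 + Real.log N)^2 * ∑ g ∈ Finset.Ioc Y N, ((g:ℝ)^2)⁻¹ := by
        rw [Finset.mul_sum]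
        refine Finset.sum_congr rfl (fun g _ => ?_)
        rw [div_pow]; ring
    _ ≤ N * (1 + Real.log N)^2 * (Y:ℝ)⁻¹ := by
        gcongr
        rcases le_total Y N with h | h
        · refine (sum_Ioc_inv_sq_le_sub (by omega) h).trans ?_
          have : (0:ℝ) ≤ (N:ℝ)⁻¹ := by positivity
          linarith
        · rw [Finset.Ioc_eq_empty (by omega)]; simp
    _ = _ := by rw [div_eq_mul_inv]

lemma no_good_count (N : ℕ) (Q : Finset ℕ) (hQ : ∀ q ∈ Q, q.Prime) :
    (((Finset.Ioc 0 N).filter (fun n => ∀ q ∈ Q, ¬ q ∣ n)).card : ℝ) * (∑ q ∈ Q, 1/(q:ℝ))^2 ≤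
      N * (∑ q ∈ Q, 1/(q:ℝ)) + ((Q.card + ∑ q ∈ Q, 1/(q:ℝ))^2 + Q.card) := by
  have hE : ∀ q ∈ Q, (N:ℝ)/q - 1 ≤ (((Finset.Ioc 0 N).filter (fun n => q ∣ n)).card : ℝ) := by
    intro q hq
    rw [Nat.Ioc_filter_dvd_card_eq_div]
    have hq0 : 0 < q := (hQ q hq).pos
    have hqR : (0:ℝ) < q := by exact_mod_cast hq0
    have := Nat.lt_div_mul_add (a := N) hq0
    have h2 : (N:ℝ) < ((N/q : ℕ):ℝ) * q + q := by exact_mod_cast this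
    rw [sub_le_iff_le_add, div_le_iff₀ hqR]
    linarith
  have hv := variance_abs (Finset.Ioc 0 N) (fun _ => 1) Q (fun q n => q ∣ n) (fun q => 1/(q:ℝ)) N 0 1 (∑ q ∈ Q, 1/(q:ℝ))
    (fun q _ => by positivity) rfl (by norm_num) (by norm_num) (by positivity)
    (by simp) (by
      intro q hq
      have := hE q hq
      rw [Finset.sum_const, nsmul_eq_mul, mul_one, sub_zero, mul_one_div]
      exact this) (by
      intro q hq
      have := card_mult N q
      rw [Finset.sum_const, nsmul_eq_mul, mul_one, add_zero, mul_one_div]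
      linarith) (by
      intro q hq q' hq' hne
      rw [Finset.sum_const, nsmul_eq_mul, mul_one, add_zero]
      have hs : (Finset.Ioc 0 N).filter (fun n => q ∣ n ∧ q' ∣ n) ⊆ (Finset.Ioc 0 N).filter (fun n => q * q' ∣ n) := by
        intro n hn
        rw [Finset.mem_filter] at hn ⊢
        exact ⟨hn.1, ((Nat.coprime_primes (hQ q hq) (hQ q' hq')).2 hne).mul_dvd_of_dvd_of_dvd hn.2.1 hn.2.2⟩
      have h1 : (((Finset.Ioc 0 N).filter (fun n => q ∣ n ∧ q' ∣ n)).card : ℝ) ≤ (((Finset.Ioc 0 N).filter (fun n => q * q' ∣ n)).card : ℝ) := by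
        exact_mod_cast Finset.card_le_card hs
      have h2 := card_mult N (q*q')
      push_cast at h2
      have h3 : (N:ℝ)/(q*q') = N * (1/(q:ℝ) * (1/(q':ℝ))) := by rw [div_mul_div_comm, one_mul]; ring
      linarith)
  set L := ∑ q ∈ Q, 1/(q:ℝ) with hL
  have h1 : (((Finset.Ioc 0 N).filter (fun n => ∀ q ∈ Q, ¬ q ∣ n)).card : ℝ) * L^2 ≤
      ∑ n ∈ Finset.Ioc 0 N, (1:ℝ) * (((Q.filter (fun q => q ∣ n)).card : ℝ) - L)^2 := by
    calc _ = ∑ n ∈ (Finset.Ioc 0 N).filter (fun n => ∀ q ∈ Q, ¬ q ∣ n), L^2 := by rw [Finset.sum_const, nsmul_eq_mul]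
      _ = ∑ n ∈ (Finset.Ioc 0 N).filter (fun n => ∀ q ∈ Q, ¬ q ∣ n), (1:ℝ) * (((Q.filter (fun q => q ∣ n)).card : ℝ) - L)^2 := by
          refine Finset.sum_congr rfl (fun n hn => ?_)
          have : Q.filter (fun q => q ∣ n) = ∅ := Finset.filter_eq_empty_iff.2 (fun q hq => (Finset.mem_filter.1 hn).2 q hq)
          rw [this]; simp
      _ ≤ _ := Finset.sum_le_sum_of_subset_of_nonneg (Finset.filter_subset _ _) (fun n _ _ => by positivity)
  refine h1.trans (hv.trans (le_of_eq ?_))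
  ring

open Classical in
lemma smooth_count : ∃ C : ℝ, 1 ≤ C ∧ ∀ (N : ℕ) (z W : ℝ), 1 ≤ z → 1 < W →
    (((Finset.Ioc 0 N).filter (fun n => W < ((∏ q ∈ n.primeFactors.filter (fun q : ℕ => ¬ z < (q:ℝ)), q : ℕ):ℝ))).card : ℝ) * Real.log W
      ≤ N * (Real.log z + C) := by
  obtain ⟨C, hC, hm⟩ := mertens
  refine ⟨C, hC, ?_⟩
  intro N z W hz hW
  set B := (Finset.Ioc 0 N).filter (fun n => W < ((∏ q ∈ n.primeFactors.filter (fun q : ℕ => ¬ z < (q:ℝ)), q : ℕ):ℝ)) with hB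
  have h1 : (B.card : ℝ) * Real.log W ≤ ∑ n ∈ B, ∑ q ∈ PI 1 z, if q ∣ n then Real.log q else 0 := by
    rw [← nsmul_eq_mul, ← Finset.sum_const]
    refine Finset.sum_le_sum (fun n hn => ?_)
    have hn2 := (Finset.mem_filter.1 hn).2
    have hn1 := Finset.mem_Ioc.1 (Finset.mem_filter.1 hn).1
    have e := (Real.log_lt_log (by linarith) hn2).le
    refine e.trans ?_
    push_cast
    rw [Real.log_prod (fun q hq => by
      have := (Nat.prime_of_mem_primeFactors (Finset.mem_filter.1 hq).1).ne_zero
      exact_mod_cast this)]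
    rw [← Finset.sum_filter]
    refine Finset.sum_le_sum_of_subset_of_nonneg ?_ (fun q _ _ => Real.log_natCast_nonneg q)
    intro q hq
    rw [Finset.mem_filter] at hq ⊢
    have hqp := Nat.prime_of_mem_primeFactors hq.1
    refine ⟨mem_PI.2 ⟨hqp, by exact_mod_cast hqp.one_lt, not_lt.1 hq.2⟩, Nat.dvd_of_mem_primeFactors hq.1⟩
  have h2 : ∑ n ∈ B, ∑ q ∈ PI 1 z, (if q ∣ n then Real.log q else 0) ≤ ∑ n ∈ Finset.Ioc 0 N, ∑ q ∈ PI 1 z, (if q ∣ n then Real.log q else 0) :=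
    Finset.sum_le_sum_of_subset_of_nonneg (Finset.filter_subset _ _) (fun n _ _ => Finset.sum_nonneg (fun q _ => by
      split_ifs
      · exact Real.log_natCast_nonneg q
      · exact le_rfl))
  have h3 : ∑ n ∈ Finset.Ioc 0 N, ∑ q ∈ PI 1 z, (if q ∣ n then Real.log q else 0) ≤ N * ∑ q ∈ PI 1 z, Real.log q / q := by
    rw [Finset.sum_comm, Finset.mul_sum]
    refine Finset.sum_le_sum (fun q _ => ?_)
    rw [← Finset.sum_filter, Finset.sum_const, nsmul_eq_mul]
    have := card_mult N q
    have hl := Real.log_natCast_nonneg q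
    calc _ ≤ (N:ℝ)/q * Real.log q := by gcongr
      _ = _ := by ring
  have h4 : ∑ q ∈ PI 1 z, Real.log q / q ≤ Real.log z + C := by
    have := (abs_le.1 (hm 1 z le_rfl hz)).2
    rw [Real.log_one] at this
    linarith
  refine h1.trans (h2.trans (h3.trans ?_))
  gcongr

set_option maxHeartbeats 4000000 in
open Classical in
lemma bad_bound (ε : ℝ → ℝ) (hεlim : Tendsto ε atTop (nhds 0))
    (a b : ℤ) (ha : a ≠ 0) (hb : b ≠ 0)
    (hind : ∀ m n : ℤ, (a : ℚ) ^ m * (b : ℚ) ^ n = 1 → m = 0 ∧ n = 0) (τ : ℝ) (hτ : 0 < τ) :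
    ∀ᶠ x : ℝ in atTop, ∃ B : Finset ℕ, (B.card : ℝ) ≤ 6 * τ * x ∧ ∀ n : ℕ, 1 ≤ n → (n:ℝ) ≤ x →
      (max (max (max (max (ellc a n) (ellc b n)) (ellc (a * b) n))
            (ellc (a ^ 2 * b) n)) (ellc (a * b ^ 2) n) : ℝ) ≤ (n : ℝ) ^ ((8 : ℝ) / 15 + ε n) → n ∈ B := by
  obtain ⟨δ, hδ, hδ1, hgood⟩ := good_recip
  obtain ⟨c', hc', hc'1, hgood⟩ := hgood (2/τ + 1)
  obtain ⟨C, hC, hsm⟩ := smooth_count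
  set θ := c'*δ/4 with hθ
  have hθ0 : 0 < θ := by positivity
  have hθ1 : θ ≤ 1/2 := by rw [hθ]; nlinarith
  set c := min c' (τ*θ/4) with hc
  have hc0 : 0 < c := lt_min hc' (by positivity)
  have hcc' : c ≤ c' := min_le_left _ _
  have hcτ : c ≤ τ*θ/4 := min_le_right _ _
  set T := 2/τ with hT
  have hT0 : 0 < T := by positivity
  have hεev : ∀ᶠ y : ℝ in atTop, ε y < c'*δ/5 := hεlim.eventually (gt_mem_nhds (by positivity))
  obtain ⟨N0, hN0⟩ := eventually_atTop.1 hεev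
  filter_upwards [hgood, n_final a b δ c' c hδ hδ1 hc' hc'1 hc0, exc_sum a b ha hb hind θ c τ hθ0 hθ1 hc0 hτ,
    eventually_gt_atTop 1, ev_log_ge 2, ev_log_ge (C/(τ*θ/4)), ev_log_ge (8/τ), ev_pow 0 (10/τ) (1/3) (by norm_num),
    ev_pow 0 (T^2/τ) (θ/2) (by positivity), ev_pow 0 (|(a:ℝ)| + |(b:ℝ)|) c hc0,
    eventually_ge_atTop (max N0 2 / τ)] with x hgood hfin hexc hx hl2 hlC hl8 hx3 hxT hxab hxN
  simp only [pow_zero, mul_one] at hx3 hxT hxab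
  have hx0 : 0 < x := by linarith
  set N := ⌊x⌋₊ with hN
  have hNx : (N:ℝ) ≤ x := Nat.floor_le hx0.le
  have hN1 : 1 ≤ N := Nat.le_floor (by simpa using hx.le)
  have hNR : (0:ℝ) < N := by exact_mod_cast hN1
  set l := Real.log x with hl
  have hl0 : 0 < l := by linarith
  set U := Finset.Ioc 0 N with hU
  set Y := ⌊l^4⌋₊ with hY
  have hl4 : 1 ≤ l^4 := one_le_pow₀ (by linarith)
  have hY1 : 1 ≤ Y := Nat.le_floor (by simpa using hl4)
  have hYle : (Y:ℝ) ≤ l^4 := Nat.floor_le (by positivity)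
  have hYge : l^4/2 ≤ Y := by
    have h1 : l^4 < Y + 1 := Nat.lt_floor_add_one _
    have h2 : (1:ℝ) ≤ Y := by exact_mod_cast hY1
    linarith
  set Q := (PI (x^c') (x^(1/3:ℝ))).filter (fun p => Good δ p) with hQ
  set E := (PI (x^c) x).filter (fun p => (Nat.card (Gam a b p) : ℝ) ≤ (p:ℝ)^(2/3-θ)) with hE
  set W := x^(θ/2) with hW
  have hW1 : 1 < W := Real.one_lt_rpow hx (by positivity)
  set z := x^c with hz
  have hz1 : 1 ≤ z := Real.one_le_rpow hx.le hc0.le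
  have hnab : ∀ p : ℕ, z < (p:ℝ) → ¬ (p:ℤ) ∣ a ∧ ¬ (p:ℤ) ∣ b := by
    intro p hp
    have key : ∀ e : ℤ, e ≠ 0 → |(e:ℝ)| ≤ z → ¬ (p:ℤ) ∣ e := by
      intro e he hez hd
      have h1 := Int.le_of_dvd (abs_pos.2 he) ((dvd_abs _ _).2 hd)
      have h2 : (p:ℝ) ≤ |(e:ℝ)| := by exact_mod_cast h1
      linarith
    exact ⟨key a ha (by have := abs_nonneg (b:ℝ); linarith), key b hb (by have := abs_nonneg (a:ℝ); linarith)⟩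
  set B0 := Finset.Ioc 0 ⌊τ*x⌋₊ with hB0
  set B1 := U.filter (fun n => ∃ t : ℕ, T < t ∧ t ^ 2 ∣ n) with hB1
  set B2 := U.filter (fun n => W < ((∏ q ∈ n.primeFactors.filter (fun q : ℕ => ¬ z < (q:ℝ)), q : ℕ):ℝ)) with hB2
  set B3 := U.filter (fun n => ∃ p ∈ E, p ∣ n) with hB3
  set B4 := U.filter (fun n => ∃ p q : ℕ, p.Prime ∧ q.Prime ∧ p ≠ q ∧ p ∣ n ∧ q ∣ n ∧ Y < Nat.gcd (p-1) (q-1)) with hB4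
  set B5 := U.filter (fun n => ∀ q ∈ Q, ¬ q ∣ n) with hB5
  have c0 : (B0.card : ℝ) ≤ τ * x := by
    rw [hB0, Nat.card_Ioc, Nat.sub_zero]
    exact Nat.floor_le (by positivity)
  have c1 : (B1.card : ℝ) ≤ τ * x := by
    have h := sq_count N T hT0
    have e : 2 * (N:ℝ) / T = τ * N := by rw [hT]; field_simp
    rw [e] at h
    exact le_trans (by convert h) (by gcongr)
  have c2 : (B2.card : ℝ) ≤ τ * x := by
    have h := hsm N z W hz1 hW1
    have hlW : Real.log W = θ/2 * l := by rw [hW, Real.log_rpow hx0]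
    have hlz : Real.log z = c * l := by rw [hz, Real.log_rpow hx0]
    rw [hlW, hlz] at h
    have hCl : C ≤ τ*θ/4 * l := by
      rw [div_le_iff₀ (by positivity)] at hlC
      linarith
    have h2 : (N:ℝ) * (c*l + C) ≤ (τ * x) * (θ/2*l) := by
      calc (N:ℝ) * (c*l + C) ≤ x * (τ*θ/4 * l + τ*θ/4 * l) := by gcongr
        _ = _ := by ring
    have h3 : (B2.card : ℝ) * (θ/2*l) ≤ (τ * x) * (θ/2*l) := le_trans (by convert h) h2
    exact le_of_mul_le_mul_right h3 (by positivity)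
  have c3 : (B3.card : ℝ) ≤ τ * x := by
    have h := union_count N E
    have h2 := hexc E (by
      intro p hp
      obtain ⟨h1, h2⟩ := Finset.mem_filter.1 hp
      obtain ⟨h3, h4, h5⟩ := mem_PI.1 h1
      exact ⟨h3, (hnab p h4).1, (hnab p h4).2, h2, h4, h5⟩)
    calc (B3.card : ℝ) ≤ N * ∑ p ∈ E, 1/(p:ℝ) := by convert h
      _ ≤ x * τ := by
        have : (0:ℝ) ≤ ∑ p ∈ E, 1/(p:ℝ) := Finset.sum_nonneg (fun p _ => by positivity)
        gcongr
      _ = _ := by ring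
  have c4 : (B4.card : ℝ) ≤ τ * x := by
    have h := pairs_count N Y hY1 hN1
    have hlN : Real.log N ≤ l := Real.log_le_log hNR hNx
    have hlN0 : 0 ≤ Real.log N := Real.log_natCast_nonneg N
    calc (B4.card : ℝ) ≤ N * (1 + Real.log N)^2 / Y := by convert h
      _ ≤ x * (l + l)^2 / (l^4/2) := by
          gcongr
          linarith
      _ = x * (8 / l^2) := by field_simp; ring
      _ ≤ x * τ := by
          gcongr
          rw [div_le_iff₀ (by positivity)]
          rw [div_le_iff₀ hτ] at hl8
          nlinarith
      _ = _ := by ring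
  have c5 : (B5.card : ℝ) ≤ τ * x := by
    have h := no_good_count N Q (fun q hq => (mem_PI.1 (Finset.mem_filter.1 hq).1).1)
    rw [← Finset.sum_filter] at hgood
    set L := ∑ q ∈ Q, 1/(q:ℝ) with hL
    have hLV : 2/τ + 1 ≤ L := by convert hgood
    have hτ2 : 0 < 2/τ := by positivity
    have hL1 : 1 ≤ L := by linarith
    have hQc : (Q.card : ℝ) ≤ x^(1/3:ℝ) :=
      le_trans (by exact_mod_cast Finset.card_filter_le _ _) (card_PI_le (x^c') (x^(1/3:ℝ)) (by positivity))
    have hLQ : L ≤ Q.card := by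
      calc L ≤ ∑ q ∈ Q, (1:ℝ) := Finset.sum_le_sum (fun q hq => by
            have hq1 : (1:ℝ) ≤ q := by exact_mod_cast (mem_PI.1 (Finset.mem_filter.1 hq).1).1.one_le
            rw [div_le_one (by linarith)]; exact hq1)
        _ = _ := by simp
    set w := x^(1/3:ℝ) with hw
    have hw1 : 1 ≤ w := Real.one_le_rpow hx.le (by norm_num)
    have hw3 : w^3 = x := by rw [hw, ← Real.rpow_natCast, ← Real.rpow_mul hx0.le]; norm_num
    have h2 : (B5.card : ℝ) * L^2 ≤ x * L + 5*w^2 := by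
      have h3 : ((Q.card:ℝ) + L)^2 + Q.card ≤ (w+w)^2 + w^2 := by
        have : w ≤ w^2 := by nlinarith
        gcongr
        · linarith
        · linarith
      have h4 : (N:ℝ) * L ≤ x * L := by gcongr
      have h5 : (B5.card : ℝ) * L^2 ≤ N * L + (((Q.card:ℝ) + L)^2 + Q.card) := by convert h
      nlinarith
    have h6 : 5*w^2 ≤ τ/2*x := by
      rw [← hw3]
      have : 10 ≤ τ * w := by rw [div_le_iff₀ hτ] at hx3; linarith
      nlinarith [sq_nonneg w]
    have h7 : x * L ≤ τ/2 * x * L^2 := by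
      have : 1 ≤ τ/2 * L := by
        have : τ/2 * (2/τ) = 1 := by field_simp
        nlinarith
      have : x * L * 1 ≤ x * L * (τ/2 * L) := by gcongr
      nlinarith
    have h8 : τ/2*x ≤ τ/2*x*L^2 := by
      have : 1 ≤ L^2 := one_le_pow₀ hL1
      exact le_mul_of_one_le_right (by positivity) this
    have h9 : (B5.card : ℝ) * L^2 ≤ (τ*x) * L^2 := by linarith
    exact le_of_mul_le_mul_right h9 (by positivity)
  refine ⟨B0 ∪ B1 ∪ B2 ∪ B3 ∪ B4 ∪ B5, ?_, ?_⟩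
  · have hcard : (B0 ∪ B1 ∪ B2 ∪ B3 ∪ B4 ∪ B5).card ≤ B0.card + B1.card + B2.card + B3.card + B4.card + B5.card := by
      refine (Finset.card_union_le _ _).trans (Nat.add_le_add_right ?_ _)
      refine (Finset.card_union_le _ _).trans (Nat.add_le_add_right ?_ _)
      refine (Finset.card_union_le _ _).trans (Nat.add_le_add_right ?_ _)
      refine (Finset.card_union_le _ _).trans (Nat.add_le_add_right ?_ _)
      exact Finset.card_union_le _ _
    have hcR : ((B0 ∪ B1 ∪ B2 ∪ B3 ∪ B4 ∪ B5).card : ℝ) ≤ B0.card + B1.card + B2.card + B3.card + B4.card + B5.card := by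
      exact_mod_cast hcard
    linarith
  · intro n hn hnx hmax
    by_contra hnB
    simp only [Finset.mem_union, not_or] at hnB
    obtain ⟨⟨⟨⟨⟨n0, n1⟩, n2⟩, n3⟩, n4⟩, n5⟩ := hnB
    have hnU : n ∈ U := Finset.mem_Ioc.2 ⟨hn, Nat.le_floor hnx⟩
    have hnbig : τ * x < n := by
      by_contra hcon
      exact n0 (Finset.mem_Ioc.2 ⟨hn, Nat.le_floor (not_lt.1 hcon)⟩)
    rw [hB1, Finset.mem_filter] at n1
    rw [hB2, Finset.mem_filter] at n2
    rw [hB3, Finset.mem_filter] at n3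
    rw [hB4, Finset.mem_filter] at n4
    rw [hB5, Finset.mem_filter] at n5
    have n1 := fun h => n1 ⟨hnU, h⟩
    have n2 := not_lt.1 (fun h => n2 ⟨hnU, h⟩)
    have n3 := fun h => n3 ⟨hnU, h⟩
    have n4 := fun h => n4 ⟨hnU, h⟩
    have n5 : ¬ ∀ q ∈ Q, ¬ q ∣ n := fun h => n5 ⟨hnU, h⟩
    push Not at n5
    obtain ⟨p0, hp0, hp0n⟩ := n5
    obtain ⟨hp0a, hp0g⟩ := Finset.mem_filter.1 hp0
    obtain ⟨hp0p, hp0b, hp0c⟩ := mem_PI.1 hp0a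
    set S := n.primeFactors.filter (fun q : ℕ => z < (q:ℝ)) with hS
    have hn0 : n ≠ 0 := by omega
    have hSm : ∀ p ∈ S, p.Prime ∧ p ∣ n ∧ z < (p:ℝ) := fun p hp => by
      obtain ⟨h1, h2⟩ := Finset.mem_filter.1 hp
      exact ⟨Nat.prime_of_mem_primeFactors h1, Nat.dvd_of_mem_primeFactors h1, h2⟩
    have hprod : x^(1-θ) ≤ ∏ p ∈ S, (p:ℝ) := by
      obtain ⟨t, ht1, ht2, ht3⟩ := rough_decomp n z hn
      have htT : (t:ℝ) ≤ T := by
        by_contra hcon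
        exact n1 ⟨t, not_le.1 hcon, ht2⟩
      have ht3R : (n:ℝ) ≤ (t:ℝ)^2 * ((∏ p ∈ S, (p:ℝ)) * ((∏ q ∈ n.primeFactors.filter (fun q : ℕ => ¬ z < (q:ℝ)), q : ℕ):ℝ)) := by
        have ht := (Nat.cast_le (α := ℝ)).2 ht3
        rw [Nat.cast_mul, Nat.cast_mul, Nat.cast_pow] at ht
        rw [← Nat.cast_prod]
        convert ht
      set P := ∏ p ∈ S, (p:ℝ) with hP
      have hP0 : 0 ≤ P := Finset.prod_nonneg (fun p _ => Nat.cast_nonneg p)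
      have h1 : τ * x ≤ T^2 * (P * W) := by
        refine hnbig.le.trans (ht3R.trans ?_)
        gcongr
      have h2 : x = x^(1-θ) * W * W := by
        rw [hW, ← Real.rpow_add hx0, ← Real.rpow_add hx0]
        rw [show 1 - θ + θ/2 + θ/2 = 1 by ring, Real.rpow_one]
      have h3 : T^2 ≤ W * τ := by rwa [div_le_iff₀ hτ] at hxT
      have hW0 : 0 < W := by linarith
      have h4 : (τ * W * W) * x^(1-θ) ≤ (τ * W * W) * P := by
        calc (τ * W * W) * x^(1-θ) = τ * (x^(1-θ) * W * W) := by ring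
          _ = τ * x := by rw [← h2]
          _ ≤ T^2 * (P*W) := h1
          _ ≤ (W*τ) * (P * W) := by gcongr
          _ = _ := by ring
      exact le_of_mul_le_mul_left h4 (by positivity)
    have hp0S : p0 ∈ S := by
      rw [hS, Finset.mem_filter, Nat.mem_primeFactors]
      refine ⟨⟨hp0p, hp0n, hn0⟩, lt_of_le_of_lt ?_ hp0b⟩
      exact Real.rpow_le_rpow_of_exponent_le hx.le hcc'
    have hres := hfin n hn hnx S (fun p hp => by
      obtain ⟨h1, h2, h3⟩ := hSm p hp
      refine ⟨h1, h2, (hnab p h3).1, (hnab p h3).2, ?_, h3⟩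
      by_contra hcon
      refine n3 ⟨p, Finset.mem_filter.2 ⟨mem_PI.2 ⟨h1, h3, ?_⟩, not_lt.1 hcon⟩, h2⟩
      exact le_trans (by exact_mod_cast Nat.le_of_dvd hn h2) hnx) hprod p0 hp0S hp0g hp0b Y hY1 hYle (by
      intro p hp q hq hne
      by_contra hcon
      exact n4 ⟨p, q, (hSm p hp).1, (hSm q hq).1, hne, (hSm p hp).2.1, (hSm q hq).2.1, not_le.1 hcon⟩) _ hmax
    have hnN : max N0 2 ≤ (n:ℝ) := by
      rw [div_le_iff₀ hτ] at hxN
      linarith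
    have hε : ε n < c'*δ/5 := hN0 n ((le_max_left _ _).trans hnN)
    have hn2 : (2:ℝ) ≤ n := (le_max_right _ _).trans hnN
    have f1 : (n:ℝ)^((8:ℝ)/15 + ε n) < (n:ℝ)^((8:ℝ)/15 + c'*δ/5) :=
      Real.rpow_lt_rpow_of_exponent_lt (by linarith) (by linarith)
    have f2 : (n:ℝ)^((8:ℝ)/15 + c'*δ/5) ≤ x^((8:ℝ)/15 + c'*δ/5) :=
      Real.rpow_le_rpow (by linarith) hnx (by positivity)
    linarith

/-- **Theorem 3.** Let `ε(x)` be a positive-valued function of `x ≥ 1` tending to `0`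
as `x → ∞`, and let `a, b` be nonzero, multiplicatively independent integers. Then for
almost all natural numbers `n` (all but `o(x)` of the `n ≤ x`),
`max{ℓ_a(n), ℓ_b(n), ℓ_{ab}(n), ℓ_{a²b}(n), ℓ_{ab²}(n)} > n^(8/15 + ε(n))`. -/
theorem stmt_6 (ε : ℝ → ℝ) (hεpos : ∀ x : ℝ, 1 ≤ x → 0 < ε x)
    (hεlim : Tendsto ε atTop (nhds 0))
    (a b : ℤ) (ha : a ≠ 0) (hb : b ≠ 0)
    (hind : ∀ m n : ℤ, (a : ℚ) ^ m * (b : ℚ) ^ n = 1 → m = 0 ∧ n = 0) :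
    (fun x : ℝ => (Nat.card {n : ℕ |
        1 ≤ n ∧ (n : ℝ) ≤ x ∧
        (max (max (max (max (ellc a n) (ellc b n)) (ellc (a * b) n))
            (ellc (a ^ 2 * b) n)) (ellc (a * b ^ 2) n) : ℝ)
          ≤ (n : ℝ) ^ ((8 : ℝ) / 15 + ε n)} : ℝ))
      =o[atTop] (fun x : ℝ => x) := by
  rw [isLittleO_iff]
  intro η hη
  filter_upwards [bad_bound ε hεlim a b ha hb hind (η/6) (by positivity), eventually_ge_atTop 0] with x hx hx0
  obtain ⟨B, hB, hmem⟩ := hx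
  rw [Real.norm_of_nonneg (Nat.cast_nonneg _), Real.norm_of_nonneg hx0]
  refine le_trans ?_ (hB.trans (le_of_eq (by ring)))
  have h : Nat.card {n : ℕ |
        1 ≤ n ∧ (n : ℝ) ≤ x ∧
        (max (max (max (max (ellc a n) (ellc b n)) (ellc (a * b) n))
            (ellc (a ^ 2 * b) n)) (ellc (a * b ^ 2) n) : ℝ)
          ≤ (n : ℝ) ^ ((8 : ℝ) / 15 + ε n)} ≤ Nat.card (B : Set ℕ) := by
    apply Nat.card_mono B.finite_toSet
    rintro n ⟨h1, h2, h3⟩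
    exact hmem n h1 h2 h3
  have h2 : Nat.card (B : Set ℕ) = B.card := by simp
  rw [h2] at h
  exact_mod_cast h
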